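/- (Simplicity of the second Dirichlet eigenvalue on nearly degenerate triangles) Let T ⊆ ℝ² be the open triangular region with non-collinear vertices A, B, C, let L be the length of its longest side and S its area, and suppose T is not equilateral and its minimum normalized height 2S/L² (the smallest of the three heights of T after rescaling so that the longest side has length 1) satisfies 2S/L² ≤ (1/2)·tan(π/60). Then the second Dirichlet eigenvalue of the Laplacian on T is simple: λ_1(T) < λ_2(T) < λ_3(T). -/

import Mathlib

open MeasureTheory Real

/-- The k-th Dirichlet eigenvalue of the Laplacian on `Ω ⊆ ℝⁿ`, defined variationally as
the infimum, over all `k`-dimensional subspaces `E` of the space of smooth compactly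
supported functions with support in `Ω`, of the supremum of the Rayleigh quotient
`(∫_Ω ‖∇u‖²) / (∫_Ω u²)` over nonzero `u ∈ E`. -/
noncomputable def dirichletEig {n : ℕ} (Ω : Set (EuclideanSpace ℝ (Fin n))) (k : ℕ) : ℝ :=
  sInf { r : ℝ | ∃ E : Submodule ℝ (EuclideanSpace ℝ (Fin n) → ℝ),
    Module.finrank ℝ E = k ∧
    (∀ u ∈ E, ContDiff ℝ (⊤ : ℕ∞) u ∧ HasCompactSupport u ∧ tsupport u ⊆ Ω) ∧
    r = sSup { q : ℝ | ∃ u ∈ E, u ≠ (0 : EuclideanSpace ℝ (Fin n) → ℝ) ∧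
        q = (∫ x in Ω, ‖gradient u x‖ ^ 2) / (∫ x in Ω, (u x) ^ 2) } }

/-- Riccati comparison: a subsolution `G` of the Riccati inequality bounds the energy from below. -/
theorem riccati_lower {a b θ : ℝ} (hab : a ≤ b) (hθ : 0 < θ) {f f' G G' w : ℝ → ℝ}
    (hf : ∀ x, HasDerivAt f (f' x) x) (hf' : Continuous f') (hw : Continuous w)
    (hD : ContinuousOn (fun x => G x * f x ^ 2) (Set.Icc a b))
    (hG : ∀ x ∈ Set.Ioo a b, HasDerivAt G (G' x) x)
    (hR : ∀ x ∈ Set.Ioo a b, G' x + θ * G x ^ 2 ≤ w x) :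
    G b * f b ^ 2 - G a * f a ^ 2 ≤ ∫ x in a..b, (f' x ^ 2 / θ + w x * f x ^ 2) := by
  have hfc : Continuous f := continuous_iff_continuousAt.2 fun x => (hf x).continuousAt
  have hInt : Continuous fun x => f' x ^ 2 / θ + w x * f x ^ 2 := by fun_prop
  refine intervalIntegral.sub_le_integral_of_hasDeriv_right_of_le hab hD
    (g' := fun x => G' x * f x ^ 2 + G x * (2 * f x * f' x)) ?_
    (hInt.continuousOn.integrableOn_compact isCompact_Icc) ?_
  · intro x hx
    have := (hG x hx).mul ((hf x).pow 2)
    refine (this.congr_deriv ?_).hasDerivWithinAt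
    simp
  · intro x hx
    have h1 := mul_le_mul_of_nonneg_right (hR x hx) (sq_nonneg (f x))
    have h2 : 0 ≤ (f' x - θ * G x * f x) ^ 2 / θ := by positivity
    have h3 : (f' x - θ * G x * f x) ^ 2 / θ
        = f' x ^ 2 / θ - 2 * G x * f x * f' x + θ * G x ^ 2 * f x ^ 2 := by
      field_simp
      ring
    nlinarith

/-- One-dimensional energy with linear potential `σ x - Λ`. -/
noncomputable def lineEnergy (θ σ Λ : ℝ) (f f' : ℝ → ℝ) (a b : ℝ) : ℝ :=
  ∫ x in a..b, (f' x ^ 2 / θ + (σ * x - Λ) * f x ^ 2)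

theorem lineEnergy_add {θ σ Λ : ℝ} {f f' : ℝ → ℝ} (hf : ∀ x, HasDerivAt f (f' x) x)
    (hf' : Continuous f') (a b c : ℝ) :
    lineEnergy θ σ Λ f f' a b + lineEnergy θ σ Λ f f' b c = lineEnergy θ σ Λ f f' a c := by
  have hfc : Continuous f := continuous_iff_continuousAt.2 fun x => (hf x).continuousAt
  have hInt : Continuous fun x => f' x ^ 2 / θ + (σ * x - Λ) * f x ^ 2 := by fun_prop
  exact intervalIntegral.integral_add_adjacent_intervals (hInt.intervalIntegrable _ _)
    (hInt.intervalIntegrable _ _)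

theorem lineEnergy_reflect (θ σ Λ : ℝ) (f f' : ℝ → ℝ) (a b : ℝ) :
    lineEnergy θ σ Λ f f' (b - a) b
      = ∫ x in (0:ℝ)..a, ((-f' (b - x)) ^ 2 / θ + (σ * (b - x) - Λ) * f (b - x) ^ 2) := by
  have := intervalIntegral.integral_comp_sub_left
    (fun x => f' x ^ 2 / θ + (σ * x - Λ) * f x ^ 2) (a := 0) (b := a) b
  simp only [sub_zero] at this
  unfold lineEnergy
  rw [← this]
  simp

/-- A cubic Riccati piece, read from left to right. -/
theorem lineEnergy_cubic {θ σ Λ : ℝ} (hθ : 0 < θ) {f f' : ℝ → ℝ}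
    (hf : ∀ x, HasDerivAt f (f' x) x) (hf' : Continuous f') (a L g₀ g₁ g₂ g₃ : ℝ) (hL : 0 ≤ L)
    (hR : ∀ s, 0 ≤ s → s ≤ L → g₁ + 2 * g₂ * s + 3 * g₃ * s ^ 2
      + θ * (g₀ + g₁ * s + g₂ * s ^ 2 + g₃ * s ^ 3) ^ 2 ≤ σ * (a + s) - Λ) :
    (g₀ + g₁ * L + g₂ * L ^ 2 + g₃ * L ^ 3) * f (a + L) ^ 2 - g₀ * f a ^ 2
      ≤ lineEnergy θ σ Λ f f' a (a + L) := by
  have hfc : Continuous f := continuous_iff_continuousAt.2 fun x => (hf x).continuousAt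
  have h := riccati_lower (a := a) (b := a + L) (w := fun x => σ * x - Λ) (by linarith) hθ hf hf'
    (by fun_prop)
    (G := fun x => g₀ + g₁ * (x - a) + g₂ * (x - a) ^ 2 + g₃ * (x - a) ^ 3)
    (G' := fun x => g₁ + 2 * g₂ * (x - a) + 3 * g₃ * (x - a) ^ 2) (by fun_prop)
    (fun x _ => by
      have h1 := (hasDerivAt_id x).sub_const a
      have := (((hasDerivAt_const x g₀).add (h1.const_mul g₁)).add ((h1.pow 2).const_mul g₂)).add
        ((h1.pow 3).const_mul g₃)
      refine this.congr_deriv ?_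
      simp; ring)
    (fun x hx => by
      have := hR (x - a) (by linarith [hx.1]) (by linarith [hx.2])
      simpa using this)
  simpa [lineEnergy] using h

/-- A cubic Riccati piece, read from right to left. -/
theorem lineEnergy_cubic_left {θ σ Λ : ℝ} (hθ : 0 < θ) {f f' : ℝ → ℝ}
    (hf : ∀ x, HasDerivAt f (f' x) x) (hf' : Continuous f') (b L g₀ g₁ g₂ g₃ : ℝ) (hL : 0 ≤ L)
    (hR : ∀ s, 0 ≤ s → s ≤ L → g₁ + 2 * g₂ * s + 3 * g₃ * s ^ 2
      + θ * (g₀ + g₁ * s + g₂ * s ^ 2 + g₃ * s ^ 3) ^ 2 ≤ σ * (b - s) - Λ) :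
    (g₀ + g₁ * L + g₂ * L ^ 2 + g₃ * L ^ 3) * f (b - L) ^ 2 - g₀ * f b ^ 2
      ≤ lineEnergy θ σ Λ f f' (b - L) b := by
  have hg : ∀ x, HasDerivAt (fun s => f (b - s)) (-f' (b - x)) x := fun x => by
    simpa using (hf (b - x)).comp_const_sub b x
  have hfc : Continuous f := continuous_iff_continuousAt.2 fun x => (hf x).continuousAt
  have h := riccati_lower (a := 0) (b := L) (w := fun x => σ * (b - x) - Λ) hL hθ hg
    (by fun_prop) (by fun_prop)
    (G := fun x => g₀ + g₁ * x + g₂ * x ^ 2 + g₃ * x ^ 3)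
    (G' := fun x => g₁ + 2 * g₂ * x + 3 * g₃ * x ^ 2) (by fun_prop)
    (fun x _ => by
      have h1 := hasDerivAt_id x
      have := (((hasDerivAt_const x g₀).add (h1.const_mul g₁)).add ((h1.pow 2).const_mul g₂)).add
        ((h1.pow 3).const_mul g₃)
      refine this.congr_deriv ?_
      simp; ring)
    (fun x hx => hR x hx.1.le hx.2.le)
  rw [lineEnergy_reflect]
  simpa using h

/-- Riccati piece starting at a zero of `f`. -/
theorem riccati_singular {L θ B C D : ℝ} (hL : 0 < L) (hθ : 0 < θ) {f f' w : ℝ → ℝ}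
    (hf : ∀ x, HasDerivAt f (f' x) x) (hf' : Continuous f') (hw : Continuous w) (hf0 : f 0 = 0)
    (hR : ∀ s, 0 ≤ s → s ≤ L → (B * s - C * s ^ 2 + D * s ^ 3) ^ 2 - 3 * B + 4 * C * s
      - 5 * D * s ^ 2 ≤ θ * w s) :
    (1 / L - B * L + C * L ^ 2 - D * L ^ 3) / θ * f L ^ 2
      ≤ ∫ x in (0:ℝ)..L, (f' x ^ 2 / θ + w x * f x ^ 2) := by
  have hfc : Continuous f := continuous_iff_continuousAt.2 fun x => (hf x).continuousAt
  have h := riccati_lower (a := 0) (b := L) (w := w) hL.le hθ hf hf' hw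
    (G := fun x => (x⁻¹ - B * x + C * x ^ 2 - D * x ^ 3) / θ)
    (G' := fun x => (-(x ^ 2)⁻¹ - B + 2 * C * x - 3 * D * x ^ 2) / θ) ?_
    (fun x hx => by
      have h1 := hasDerivAt_id x
      have := (((hasDerivAt_inv hx.1.ne').sub (h1.const_mul B)).add
        ((h1.pow 2).const_mul C)).sub ((h1.pow 3).const_mul D)
      refine (this.div_const θ).congr_deriv ?_
      simp; ring)
    (fun x hx => by
      have h1 := hR x hx.1.le hx.2.le
      have hx0 : x ≠ 0 := hx.1.ne'
      have : (-(x ^ 2)⁻¹ - B + 2 * C * x - 3 * D * x ^ 2) / θ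
          + θ * ((x⁻¹ - B * x + C * x ^ 2 - D * x ^ 3) / θ) ^ 2
          = ((B * x - C * x ^ 2 + D * x ^ 3) ^ 2 - 3 * B + 4 * C * x - 5 * D * x ^ 2) / θ := by
        field_simp
        ring
      rw [this, div_le_iff₀ hθ]
      linarith)
  · simpa [hf0] using h
  · have h1 : ContinuousOn (fun x => (x⁻¹ * f x) * f x) (Set.Icc 0 L) := by
      have key : Continuous (fun x => (x⁻¹ * f x) * f x) := by
        rw [continuous_iff_continuousAt]
        intro x
        rcases eq_or_ne x 0 with rfl | hx
        · have h2 : Filter.Tendsto (fun x => x⁻¹ * f x) (nhdsWithin 0 {0}ᶜ) (nhds (f' 0)) := by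
            have := (hasDerivAt_iff_tendsto_slope_zero.1 (hf 0))
            simpa [hf0] using this
          have h3 : Filter.Tendsto (fun x => (x⁻¹ * f x) * f x) (nhdsWithin 0 {0}ᶜ)
              (nhds (f' 0 * f 0)) := h2.mul (hfc.continuousAt.tendsto.mono_left nhdsWithin_le_nhds)
          rw [continuousAt_iff_punctured_nhds]
          simpa [hf0] using h3
        · exact ((continuousAt_inv₀ hx).mul hfc.continuousAt).mul hfc.continuousAt
      exact key.continuousOn
    have h2 : ContinuousOn (fun x => (- B * x + C * x ^ 2 - D * x ^ 3) * f x ^ 2)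
      (Set.Icc 0 L) := by fun_prop
    refine ((h1.add h2).div_const θ).congr fun x _ => ?_
    simp only [Pi.add_apply]
    ring

theorem lineEnergy_singular {θ σ Λ : ℝ} (hθ : 0 < θ) {f f' : ℝ → ℝ}
    (hf : ∀ x, HasDerivAt f (f' x) x) (hf' : Continuous f') (a L B C D : ℝ) (hL : 0 < L)
    (hfa : f a = 0)
    (hR : ∀ s, 0 ≤ s → s ≤ L → (B * s - C * s ^ 2 + D * s ^ 3) ^ 2 - 3 * B + 4 * C * s
      - 5 * D * s ^ 2 ≤ θ * (σ * (a + s) - Λ)) :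
    (1 / L - B * L + C * L ^ 2 - D * L ^ 3) / θ * f (a + L) ^ 2
      ≤ lineEnergy θ σ Λ f f' a (a + L) := by
  have hg : ∀ x, HasDerivAt (fun s => f (a + s)) (f' (a + x)) x := fun x => by
    simpa using (hf (a + x)).comp_const_add a x
  have h := riccati_singular hL hθ hg (by fun_prop) (w := fun s => σ * (a + s) - Λ) (by fun_prop)
    (by simpa using hfa) hR
  have := intervalIntegral.integral_comp_add_left
    (fun x => f' x ^ 2 / θ + (σ * x - Λ) * f x ^ 2) (a := 0) (b := L) a
  simp only [add_zero] at this
  unfold lineEnergy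
  rw [← this]
  exact h

theorem lineEnergy_singular_left {θ σ Λ : ℝ} (hθ : 0 < θ) {f f' : ℝ → ℝ}
    (hf : ∀ x, HasDerivAt f (f' x) x) (hf' : Continuous f') (b L B C D : ℝ) (hL : 0 < L)
    (hfb : f b = 0)
    (hR : ∀ s, 0 ≤ s → s ≤ L → (B * s - C * s ^ 2 + D * s ^ 3) ^ 2 - 3 * B + 4 * C * s
      - 5 * D * s ^ 2 ≤ θ * (σ * (b - s) - Λ)) :
    (1 / L - B * L + C * L ^ 2 - D * L ^ 3) / θ * f (b - L) ^ 2
      ≤ lineEnergy θ σ Λ f f' (b - L) b := by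
  have hg : ∀ x, HasDerivAt (fun s => f (b - s)) (-f' (b - x)) x := fun x => by
    simpa using (hf (b - x)).comp_const_sub b x
  have h := riccati_singular hL hθ hg (by fun_prop) (w := fun s => σ * (b - s) - Λ) (by fun_prop)
    (by simpa using hfb) hR
  rw [lineEnergy_reflect]
  exact h

/-- The free end: beyond `a` the potential dominates `θ k ^ 2`. -/
theorem lineEnergy_tail {θ σ Λ : ℝ} (hθ : 0 < θ) (hσ : 0 ≤ σ) {f f' : ℝ → ℝ}
    (hf : ∀ x, HasDerivAt f (f' x) x) (hf' : Continuous f') (a X k : ℝ) (haX : a ≤ X)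
    (hfX : f X = 0) (hk : θ * k ^ 2 ≤ σ * a - Λ) :
    k * f a ^ 2 ≤ lineEnergy θ σ Λ f f' a X := by
  have hfc : Continuous f := continuous_iff_continuousAt.2 fun x => (hf x).continuousAt
  have h := riccati_lower (a := a) (b := X) (w := fun x => σ * x - Λ) haX hθ hf hf'
    (by fun_prop) (G := fun _ => -k) (G' := fun _ => 0) (by fun_prop)
    (fun x _ => hasDerivAt_const x _)
    (fun x hx => by nlinarith [hx.1])
  simpa [lineEnergy, hfX] using h

theorem second_mode_boundary {M y s c w P p : ℝ} (hM : 0 ≤ M) (hy : 0 ≤ y) (hy2 : y ≤ π / 2)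
    (hs : y / 2 ≤ s) (hc : |c| ≤ 1) (hw : |w| ≤ M * y) (hP : |P| ≤ M * y ^ 3)
    (hp : |p| ≤ M * y) :
    |w * P / s - 3 / 2 * (c * P ^ 2 / s ^ 3) - 1 / 6 * (c * p ^ 2 / s)| ≤ 40 * M ^ 2 * y := by
  rcases hy.eq_or_lt with rfl | hy
  · have h1 : P = 0 := by simpa using hP
    have h2 : p = 0 := by simpa using hp
    simp [h1, h2]
  have hs0 : 0 < s := by linarith
  have hy4 : y ^ 2 ≤ 5 / 2 := by
    have : y ≤ 3.15 / 2 := by linarith [pi_lt_d2]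
    nlinarith
  have e1 : |w * P / s| ≤ 2 * M ^ 2 * y ^ 3 := by
    rw [abs_div, abs_mul, abs_of_pos hs0, div_le_iff₀ hs0]
    calc |w| * |P| ≤ (M * y) * (M * y ^ 3) := by gcongr
      _ = 2 * M ^ 2 * y ^ 3 * (y / 2) := by ring
      _ ≤ _ := by gcongr
  have e2 : |c * P ^ 2 / s ^ 3| ≤ 8 * M ^ 2 * y ^ 3 := by
    rw [abs_div, abs_mul, abs_of_pos (pow_pos hs0 3), div_le_iff₀ (pow_pos hs0 3), abs_pow]
    calc |c| * |P| ^ 2 ≤ 1 * (M * y ^ 3) ^ 2 := by gcongr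
      _ = 8 * M ^ 2 * y ^ 3 * (y / 2) ^ 3 := by ring
      _ ≤ _ := by gcongr
  have e3 : |c * p ^ 2 / s| ≤ 2 * M ^ 2 * y := by
    rw [abs_div, abs_mul, abs_of_pos hs0, div_le_iff₀ hs0, abs_pow]
    calc |c| * |p| ^ 2 ≤ 1 * (M * y) ^ 2 := by gcongr
      _ = 2 * M ^ 2 * y * (y / 2) := by ring
      _ ≤ _ := by gcongr
  have e4 : M ^ 2 * y ^ 3 ≤ 5 / 2 * (M ^ 2 * y) := by
    have := mul_le_mul_of_nonneg_left hy4 (by positivity : 0 ≤ M ^ 2 * y)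
    nlinarith
  rw [abs_le] at *
  constructor <;> nlinarith [e1.1, e1.2, e2.1, e2.2, e3.1, e3.2, e4]

/-- The second Dirichlet mode on `(0, π)`: the component orthogonal to `sin` has Rayleigh
quotient at least `4`. -/
theorem second_mode {p p' : ℝ → ℝ} (hp : ∀ x, HasDerivAt p (p' x) x) (hp' : Continuous p')
    (h0 : p 0 = 0) (hπ : p π = 0) {a : ℝ} (ha : ∫ x in (0:ℝ)..π, p x * sin x = a * (π / 2)) :
    3 * ((∫ x in (0:ℝ)..π, p x ^ 2) - π / 2 * a ^ 2)
      ≤ (∫ x in (0:ℝ)..π, p' x ^ 2) - ∫ x in (0:ℝ)..π, p x ^ 2 := by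
  have hpc : Continuous p := continuous_iff_continuousAt.2 fun x => (hp x).continuousAt
  have hsin2 : ∫ x in (0:ℝ)..π, sin x ^ 2 = π / 2 := by
    rw [integral_sin_sq]; simp
  set w : ℝ → ℝ := fun x => p x - a * sin x with hw
  have hwd : ∀ x, HasDerivAt w (p' x - a * cos x) x := fun x =>
    (hp x).sub ((hasDerivAt_sin x).const_mul a)
  have hwc : Continuous w := by fun_prop
  set P : ℝ → ℝ := fun x => ∫ t in (0:ℝ)..x, w t * sin t with hP
  have hwsc : Continuous fun t => w t * sin t := by fun_prop
  have hPd : ∀ x, HasDerivAt P (w x * sin x) x := fun x =>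
    intervalIntegral.integral_hasDerivAt_right (hwsc.intervalIntegrable _ _)
      (hwsc.stronglyMeasurableAtFilter _ _) hwsc.continuousAt
  have hP0 : P 0 = 0 := by simp [hP]
  have hPπ : P π = 0 := by
    have : ∫ t in (0:ℝ)..π, w t * sin t
        = (∫ t in (0:ℝ)..π, p t * sin t) - a * ∫ t in (0:ℝ)..π, sin t ^ 2 := by
      rw [← intervalIntegral.integral_const_mul, ← intervalIntegral.integral_sub]
      · congr 1; ext t; simp only [hw]; ring
      · exact (hpc.mul continuous_sin).intervalIntegrable _ _
      · exact (by fun_prop : Continuous fun t => a * sin t ^ 2).intervalIntegrable _ _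
    simp only [hP]
    rw [this, ha, hsin2]; ring
  have hInt : ∫ x in (0:ℝ)..π, w x ^ 2 = (∫ x in (0:ℝ)..π, p x ^ 2) - π / 2 * a ^ 2 := by
    have : ∫ t in (0:ℝ)..π, w t ^ 2 = (∫ t in (0:ℝ)..π, p t ^ 2)
        - (2 * a) * (∫ t in (0:ℝ)..π, p t * sin t) + a ^ 2 * ∫ t in (0:ℝ)..π, sin t ^ 2 := by
      rw [← intervalIntegral.integral_const_mul, ← intervalIntegral.integral_const_mul,
        ← intervalIntegral.integral_sub, ← intervalIntegral.integral_add]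
      · congr 1; ext t; simp only [hw]; ring
      all_goals exact Continuous.intervalIntegrable (by fun_prop) _ _
    rw [this, ha, hsin2]; ring
  obtain ⟨M, hM⟩ : ∃ M, ∀ x ∈ Set.Icc (0:ℝ) π, |p' x| ≤ M := by
    obtain ⟨M, hM⟩ := isCompact_Icc.exists_bound_of_continuousOn
      (hp'.continuousOn (s := Set.Icc (0:ℝ) π))
    exact ⟨M, fun x hx => by simpa using hM x hx⟩
  have hM0 : 0 ≤ M := (abs_nonneg _).trans (hM 0 ⟨le_rfl, pi_pos.le⟩)
  have hlip : ∀ x ∈ Set.Icc (0:ℝ) π, ∀ y ∈ Set.Icc (0:ℝ) π, |p y - p x| ≤ M * |y - x| := by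
    intro x hx y hy
    have := (convex_Icc (0:ℝ) π).norm_image_sub_le_of_norm_hasDerivWithin_le
      (f := p) (f' := p') (fun z _ => (hp z).hasDerivWithinAt)
      (fun z hz => by simpa using hM z hz) hx hy
    simpa using this
  have hsl : ∀ x, |sin x| ≤ |x| := fun x => abs_sin_le_abs
  have hsr : ∀ x, |sin x| ≤ |π - x| := fun x => by
    rw [← sin_pi_sub]; exact abs_sin_le_abs
  set K := M + |a| with hK
  have hK0 : 0 ≤ K := by positivity
  have hMK : M ≤ K := by simp [hK]
  have hwl : ∀ x ∈ Set.Icc (0:ℝ) π, |w x| ≤ K * x := fun x hx => by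
    have h1 := hlip 0 ⟨le_rfl, pi_pos.le⟩ x hx
    rw [h0, sub_zero, sub_zero, abs_of_nonneg hx.1] at h1
    have h2 := hsl x
    rw [abs_of_nonneg hx.1] at h2
    calc |w x| ≤ |p x| + |a * sin x| := abs_sub _ _
      _ ≤ M * x + |a| * x := by rw [abs_mul]; gcongr
      _ = K * x := by rw [hK]; ring
  have hwr : ∀ x ∈ Set.Icc (0:ℝ) π, |w x| ≤ K * (π - x) := fun x hx => by
    have h1 := hlip π ⟨pi_pos.le, le_rfl⟩ x hx
    rw [hπ, sub_zero, abs_sub_comm x π, abs_of_nonneg (by linarith [hx.2] : 0 ≤ π - x)] at h1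
    have h2 := hsr x
    rw [abs_of_nonneg (by linarith [hx.2] : 0 ≤ π - x)] at h2
    calc |w x| ≤ |p x| + |a * sin x| := abs_sub _ _
      _ ≤ M * (π - x) + |a| * (π - x) := by rw [abs_mul]; gcongr
      _ = K * (π - x) := by rw [hK]; ring
  have hPl : ∀ x ∈ Set.Icc (0:ℝ) π, |P x| ≤ K * x ^ 3 := fun x hx => by
    have := intervalIntegral.norm_integral_le_of_norm_le_const (a := 0) (b := x)
      (f := fun t => w t * sin t) (C := K * x * x) (fun t ht => by
        rw [Set.uIoc_of_le hx.1] at ht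
        have h1 := hwl t ⟨ht.1.le, ht.2.trans hx.2⟩
        have h2 := hsl t
        rw [abs_of_pos ht.1] at h2
        rw [norm_mul, norm_eq_abs, norm_eq_abs]
        have ht2 := ht.2
        have ht1 := ht.1
        exact mul_le_mul (h1.trans (by gcongr)) (h2.trans ht2) (abs_nonneg _) (mul_nonneg hK0 hx.1))
    rw [norm_eq_abs, sub_zero, abs_of_nonneg hx.1] at this
    calc |P x| ≤ _ := this
      _ = K * x ^ 3 := by ring
  have hPr : ∀ x ∈ Set.Icc (0:ℝ) π, |P x| ≤ K * (π - x) ^ 3 := fun x hx => by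
    have h3 : P x = ∫ t in π..x, w t * sin t := by
      have := intervalIntegral.integral_add_adjacent_intervals
        (hwsc.intervalIntegrable (μ := volume) 0 π) (hwsc.intervalIntegrable π x)
      have h4 : ∫ t in (0:ℝ)..π, w t * sin t = 0 := hPπ
      simp only [hP]
      rw [← this, h4, zero_add]
    have := intervalIntegral.norm_integral_le_of_norm_le_const (a := π) (b := x)
      (f := fun t => w t * sin t) (C := K * (π - x) * (π - x)) (fun t ht => by
        rw [Set.uIoc_comm, Set.uIoc_of_le hx.2] at ht
        have h1 := hwr t ⟨hx.1.trans ht.1.le, ht.2⟩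
        have h2 := hsr t
        rw [abs_of_nonneg (by linarith [ht.2] : 0 ≤ π - t)] at h2
        rw [norm_mul, norm_eq_abs, norm_eq_abs]
        have ht2 := ht.2
        have ht1 := ht.1
        have : 0 ≤ K * (π - x) := mul_nonneg hK0 (by linarith)
        have hle : π - t ≤ π - x := by linarith
        refine mul_le_mul (h1.trans (by gcongr)) (h2.trans hle) (abs_nonneg _) this)
    rw [norm_eq_abs, abs_sub_comm x π, abs_of_nonneg (by linarith [hx.2] : 0 ≤ π - x)] at this
    rw [h3]
    calc _ ≤ _ := this
      _ = K * (π - x) ^ 3 := by ring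
  set D : ℝ → ℝ := fun x => w x * P x / sin x - 3 / 2 * (cos x * P x ^ 2 / sin x ^ 3)
    - 1 / 6 * (cos x * p x ^ 2 / sin x) with hD
  have hjord : ∀ x, 0 ≤ x → x ≤ π / 2 → x / 2 ≤ sin x := fun x hx hx2 => by
    have := mul_le_sin hx hx2
    refine le_trans ?_ this
    have : 1 / 2 ≤ 2 / π := by
      rw [div_le_div_iff₀ (by norm_num) pi_pos]; linarith [pi_le_four]
    nlinarith
  have hDl : ∀ x, 0 ≤ x → x ≤ π / 2 → |D x| ≤ 40 * K ^ 2 * x := fun x hx hx2 => by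
    have hmem : x ∈ Set.Icc (0:ℝ) π := ⟨hx, by linarith [pi_pos]⟩
    refine second_mode_boundary hK0 hx hx2 (hjord x hx hx2) (abs_cos_le_one x) (hwl x hmem)
      (hPl x hmem) ?_
    have h1 := hlip 0 ⟨le_rfl, pi_pos.le⟩ x hmem
    rw [h0, sub_zero, sub_zero, abs_of_nonneg hx] at h1
    exact h1.trans (by gcongr)
  have hDr : ∀ x, π / 2 ≤ x → x ≤ π → |D x| ≤ 40 * K ^ 2 * (π - x) := fun x hx hx2 => by
    have hmem : x ∈ Set.Icc (0:ℝ) π := ⟨by linarith [pi_pos], hx2⟩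
    refine second_mode_boundary hK0 (by linarith) (by linarith) ?_ (abs_cos_le_one x) (hwr x hmem)
      (hPr x hmem) ?_
    · have := hjord (π - x) (by linarith) (by linarith)
      rwa [sin_pi_sub] at this
    have h1 := hlip π ⟨pi_pos.le, le_rfl⟩ x hmem
    rw [hπ, sub_zero, abs_sub_comm x π, abs_of_nonneg (by linarith : 0 ≤ π - x)] at h1
    exact h1.trans (mul_le_mul_of_nonneg_right hMK (by linarith))
  have hDd : ∀ x ∈ Set.Ioo (0:ℝ) π, HasDerivAt D
      (((p' x - a * cos x) * P x + w x * (w x * sin x)) / sin x - w x * P x * cos x / sin x ^ 2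
        - 3 / 2 * ((-sin x * P x ^ 2 + cos x * (2 * P x * (w x * sin x))) / sin x ^ 3
          - cos x * P x ^ 2 * (3 * sin x ^ 2 * cos x) / sin x ^ 6)
        - 1 / 6 * ((-sin x * p x ^ 2 + cos x * (2 * p x * p' x)) / sin x
          - cos x * p x ^ 2 * cos x / sin x ^ 2)) x := fun x hx => by
    have hs : sin x ≠ 0 := (sin_pos_of_mem_Ioo hx).ne'
    have e1 := (((hwd x).mul (hPd x)).div (hasDerivAt_sin x) hs)
    have e2 := (((hasDerivAt_cos x).mul ((hPd x).pow 2)).div ((hasDerivAt_sin x).pow 3)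
      (pow_ne_zero 3 hs)).const_mul (3 / 2)
    have e3 := (((hasDerivAt_cos x).mul ((hp x).pow 2)).div (hasDerivAt_sin x) hs).const_mul (1 / 6)
    refine ((e1.sub e2).sub e3).congr_deriv ?_
    simp only [Pi.mul_apply, Pi.pow_apply]
    field_simp
    ring
  have hDc : ContinuousOn D (Set.Icc 0 π) := by
    intro x hx
    rcases hx.1.eq_or_lt with rfl | hx0
    · have hz : D 0 = 0 := by simp [hD]
      have : Filter.Tendsto D (nhdsWithin 0 (Set.Icc 0 π)) (nhds 0) := by
        refine squeeze_zero_norm' (a := fun x => 40 * K ^ 2 * x) ?_ ?_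
        · have hev : ∀ᶠ x in nhdsWithin (0:ℝ) (Set.Icc 0 π), x < π / 2 :=
            nhdsWithin_le_nhds (Iio_mem_nhds (by positivity))
          filter_upwards [hev, self_mem_nhdsWithin] with x hx hx2
          exact hDl x hx2.1 hx.le
        · have : ContinuousAt (fun x : ℝ => 40 * K ^ 2 * x) 0 := by fun_prop
          simpa using this.tendsto.mono_left (nhdsWithin_le_nhds (s := Set.Icc 0 π))
      show Filter.Tendsto D _ (nhds (D 0))
      rw [hz]; exact this
    rcases hx.2.eq_or_lt with rfl | hx1
    · have hz : D π = 0 := by simp [hD]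
      have : Filter.Tendsto D (nhdsWithin π (Set.Icc 0 π)) (nhds 0) := by
        refine squeeze_zero_norm' (a := fun x => 40 * K ^ 2 * (π - x)) ?_ ?_
        · have hev : ∀ᶠ x in nhdsWithin π (Set.Icc 0 π), π / 2 < x :=
            nhdsWithin_le_nhds (Ioi_mem_nhds (by linarith [pi_pos]))
          filter_upwards [hev, self_mem_nhdsWithin] with x hx hx2
          exact hDr x hx.le hx2.2
        · have : ContinuousAt (fun x : ℝ => 40 * K ^ 2 * (π - x)) π := by fun_prop
          simpa using this.tendsto.mono_left (nhdsWithin_le_nhds (s := Set.Icc 0 π))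
      show Filter.Tendsto D _ (nhds (D π))
      rw [hz]; exact this
    · exact (hDd x ⟨hx0, hx1⟩).continuousAt.continuousWithinAt
  have key := intervalIntegral.integral_le_sub_of_hasDeriv_right_of_le pi_pos.le hDc
    (fun x hx => (hDd x hx).hasDerivWithinAt)
    (φ := fun x => 1 / 2 * w x ^ 2 - 1 / 6 * (p' x ^ 2 - p x ^ 2))
    ((by fun_prop : Continuous fun x =>
        1 / 2 * w x ^ 2 - 1 / 6 * (p' x ^ 2 - p x ^ 2)).continuousOn.integrableOn_compact
      isCompact_Icc) (fun x hx => by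
      have hs : 0 < sin x := sin_pos_of_mem_Ioo hx
      have hsc : cos x ^ 2 = 1 - sin x ^ 2 := cos_sq' x
      have hpw : p x = w x + a * sin x := by simp [hw]
      have e : ∀ s c W Q q A : ℝ, s ≠ 0 → c ^ 2 = 1 - s ^ 2 →
          (((q - A * c) * Q + W * (W * s)) / s - W * Q * c / s ^ 2
            - 3 / 2 * ((-s * Q ^ 2 + c * (2 * Q * (W * s))) / s ^ 3
              - c * Q ^ 2 * (3 * s ^ 2 * c) / s ^ 6)
            - 1 / 6 * ((-s * (W + A * s) ^ 2 + c * (2 * (W + A * s) * q)) / s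
              - c * (W + A * s) ^ 2 * c / s ^ 2))
          - (1 / 2 * W ^ 2 - 1 / 6 * (q ^ 2 - (W + A * s) ^ 2))
          = 1 / 6 * (q - c / s * (W + A * s) + 3 * Q / s) ^ 2
            + 1 / 2 * (W - 3 * c * Q / s ^ 2) ^ 2 := by
        intro s c W Q q A hs hc
        field_simp
        ring_nf
      have := e (sin x) (cos x) (w x) (P x) (p' x) a hs.ne' hsc
      rw [← hpw] at this
      have h2 : 0 ≤ 1 / 6 * (p' x - cos x / sin x * p x + 3 * P x / sin x) ^ 2
            + 1 / 2 * (w x - 3 * cos x * P x / sin x ^ 2) ^ 2 := by positivity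
      linarith)
  have hz0 : D 0 = 0 := by simp [hD]
  have hzπ : D π = 0 := by simp [hD]
  rw [hz0, hzπ, intervalIntegral.integral_sub, intervalIntegral.integral_const_mul,
    intervalIntegral.integral_const_mul, intervalIntegral.integral_sub, hInt] at key
  · linarith
  all_goals exact Continuous.intervalIntegrable (by fun_prop) _ _

theorem sq_integral_mul_le {a b : ℝ} (hab : a ≤ b) {f g : ℝ → ℝ} (hf : Continuous f)
    (hg : Continuous g) {G : ℝ} (hG : ∫ x in a..b, g x ^ 2 = G) (hG0 : 0 < G) :
    (∫ x in a..b, f x * g x) ^ 2 ≤ (∫ x in a..b, f x ^ 2) * G := by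
  have h2 : ∀ I : ℝ, ∫ x in a..b, (G * f x - I * g x) ^ 2
      = G ^ 2 * (∫ x in a..b, f x ^ 2) - (2 * G * I) * (∫ x in a..b, f x * g x)
        + I ^ 2 * ∫ x in a..b, g x ^ 2 := by
    intro I
    rw [← intervalIntegral.integral_const_mul, ← intervalIntegral.integral_const_mul,
      ← intervalIntegral.integral_const_mul,
      ← intervalIntegral.integral_sub, ← intervalIntegral.integral_add]
    · congr 1; ext t; ring
    all_goals exact Continuous.intervalIntegrable (by fun_prop) _ _
  have h1 := fun I : ℝ => intervalIntegral.integral_nonneg (μ := volume) hab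
    (f := fun x => (G * f x - I * g x) ^ 2) fun x _ => sq_nonneg _
  specialize h1 (∫ x in a..b, f x * g x)
  rw [h2, hG] at h1
  set I := ∫ x in a..b, f x * g x
  by_contra hcon
  push Not at hcon
  nlinarith [mul_pos hG0 (sub_pos.2 hcon)]

theorem integral_twist_sq :
    ∫ t in (0:ℝ)..π, (1 / 2 * sin t + t * cos t) ^ 2 = π ^ 3 / 6 + π / 8 := by
  have h : ∀ t : ℝ, HasDerivAt (fun t : ℝ => t ^ 3 / 6 + t / 8 - sin t * cos t / 8
      + t ^ 2 / 2 * (sin t * cos t))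
      ((1 / 2 * sin t + t * cos t) ^ 2) t := by
    intro t
    have h1 := ((hasDerivAt_id t).pow 3).div_const 6
    have h2 := (hasDerivAt_id t).div_const 8
    have h3 := ((hasDerivAt_sin t).mul (hasDerivAt_cos t)).div_const 8
    have h5 := (((hasDerivAt_id t).pow 2).div_const 2).mul
      ((hasDerivAt_sin t).mul (hasDerivAt_cos t))
    refine (((h1.add h2).sub h3).add h5).congr_deriv ?_
    have hsc : cos t ^ 2 = 1 - sin t ^ 2 := cos_sq' t
    simp
    ring_nf
    simp only [hsc]
    ring
  rw [intervalIntegral.integral_eq_sub_of_hasDerivAt (fun t _ => h t)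
    (Continuous.intervalIntegrable (by fun_prop) _ _)]
  simp

theorem integral_sin_mul_twist :
    ∫ t in (0:ℝ)..π, sin t * (1 / 2 * sin t + t * cos t) = 0 := by
  have h : ∀ t : ℝ, HasDerivAt (fun t : ℝ => t / 2 * sin t ^ 2)
      (sin t * (1 / 2 * sin t + t * cos t)) t := by
    intro t
    have h4 := (((hasDerivAt_id t).div_const 2).mul ((hasDerivAt_sin t).pow 2))
    refine h4.congr_deriv ?_
    simp
    ring
  rw [intervalIntegral.integral_eq_sub_of_hasDerivAt (fun t _ => h t)
    (Continuous.intervalIntegrable (by fun_prop) _ _)]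
  simp

theorem slice_inequality {p p' q : ℝ → ℝ} (hp : ∀ x, HasDerivAt p (p' x) x) (hp' : Continuous p')
    (hq : Continuous q) (h0 : p 0 = 0) (hπ : p π = 0) {H m ζ E : ℝ} (hH : 0 < H) (hζ : 0 < ζ)
    (hE : E ≤ (4 * π ^ 2 - (π ^ 2 / 3 + 1 / 4) * m ^ 2 / ζ) / H ^ 2) :
    (√(2 * H) / π * ((∫ t in (0:ℝ)..π, q t * sin t)
        + m / H * ∫ t in (0:ℝ)..π, p t * (1 / 2 * sin t + t * cos t))) ^ 2 / (1 + ζ)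
      + (π ^ 2 / H ^ 2 - E) * (√(2 * H) / π * ∫ t in (0:ℝ)..π, p t * sin t) ^ 2
    ≤ H / π * ∫ t in (0:ℝ)..π, (q t ^ 2 + (π / H * p' t) ^ 2 - E * p t ^ 2) := by
  have hπ0 := pi_pos
  have hpc : Continuous p := continuous_iff_continuousAt.2 fun x => (hp x).continuousAt
  obtain ⟨a, ha⟩ : ∃ a, ∫ t in (0:ℝ)..π, p t * sin t = a * (π / 2) :=
    ⟨(∫ t in (0:ℝ)..π, p t * sin t) / (π / 2), by field_simp⟩
  have hsm := second_mode hp hp' h0 hπ ha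
  have hsin2 : ∫ x in (0:ℝ)..π, sin x ^ 2 = π / 2 := by
    rw [integral_sin_sq]; simp
  set W := (∫ x in (0:ℝ)..π, p x ^ 2) - π / 2 * a ^ 2 with hW
  have hInt : ∫ x in (0:ℝ)..π, (p x - a * sin x) ^ 2 = W := by
    have : ∫ t in (0:ℝ)..π, (p t - a * sin t) ^ 2 = (∫ t in (0:ℝ)..π, p t ^ 2)
        - (2 * a) * (∫ t in (0:ℝ)..π, p t * sin t) + a ^ 2 * ∫ t in (0:ℝ)..π, sin t ^ 2 := by
      rw [← intervalIntegral.integral_const_mul, ← intervalIntegral.integral_const_mul,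
        ← intervalIntegral.integral_sub, ← intervalIntegral.integral_add]
      · congr 1; ext t; ring
      all_goals exact Continuous.intervalIntegrable (by fun_prop) _ _
    rw [this, ha, hsin2, hW]; ring
  have hB : ∫ t in (0:ℝ)..π, p t * (1 / 2 * sin t + t * cos t)
      = ∫ t in (0:ℝ)..π, (p t - a * sin t) * (1 / 2 * sin t + t * cos t) := by
    have : ∫ t in (0:ℝ)..π, (p t - a * sin t) * (1 / 2 * sin t + t * cos t)
        = (∫ t in (0:ℝ)..π, p t * (1 / 2 * sin t + t * cos t))
          - a * ∫ t in (0:ℝ)..π, sin t * (1 / 2 * sin t + t * cos t) := by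
      rw [← intervalIntegral.integral_const_mul, ← intervalIntegral.integral_sub]
      · congr 1; ext t; ring
      all_goals exact Continuous.intervalIntegrable (by fun_prop) _ _
    rw [this, integral_sin_mul_twist]; ring
  have hB2 := sq_integral_mul_le pi_pos.le (f := fun t => p t - a * sin t) (by fun_prop)
    (by fun_prop) integral_twist_sq (by positivity)
  rw [← hB, hInt] at hB2
  have hA2 := sq_integral_mul_le pi_pos.le hq continuous_sin hsin2 (by positivity)
  have hWnn : 0 ≤ W := by
    rw [← hInt]; exact intervalIntegral.integral_nonneg pi_pos.le fun x _ => sq_nonneg _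
  have hsplit : ∫ t in (0:ℝ)..π, (q t ^ 2 + (π / H * p' t) ^ 2 - E * p t ^ 2)
      = (∫ t in (0:ℝ)..π, q t ^ 2) + (π / H) ^ 2 * (∫ t in (0:ℝ)..π, p' t ^ 2)
        - E * ∫ t in (0:ℝ)..π, p t ^ 2 := by
    rw [← intervalIntegral.integral_const_mul, ← intervalIntegral.integral_const_mul,
        ← intervalIntegral.integral_add, ← intervalIntegral.integral_sub]
    · congr 1; ext t; ring
    all_goals exact Continuous.intervalIntegrable (by fun_prop) _ _
  rw [hsplit, ha]
  set A := ∫ t in (0:ℝ)..π, q t * sin t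
  set B := ∫ t in (0:ℝ)..π, p t * (1 / 2 * sin t + t * cos t)
  set Q := ∫ t in (0:ℝ)..π, q t ^ 2
  set D := ∫ t in (0:ℝ)..π, p' t ^ 2
  set V := ∫ t in (0:ℝ)..π, p t ^ 2
  have hsq : √(2 * H) ^ 2 = 2 * H := sq_sqrt (by positivity)
  have e1 : (A + m / H * B) ^ 2 / (1 + ζ) ≤ A ^ 2 + (m / H * B) ^ 2 / ζ := by
    rw [div_le_iff₀ (by positivity)]
    have : (A ^ 2 + (m / H * B) ^ 2 / ζ) * (1 + ζ) - (A + m / H * B) ^ 2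
        = (ζ * A - m / H * B) ^ 2 / ζ := by field_simp; ring
    have h2 : 0 ≤ (ζ * A - m / H * B) ^ 2 / ζ := by positivity
    linarith
  have e2 : (m / H * B) ^ 2 / ζ ≤ m ^ 2 / (H ^ 2 * ζ) * (W * (π ^ 3 / 6 + π / 8)) := by
    have : (m / H * B) ^ 2 / ζ = m ^ 2 / (H ^ 2 * ζ) * B ^ 2 := by field_simp
    rw [this]; gcongr
  have e3 : (√(2 * H) / π * (A + m / H * B)) ^ 2 / (1 + ζ)
      ≤ 2 * H / π ^ 2 * (Q * (π / 2) + m ^ 2 / (H ^ 2 * ζ) * (W * (π ^ 3 / 6 + π / 8))) := by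
    have : (√(2 * H) / π * (A + m / H * B)) ^ 2 / (1 + ζ)
        = 2 * H / π ^ 2 * ((A + m / H * B) ^ 2 / (1 + ζ)) := by
      rw [mul_pow, div_pow, hsq]; ring
    rw [this]
    gcongr
    linarith
  have e4 : (√(2 * H) / π * (a * (π / 2))) ^ 2 = H / 2 * a ^ 2 := by
    rw [mul_pow, div_pow, hsq]; field_simp
  rw [e4]
  have e5 : (π / H) ^ 2 * (V + 3 * W) ≤ (π / H) ^ 2 * D := by gcongr; linarith
  have hV : V = W + π / 2 * a ^ 2 := by rw [hW]; ring
  have e6 : E * (H / π * W) ≤ (4 * π ^ 2 - (π ^ 2 / 3 + 1 / 4) * m ^ 2 / ζ) / H ^ 2 * (H / π * W) :=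
    mul_le_mul_of_nonneg_right hE (by positivity)
  have e7 : H / π * ((π / H) ^ 2 * (V + 3 * W)) ≤ H / π * ((π / H) ^ 2 * D) := by gcongr
  have e8 : H / π * (Q + (π / H) ^ 2 * (V + 3 * W) - E * V)
      - (2 * H / π ^ 2 * (Q * (π / 2) + m ^ 2 / (H ^ 2 * ζ) * (W * (π ^ 3 / 6 + π / 8)))
      + (π ^ 2 / H ^ 2 - E) * (H / 2 * a ^ 2))
      = (4 * π ^ 2 - (π ^ 2 / 3 + 1 / 4) * m ^ 2 / ζ) / H ^ 2 * (H / π * W) - E * (H / π * W) := by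
    rw [hV]; field_simp; ring
  linarith

theorem hasDerivAt_intervalIntegral_param {g g' : ℝ → ℝ → ℝ}
    (hg : ∀ x t, HasDerivAt (fun x => g x t) (g' x t) x) (hgc : ∀ x, Continuous (g x))
    (hg' : Continuous (Function.uncurry g')) (a b x : ℝ) :
    HasDerivAt (fun x => ∫ t in a..b, g x t) (∫ t in a..b, g' x t) x := by
  obtain ⟨M, hM⟩ := ((isCompact_Icc (a := x - 1) (b := x + 1)).prod
    (isCompact_uIcc (a := a) (b := b))).exists_bound_of_continuousOn hg'.continuousOn
  have hg'c : ∀ x, Continuous (g' x) := fun x => hg'.comp (by fun_prop : Continuous fun t => (x, t))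
  refine (intervalIntegral.hasDerivAt_integral_of_dominated_loc_of_deriv_le
    (F := g) (F' := g') (bound := fun _ => M) (s := Set.Icc (x - 1) (x + 1))
    (Icc_mem_nhds (by linarith) (by linarith)) (Filter.Eventually.of_forall fun y =>
      (hgc y).aestronglyMeasurable) ((hgc x).intervalIntegrable _ _)
    (hg'c x).aestronglyMeasurable ?_ intervalIntegrable_const ?_).2
  · exact Filter.Eventually.of_forall fun t ht y hy =>
      hM (y, t) ⟨hy, Set.uIoc_subset_uIcc ht⟩
  · exact Filter.Eventually.of_forall fun t _ y _ => hg y t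

/-- Squared length of the gradient of a function on `ℝ × ℝ`. -/
noncomputable def gradSq (v : ℝ × ℝ → ℝ) (z : ℝ × ℝ) : ℝ :=
  (fderiv ℝ v z (1, 0)) ^ 2 + (fderiv ℝ v z (0, 1)) ^ 2

theorem ContDiff.continuous_fderiv_const {u : ℝ × ℝ → ℝ} (hu : ContDiff ℝ (⊤ : ℕ∞) u) (d : ℝ × ℝ) :
    Continuous fun z => fderiv ℝ u z d :=
  (hu.continuous_fderiv (by simp)).clm_apply continuous_const

theorem ContDiff.continuous_gradSq {u : ℝ × ℝ → ℝ} (hu : ContDiff ℝ (⊤ : ℕ∞) u) :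
    Continuous (gradSq u) :=
  ((hu.continuous_fderiv_const _).pow 2).add ((hu.continuous_fderiv_const _).pow 2)

theorem gradSq_eq_zero {u : ℝ × ℝ → ℝ} {z : ℝ × ℝ} (hz : z ∉ tsupport u) : gradSq u z = 0 := by
  simp [gradSq, fderiv_of_notMem_tsupport ℝ hz]

theorem HasCompactSupport.gradSq {u : ℝ × ℝ → ℝ} (hu : HasCompactSupport u) :
    HasCompactSupport (gradSq u) :=
  hu.mono' fun z hz => by
    by_contra h
    exact hz (gradSq_eq_zero h)

theorem ContDiff.integrable_gradSq {u : ℝ × ℝ → ℝ} (hu : ContDiff ℝ (⊤ : ℕ∞) u)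
    (hc : HasCompactSupport u) : Integrable (gradSq u) :=
  hu.continuous_gradSq.integrable_of_hasCompactSupport hc.gradSq

theorem ContDiff.integrable_sq {u : ℝ × ℝ → ℝ} (hu : ContDiff ℝ (⊤ : ℕ∞) u)
    (hc : HasCompactSupport u) : Integrable (fun z => u z ^ 2) :=
  Continuous.integrable_of_hasCompactSupport (by have := hu.continuous; fun_prop)
    (hc.mono fun z hz h => hz (by simp [h]))

theorem ContDiff.hasDerivAt_comp_curve {u : ℝ × ℝ → ℝ} (hu : ContDiff ℝ (⊤ : ℕ∞) u)
    {α β : ℝ → ℝ} {α' β' t : ℝ} (hα : HasDerivAt α α' t) (hβ : HasDerivAt β β' t) :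
    HasDerivAt (fun t => u (α t, β t))
      (α' * fderiv ℝ u (α t, β t) (1, 0) + β' * fderiv ℝ u (α t, β t) (0, 1)) t := by
  have h1 := ((hu.differentiable (by simp)) (α t, β t)).hasFDerivAt.comp_hasDerivAt t
    (hα.prodMk hβ)
  refine h1.congr_deriv ?_
  have : ((α', β') : ℝ × ℝ) = α' • (1, 0) + β' • (0, 1) := by ext <;> simp
  rw [this, map_add, map_smul, map_smul]
  simp

theorem side_reduction {u : ℝ × ℝ → ℝ} (hu : ContDiff ℝ (⊤ : ℕ∞) u) (hc : HasCompactSupport u)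
    {ε e Λ ζ : ℝ} (hε : 0 < ε) (he : 0 < e) (hζ : 0 < ζ) (hΛ : 0 ≤ Λ)
    (hsupp : ∀ z ∈ tsupport u, 0 ≤ z.1 → 0 < z.2 ∧ z.2 < π * √(2 * ε) * (1 - e * z.1))
    (hsmall : 2 * ε * Λ + (π ^ 2 / 3 + 1 / 4) * (2 * ε * e ^ 2) / ζ ≤ 3) :
    ∃ f f' : ℝ → ℝ, (∀ x, HasDerivAt f (f' x) x) ∧ Continuous f' ∧ (∃ X, ∀ x, X ≤ x → f x = 0) ∧
      (∀ x, f x = √(2 * (π * √(2 * ε) * (1 - e * x))) / π *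
        ∫ t in (0:ℝ)..π, u (x, π * √(2 * ε) * (1 - e * x) / π * t) * sin t) ∧
      ∀ Y, 0 ≤ Y → lineEnergy (1 + ζ) (e / ε) Λ f f' 0 Y
        ≤ ∫ x in (0:ℝ)..Y, ∫ y, (gradSq u (x, y) - (1 / (2 * ε) + Λ) * u (x, y) ^ 2) := by
  have hπ := pi_pos
  set h := π * √(2 * ε) with hh
  have hh0 : 0 < h := by positivity
  have hh2 : h ^ 2 = 2 * π ^ 2 * ε := by
    rw [hh, mul_pow, sq_sqrt (by positivity)]; ring
  obtain ⟨X, hX0, heX, hX⟩ : ∃ X, 0 ≤ X ∧ e * X < 1 ∧ ∀ z ∈ tsupport u, z.1 < X := by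
    rcases (tsupport u).eq_empty_or_nonempty with h1 | h1
    · exact ⟨0, le_rfl, by simp, by simp [h1]⟩
    obtain ⟨z, hz, hmax⟩ := hc.isCompact.exists_isMaxOn h1 continuous_fst.continuousOn
    have hz1 : e * z.1 < 1 := by
      by_contra hcon
      push Not at hcon
      have hz0 : 0 ≤ z.1 := by
        by_contra h0; push Not at h0; nlinarith
      have := hsupp z hz hz0
      nlinarith [mul_nonneg hh0.le (sub_nonneg.2 hcon)]
    have hz2 : z.1 < 1 / e := by rw [lt_div_iff₀ he]; linarith
    refine ⟨(max z.1 0 + 1 / e) / 2, by positivity, ?_, fun w hw => ?_⟩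
    · have : max z.1 0 < 1 / e := max_lt hz2 (by positivity)
      have h2 : (max z.1 0 + 1 / e) / 2 < 1 / e := by linarith
      rw [lt_div_iff₀ he] at h2; linarith
    · have : w.1 ≤ z.1 := hmax hw
      have := le_max_left z.1 0
      have : max z.1 0 < 1 / e := max_lt hz2 (by positivity)
      linarith
  set ux : ℝ × ℝ → ℝ := fun z => fderiv ℝ u z (1, 0) with hux
  set uy : ℝ × ℝ → ℝ := fun z => fderiv ℝ u z (0, 1) with huy
  have huxc : Continuous ux := hu.continuous_fderiv_const _
  have huyc : Continuous uy := hu.continuous_fderiv_const _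
  have huc := hu.continuous
  have hzero : ∀ z, z ∉ tsupport u → u z = 0 ∧ ux z = 0 ∧ uy z = 0 := fun z hz =>
    ⟨image_eq_zero_of_notMem_tsupport hz, by simp [hux, fderiv_of_notMem_tsupport ℝ hz],
      by simp [huy, fderiv_of_notMem_tsupport ℝ hz]⟩
  have hzX : ∀ x y, X ≤ x → u (x, y) = 0 ∧ ux (x, y) = 0 ∧ uy (x, y) = 0 := fun x y hx =>
    hzero _ fun hm => absurd (hX _ hm) (not_lt.2 hx)
  set H : ℝ → ℝ := fun x => h * (1 - e * x) with hH
  have hHd : ∀ x, HasDerivAt H (-(h * e)) x := fun x => by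
    have := (((hasDerivAt_id x).const_mul e).const_sub 1).const_mul h
    refine this.congr_deriv ?_
    ring
  have hHc : Continuous H := by fun_prop
  set F : ℝ → ℝ := fun x => ∫ t in (0:ℝ)..π, u (x, H x / π * t) * sin t with hF
  set F' : ℝ → ℝ := fun x => ∫ t in (0:ℝ)..π,
    (ux (x, H x / π * t) + (-(h * e) / π * t) * uy (x, H x / π * t)) * sin t with hF'
  have hFd : ∀ x, HasDerivAt F (F' x) x := fun x => by
    refine hasDerivAt_intervalIntegral_param (g := fun x t => u (x, H x / π * t) * sin t)
      (g' := fun x t => (ux (x, H x / π * t) + (-(h * e) / π * t) * uy (x, H x / π * t)) * sin t)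
      (fun x t => ?_) (fun x => by fun_prop) (by fun_prop) 0 π x
    have := (hu.hasDerivAt_comp_curve (hasDerivAt_id x)
      (((hHd x).div_const π).mul_const t)).mul_const (sin t)
    simpa [hux, huy] using this
  have hFc : Continuous F := continuous_iff_continuousAt.2 fun x => (hFd x).continuousAt
  have hF'c : Continuous F' := by
    refine intervalIntegral.continuous_parametric_intervalIntegral_of_continuous' ?_ _ _
    fun_prop
  have hFX : ∀ x, X ≤ x → F x = 0 := fun x hx => by simp [hF, (hzX x _ hx).1]
  have hF'X : ∀ x, X ≤ x → F' x = 0 := fun x hx => by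
    simp [hF', (hzX x _ hx).2.1, (hzX x _ hx).2.2]
  set c : ℝ → ℝ := fun x => √(2 * H x) / π with hcdef
  set c' : ℝ → ℝ := fun x => -(h * e) / √(2 * H x) / π with hc'def
  have hHpos : ∀ x, x ≤ X → 0 < H x := fun x hx => by
    have : e * x ≤ e * X := by gcongr
    exact mul_pos hh0 (by linarith)
  have hHpos' : ∀ x, x < 1 / e → 0 < H x := fun x hx => by
    rw [lt_div_iff₀ he] at hx
    exact mul_pos hh0 (by linarith)
  have hX1 : X < 1 / e := by rw [lt_div_iff₀ he]; linarith
  have hcd : ∀ x, x < 1 / e → HasDerivAt c (c' x) x := fun x hx => by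
    have h1 := (((hHd x).const_mul 2).sqrt (mul_pos two_pos (hHpos' x hx)).ne').div_const π
    refine h1.congr_deriv ?_
    simp only [hc'def]
    field_simp
  set f : ℝ → ℝ := fun x => c x * F x with hf
  set f' : ℝ → ℝ := fun x => c' x * F x + c x * F' x with hf'
  have hfX : ∀ x, X ≤ x → f x = 0 := fun x hx => by simp [hf, hFX x hx]
  have hf'X : ∀ x, X ≤ x → f' x = 0 := fun x hx => by simp [hf', hFX x hx, hF'X x hx]
  have hfd : ∀ x, HasDerivAt f (f' x) x := fun x => by
    rcases lt_or_ge x (1 / e) with hx | hx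
    · exact (hcd x hx).mul (hFd x)
    · rw [hf'X x (hX1.le.trans hx)]
      refine (hasDerivAt_const x (0:ℝ)).congr_of_eventuallyEq ?_
      filter_upwards [Ioi_mem_nhds (hX1.trans_le hx)] with y hy
      exact hfX y (le_of_lt hy)
  have hf'c : Continuous f' := continuous_iff_continuousAt.2 fun x => by
    rcases lt_or_ge x (1 / e) with hx | hx
    · have hc1 : ContinuousAt c x := (hcd x hx).continuousAt
      have hc2 : ContinuousAt c' x := by
        have : √(2 * H x) ≠ 0 := (sqrt_pos.2 (mul_pos two_pos (hHpos' x hx))).ne'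
        have hs : ContinuousAt (fun x => √(2 * H x)) x := by fun_prop
        exact ((continuousAt_const (y := -(h * e))).div hs this).div_const _
      exact (hc2.mul hFc.continuousAt).add (hc1.mul hF'c.continuousAt)
    · refine (continuousAt_const (y := (0:ℝ))).congr ?_
      filter_upwards [Ioi_mem_nhds (hX1.trans_le hx)] with y hy
      exact (hf'X y (le_of_lt hy)).symm
  refine ⟨f, f', hfd, hf'c, ⟨X, hfX⟩, fun x => rfl, fun Y hY => ?_⟩
  set E := 1 / (2 * ε) + Λ with hE
  have hInt : Integrable (fun z : ℝ × ℝ => gradSq u z - E * u z ^ 2) :=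
    (hu.integrable_gradSq hc).sub ((hu.integrable_sq hc).const_mul E)
  have hint1 : Integrable (fun x => ∫ y, (gradSq u (x, y) - E * u (x, y) ^ 2)) :=
    Integrable.integral_prod_left (f := fun z : ℝ × ℝ => gradSq u z - E * u z ^ 2) hInt
  have hfc : Continuous f := continuous_iff_continuousAt.2 fun x => (hfd x).continuousAt
  refine intervalIntegral.integral_mono_on hY (Continuous.intervalIntegrable (by fun_prop) _ _)
    hint1.intervalIntegrable fun x hx => ?_
  rcases le_or_gt X x with hxX | hxX
  · rw [hfX x hxX, hf'X x hxX]
    have : ∀ y, gradSq u (x, y) - E * u (x, y) ^ 2 = 0 := fun y => by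
      have := hzX x y hxX
      simp only [hux, huy] at this
      simp [gradSq, this]
    simp [this]
  have hHx := hHpos x hxX.le
  set p : ℝ → ℝ := fun t => u (x, H x / π * t) with hp
  set p' : ℝ → ℝ := fun t => H x / π * uy (x, H x / π * t) with hp'
  have hpd : ∀ t, HasDerivAt p (p' t) t := fun t => by
    have := hu.hasDerivAt_comp_curve (hasDerivAt_const t x) ((hasDerivAt_id t).const_mul (H x / π))
    simpa [hux, huy, hp'] using this
  have hp'c : Continuous p' := by fun_prop
  have hpc : Continuous p := by fun_prop
  have hnot : ∀ y, (y ≤ 0 ∨ H x ≤ y) → (x, y) ∉ tsupport u := fun y hy hm => by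
    have := hsupp _ hm hx.1
    simp only [hH] at hy
    rcases hy with hy | hy <;> simp at this <;> linarith
  have hp0 : p 0 = 0 := by simpa [hp] using (hzero _ (hnot 0 (Or.inl le_rfl))).1
  have hpπ : p π = 0 := by
    have : H x / π * π = H x := by field_simp
    simp only [hp, this]
    exact (hzero _ (hnot (H x) (Or.inr le_rfl))).1
  have hEb : E ≤ (4 * π ^ 2 - (π ^ 2 / 3 + 1 / 4) * (h * e) ^ 2 / ζ) / H x ^ 2 := by
    rw [le_div_iff₀ (by positivity)]
    have h1 : H x ≤ h := by
      have : 0 ≤ e * x := mul_nonneg he.le hx.1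
      simp only [hH]; nlinarith
    have h2 : E * H x ^ 2 ≤ E * h ^ 2 := by
      have : 0 ≤ E := by positivity
      gcongr
    have h3 : E * h ^ 2 = π ^ 2 * (1 + 2 * ε * Λ) := by
      rw [hh2, hE]; field_simp
    have h4 : (π ^ 2 / 3 + 1 / 4) * (h * e) ^ 2 / ζ
        = π ^ 2 * ((π ^ 2 / 3 + 1 / 4) * (2 * ε * e ^ 2) / ζ) := by
      rw [mul_pow, hh2]; ring
    rw [h4]
    have h5 := mul_le_mul_of_nonneg_left hsmall (sq_nonneg π)
    linarith
  have hsl := slice_inequality hpd hp'c (q := fun t => ux (x, H x / π * t)) (by fun_prop) hp0 hpπ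
    (m := h * e) hHx hζ hEb
  have hfx : √(2 * H x) / π * ∫ t in (0:ℝ)..π, p t * sin t = f x := rfl
  have hf'x : √(2 * H x) / π * ((∫ t in (0:ℝ)..π, ux (x, H x / π * t) * sin t)
        + h * e / H x * ∫ t in (0:ℝ)..π, p t * (1 / 2 * sin t + t * cos t)) = f' x := by
    have h1 : c' x = -(h * e / (2 * H x)) * c x := by
      simp only [hc'def, hcdef]
      have h2 : √(2 * H x) ^ 2 = 2 * H x := sq_sqrt (by positivity)
      have : √(2 * H x) ≠ 0 := (sqrt_pos.2 (by positivity)).ne'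
      have h3 : H x = √(2 * H x) ^ 2 / 2 := by rw [h2]; ring
      generalize √(2 * H x) = r at *
      rw [h3]; field_simp
    have h2 : F' x = (∫ t in (0:ℝ)..π, ux (x, H x / π * t) * sin t)
        - (h * e / H x) * ∫ t in (0:ℝ)..π, t * p' t * sin t := by
      simp only [hF']
      rw [← intervalIntegral.integral_const_mul, ← intervalIntegral.integral_sub]
      · congr 1; ext t; simp only [hp']; field_simp; ring
      all_goals exact Continuous.intervalIntegrable (by fun_prop) _ _
    have h3 : ∫ t in (0:ℝ)..π, (t * p' t * sin t + p t * (sin t + t * cos t)) = 0 := by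
      have : ∀ t, HasDerivAt (fun t => t * p t * sin t)
          (t * p' t * sin t + p t * (sin t + t * cos t)) t := fun t => by
        refine (((hasDerivAt_id t).mul (hpd t)).mul (hasDerivAt_sin t)).congr_deriv ?_
        simp; ring
      rw [intervalIntegral.integral_eq_sub_of_hasDerivAt (fun t _ => this t)
        (Continuous.intervalIntegrable (by fun_prop) _ _)]
      simp
    rw [intervalIntegral.integral_add (Continuous.intervalIntegrable (by fun_prop) _ _)
      (Continuous.intervalIntegrable (by fun_prop) _ _)] at h3
    have h4 : ∫ t in (0:ℝ)..π, p t * (1 / 2 * sin t + t * cos t)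
        = (∫ t in (0:ℝ)..π, p t * (sin t + t * cos t)) - 1 / 2 * F x := by
      simp only [hF]
      rw [← intervalIntegral.integral_const_mul, ← intervalIntegral.integral_sub]
      · congr 1; ext t; simp only [hp]; ring
      all_goals exact Continuous.intervalIntegrable (by fun_prop) _ _
    have h5 : f' x = c' x * F x + c x * F' x := rfl
    rw [h5, h1, h2, h4]
    have h6 : √(2 * H x) / π = c x := rfl
    rw [h6]
    have h7 : h * e / (2 * H x) = h * e / H x / 2 := by field_simp
    rw [h7]
    generalize h * e / H x = r
    linear_combination (c x * r) * h3
  rw [hfx, hf'x] at hsl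
  have hcv : ∫ y, (gradSq u (x, y) - E * u (x, y) ^ 2)
      = H x / π * ∫ t in (0:ℝ)..π, (ux (x, H x / π * t) ^ 2 + (π / H x * p' t) ^ 2 -
          E * p t ^ 2) := by
    have h1 : ∫ y, (gradSq u (x, y) - E * u (x, y) ^ 2)
        = ∫ y in (0:ℝ)..H x, (gradSq u (x, y) - E * u (x, y) ^ 2) := by
      rw [intervalIntegral.integral_of_le hHx.le]
      refine (setIntegral_eq_integral_of_forall_compl_eq_zero fun y hy => ?_).symm
      have hn := hnot y (by
        by_contra hcon
        push Not at hcon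
        exact hy ⟨hcon.1, hcon.2.le⟩)
      rw [gradSq_eq_zero hn, (hzero _ hn).1]; simp
    have h2 := intervalIntegral.smul_integral_comp_mul_left (a := 0) (b := π)
      (fun y => gradSq u (x, y) - E * u (x, y) ^ 2) (H x / π)
    have h3 : H x / π * π = H x := by field_simp
    rw [h3, mul_zero] at h2
    rw [h1, ← h2, smul_eq_mul]
    congr 2
    ext t
    simp only [gradSq, hp, hp', hux, huy]
    field_simp
  rw [hcv]
  refine le_trans ?_ hsl
  have hs : e / ε * x - Λ ≤ π ^ 2 / H x ^ 2 - E := by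
    have h1 : π ^ 2 / H x ^ 2 = 1 / (2 * ε) * (1 / (1 - e * x) ^ 2) := by
      simp only [hH]; rw [mul_pow, hh2]; field_simp
    have hr : 0 < 1 - e * x := by
      have : e * x ≤ e * X := by gcongr
      linarith
    have h2 : 1 + 2 * (e * x) ≤ 1 / (1 - e * x) ^ 2 := by
      rw [le_div_iff₀ (by positivity)]
      have h0 : 0 ≤ e * x := mul_nonneg he.le hx.1
      nlinarith [mul_nonneg (sq_nonneg (e * x)) hr.le, sq_nonneg (e * x)]
    have h3 : 1 / (2 * ε) * (1 + 2 * (e * x)) ≤ 1 / (2 * ε) * (1 / (1 - e * x) ^ 2) := by gcongr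
    have h4 : 1 / (2 * ε) * (1 + 2 * (e * x)) = 1 / (2 * ε) + e / ε * x := by field_simp
    rw [h1, hE]; linarith
  have := mul_le_mul_of_nonneg_right hs (sq_nonneg (f x))
  linarith

/-- The thin triangle in normalized coordinates, with apex above the origin. -/
def thinTri (ε ρ : ℝ) : Set (ℝ × ℝ) :=
  {z | 0 < z.2 ∧ z.2 < π * √(2 * ε) * (1 + ε * z.1) ∧ z.2 < π * √(2 * ε) * (1 - ε / ρ * z.1)}

theorem gradSq_reflect {u : ℝ × ℝ → ℝ} (hu : ContDiff ℝ (⊤ : ℕ∞) u) (z : ℝ × ℝ) :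
    gradSq (fun z => u (-z.1, z.2)) z = gradSq u (-z.1, z.2) := by
  have h1 : HasFDerivAt (fun z : ℝ × ℝ => ((-z.1, z.2) : ℝ × ℝ))
      ((-ContinuousLinearMap.fst ℝ ℝ ℝ).prod (ContinuousLinearMap.snd ℝ ℝ ℝ)) z :=
    (hasFDerivAt_fst.neg).prodMk hasFDerivAt_snd
  have h2 := ((hu.differentiable (by simp)) (-z.1, z.2)).hasFDerivAt.comp z h1
  have h3 : fderiv ℝ (fun z : ℝ × ℝ => u (-z.1, z.2)) z = _ := h2.fderiv
  have h4 : ((-1, 0) : ℝ × ℝ) = -(1, 0) := by simp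
  simp [gradSq, h3, h4, -Prod.neg_mk]

theorem thin_reduction {ε ρ Λ ζL ζR : ℝ} (hε : 0 < ε) (hρ : 0 < ρ) (hΛ : 0 ≤ Λ)
    (hζL : 0 < ζL) (hζR : 0 < ζR)
    (hsL : 2 * ε * Λ + (π ^ 2 / 3 + 1 / 4) * (2 * ε * ε ^ 2) / ζL ≤ 3)
    (hsR : 2 * ε * Λ + (π ^ 2 / 3 + 1 / 4) * (2 * ε * (ε / ρ) ^ 2) / ζR ≤ 3)
    (PL PR : Set ℝ)
    (hcert : ∀ fL fL' fR fR' : ℝ → ℝ, (∀ x, HasDerivAt fL (fL' x) x) → Continuous fL' →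
      (∀ x, HasDerivAt fR (fR' x) x) → Continuous fR' → (∃ X, ∀ x, X ≤ x → fL x = 0) →
      (∃ X, ∀ x, X ≤ x → fR x = 0) → fL 0 = fR 0 → (∀ p ∈ PL, fL p = 0) → (∀ q ∈ PR, fR q = 0) →
      ∃ Y₀, ∀ Y, Y₀ ≤ Y → 0 ≤ lineEnergy (1 + ζL) 1 Λ fL fL' 0 Y
        + lineEnergy (1 + ζR) (1 / ρ) Λ fR fR' 0 Y)
    {u : ℝ × ℝ → ℝ} (hu : ContDiff ℝ (⊤ : ℕ∞) u) (hc : HasCompactSupport u)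
    (hsupp : tsupport u ⊆ thinTri ε ρ)
    (huL : ∀ p ∈ PL,
      ∫ t in (0:ℝ)..π, u (-p, π * √(2 * ε) * (1 - ε * p) / π * t) * sin t = 0)
    (huR : ∀ q ∈ PR,
      ∫ t in (0:ℝ)..π, u (q, π * √(2 * ε) * (1 - ε / ρ * q) / π * t) * sin t = 0) :
    (1 / (2 * ε) + Λ) * ∫ z, u z ^ 2 ≤ ∫ z, gradSq u z := by
  set E := 1 / (2 * ε) + Λ with hE
  set uL : ℝ × ℝ → ℝ := fun z => u (-z.1, z.2) with huLdef
  have huL_smooth : ContDiff ℝ (⊤ : ℕ∞) uL :=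
    hu.comp ((contDiff_fst.neg).prodMk contDiff_snd)
  have hmem : ∀ z, z ∈ tsupport uL → (-z.1, z.2) ∈ tsupport u := fun z hz =>
    tsupport_comp_subset_preimage u (by fun_prop : Continuous fun z : ℝ × ℝ => (-z.1, z.2)) hz
  have huL_compact : HasCompactSupport uL :=
    hc.comp_homeomorph ((Homeomorph.neg ℝ).prodCongr (Homeomorph.refl ℝ))
  obtain ⟨fL, fL', hfL, hfL', hfLX, hfLv, hfLe⟩ := side_reduction huL_smooth huL_compact hε hε hζL
    hΛ (fun z hz _ => by
      obtain ⟨h1, h2, h3⟩ := hsupp (hmem z hz)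
      simp only at h1 h2 h3
      exact ⟨h1, by convert h2 using 2; ring⟩) hsL
  obtain ⟨fR, fR', hfR, hfR', hfRX, hfRv, hfRe⟩ := side_reduction hu hc hε (div_pos hε hρ) hζR
    hΛ (fun z hz _ => by
      obtain ⟨h1, h2, h3⟩ := hsupp hz
      exact ⟨h1, h3⟩) hsR
  obtain ⟨Y₀, hY₀⟩ := hcert fL fL' fR fR' hfL hfL' hfR hfR' hfLX hfRX
    (by rw [hfLv, hfRv]; simp [huLdef])
    (fun p hp => by rw [hfLv]; simp only [huLdef]; rw [huL p hp]; simp)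
    (fun q hq => by rw [hfRv, huR q hq]; simp)
  obtain ⟨R, hR⟩ := hc.isCompact.isBounded.subset_closedBall 0
  set Y := max Y₀ (max R 0 + 1) with hY
  have hY1 : 0 < Y := lt_of_lt_of_le (by positivity) (le_max_right _ _)
  have hYR : R < Y := lt_of_lt_of_le (by linarith [le_max_left R 0]) (le_max_right _ _)
  have hcY := hY₀ Y (le_max_left _ _)
  have h1 := hfLe Y hY1.le
  have h2 := hfRe Y hY1.le
  rw [div_self hε.ne'] at h1
  have hσ : ε / ρ / ε = 1 / ρ := by field_simp
  rw [hσ] at h2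
  set φ : ℝ → ℝ := fun x => ∫ y, (gradSq u (x, y) - E * u (x, y) ^ 2) with hφ
  have hInt : Integrable (fun z : ℝ × ℝ => gradSq u z - E * u z ^ 2) :=
    (hu.integrable_gradSq hc).sub ((hu.integrable_sq hc).const_mul E)
  have hφi : Integrable φ :=
    Integrable.integral_prod_left (f := fun z : ℝ × ℝ => gradSq u z - E * u z ^ 2) hInt
  have hφL : (∫ x in (0:ℝ)..Y, ∫ y, (gradSq uL (x, y) - E * uL (x, y) ^ 2))
      = ∫ x in (-Y)..0, φ x := by
    have := intervalIntegral.integral_comp_neg (a := 0) (b := Y) φ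
    rw [neg_zero] at this
    rw [← this]
    simp only [hφ, huLdef, gradSq_reflect hu]
  have htot : ∫ z, (gradSq u z - E * u z ^ 2) = ∫ x in (-Y)..Y, φ x := by
    have h3 : ∫ z, (gradSq u z - E * u z ^ 2) = ∫ x, φ x := integral_prod _ hInt
    rw [h3, intervalIntegral.integral_of_le (by linarith)]
    refine (setIntegral_eq_integral_of_forall_compl_eq_zero fun x hx => ?_).symm
    have hx2 : Y ≤ |x| := by
      by_contra hcon
      push Not at hcon
      rw [abs_lt] at hcon
      exact hx ⟨hcon.1, hcon.2.le⟩
    have : ∀ y, (x, y) ∉ tsupport u := fun y hy => by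
      have h4 := hR hy
      rw [mem_closedBall_zero_iff] at h4
      have h5 : |x| ≤ ‖((x, y) : ℝ × ℝ)‖ := norm_fst_le ((x, y) : ℝ × ℝ)
      linarith
    simp only [hφ]
    simp [gradSq_eq_zero (this _), image_eq_zero_of_notMem_tsupport (this _)]
  rw [hφL] at h1
  have hadd := intervalIntegral.integral_add_adjacent_intervals
    (hφi.intervalIntegrable (a := -Y) (b := 0)) (hφi.intervalIntegrable (a := 0) (b := Y))
  rw [integral_sub (hu.integrable_gradSq hc) ((hu.integrable_sq hc).const_mul E),
    integral_const_mul, ← hadd] at htot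
  linarith

/-- Smooth compactly supported functions on an open set. -/
structure IsTest {E : Type*} [NormedAddCommGroup E] [NormedSpace ℝ E] (W : Set E) (v : E → ℝ) :
    Prop where
  smooth : ContDiff ℝ (⊤ : ℕ∞) v
  compact : HasCompactSupport v
  supp : tsupport v ⊆ W

theorem IsTest.mono {E : Type*} [NormedAddCommGroup E] [NormedSpace ℝ E] {W W' : Set E} {v : E → ℝ}
    (h : IsTest W v) (hW : W ⊆ W') : IsTest W' v :=
  ⟨h.smooth, h.compact, h.supp.trans hW⟩

/-- The similarity of ratio `s` from `ℝ × ℝ` to the Euclidean plane with given origin and axes. -/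
noncomputable def simChart (b : OrthonormalBasis (Fin 2) ℝ (EuclideanSpace ℝ (Fin 2)))
    (O : EuclideanSpace ℝ (Fin 2)) (s : ℝ) (z : ℝ × ℝ) : EuclideanSpace ℝ (Fin 2) :=
  O + s • (z.1 • b 0 + z.2 • b 1)

/-- The inverse of `simChart`. -/
noncomputable def simChartInv (b : OrthonormalBasis (Fin 2) ℝ (EuclideanSpace ℝ (Fin 2)))
    (O : EuclideanSpace ℝ (Fin 2)) (s : ℝ) (x : EuclideanSpace ℝ (Fin 2)) : ℝ × ℝ :=
  (s⁻¹ * inner ℝ (b 0) (x - O), s⁻¹ * inner ℝ (b 1) (x - O))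

section simChart

variable (b : OrthonormalBasis (Fin 2) ℝ (EuclideanSpace ℝ (Fin 2)))
  (O : EuclideanSpace ℝ (Fin 2)) {s : ℝ}

theorem simChartInv_simChart (hs : s ≠ 0) (z : ℝ × ℝ) :
    simChartInv b O s (simChart b O s z) = z := by
  have h00 : inner ℝ (b 0) (b 0) = 1 := by simp
  have h11 : inner ℝ (b 1) (b 1) = 1 := by simp
  have h01 : inner ℝ (b 0) (b 1) = 0 := b.orthonormal.2 (by decide)
  have h10 : inner ℝ (b 1) (b 0) = 0 := b.orthonormal.2 (by decide)
  simp only [simChartInv, simChart, add_sub_cancel_left, inner_smul_right, inner_add_right, h00,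
    h01, h10, h11]
  ext <;> simp <;> field_simp

theorem simChart_simChartInv (hs : s ≠ 0) (x : EuclideanSpace ℝ (Fin 2)) :
    simChart b O s (simChartInv b O s x) = x := by
  have := b.sum_repr (x - O)
  simp only [Fin.sum_univ_two, b.repr_apply_apply] at this
  simp only [simChart, simChartInv, mul_smul, ← smul_add, smul_inv_smul₀ hs, this]
  simp

theorem contDiff_simChart : ContDiff ℝ (⊤ : ℕ∞) (simChart b O s) := by
  unfold simChart
  fun_prop

theorem contDiff_simChartInv : ContDiff ℝ (⊤ : ℕ∞) (simChartInv b O s) := by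
  unfold simChartInv
  exact (contDiff_const.mul (contDiff_const.inner ℝ (contDiff_id.sub contDiff_const))).prodMk
    (contDiff_const.mul (contDiff_const.inner ℝ (contDiff_id.sub contDiff_const)))

/-- `simChart` as a homeomorphism. -/
noncomputable def simHomeo (hs : s ≠ 0) : (ℝ × ℝ) ≃ₜ EuclideanSpace ℝ (Fin 2) where
  toFun := simChart b O s
  invFun := simChartInv b O s
  left_inv := simChartInv_simChart b O hs
  right_inv := simChart_simChartInv b O hs
  continuous_toFun := (contDiff_simChart b O).continuous
  continuous_invFun := (contDiff_simChartInv b O).continuous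

theorem integral_simChart (hs : s ≠ 0) (g : EuclideanSpace ℝ (Fin 2) → ℝ) :
    ∫ x, g x = s ^ 2 * ∫ z, g (simChart b O s z) := by
  have h1 : ∫ z, g (simChart b O s z)
      = ∫ w : EuclideanSpace ℝ (Fin 2), g (O + s • b.repr.symm w) := by
    have e1 := (volume_preserving_finTwoArrow ℝ).symm.integral_comp'
      (fun v : Fin 2 → ℝ => g (O + s • b.repr.symm (WithLp.toLp 2 v)))
    have e2 := (EuclideanSpace.volume_preserving_symm_measurableEquiv_toLp (Fin 2)).symm.integral_comp'
      (fun w : EuclideanSpace ℝ (Fin 2) => g (O + s • b.repr.symm w))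
    rw [← e2]
    refine Eq.trans ?_ e1
    congr 1
    ext z
    rw [simChart, ← b.sum_repr_symm]
    simp [Fin.sum_univ_two]
  have h2 : ∫ w : EuclideanSpace ℝ (Fin 2), g (O + s • b.repr.symm w)
      = ∫ w : EuclideanSpace ℝ (Fin 2), g (O + s • w) :=
    (b.measurePreserving_repr_symm).integral_comp b.repr.symm.toHomeomorph.measurableEmbedding
      (fun w => g (O + s • w))
  have h3 := Measure.integral_comp_smul (volume : Measure (EuclideanSpace ℝ (Fin 2)))
    (fun w => g (O + w)) s
  rw [integral_add_left_eq_self g O] at h3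
  rw [h1, h2, h3, finrank_euclideanSpace, Fintype.card_fin, smul_eq_mul,
    abs_of_pos (by positivity), ← mul_assoc, mul_inv_cancel₀ (by positivity), one_mul]

theorem gradSq_simChart {u : EuclideanSpace ℝ (Fin 2) → ℝ} (hu : ContDiff ℝ (⊤ : ℕ∞) u)
    (z : ℝ × ℝ) :
    gradSq (fun z => u (simChart b O s z)) z = s ^ 2 * ‖gradient u (simChart b O s z)‖ ^ 2 := by
  have key : ∀ d : ℝ × ℝ, fderiv ℝ (fun z => u (simChart b O s z)) z d
      = fderiv ℝ u (simChart b O s z) (s • (d.1 • b 0 + d.2 • b 1)) := by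
    intro d
    have h1 : HasFDerivAt (simChart b O s)
        (s • ((ContinuousLinearMap.fst ℝ ℝ ℝ).smulRight (b 0)
          + (ContinuousLinearMap.snd ℝ ℝ ℝ).smulRight (b 1))) z := by
      unfold simChart
      exact (((hasFDerivAt_fst.smul_const (b 0)).add
        (hasFDerivAt_snd.smul_const (b 1))).const_smul s).const_add O
    have h2 := ((hu.differentiable (by simp)) (simChart b O s z)).hasFDerivAt.comp z h1
    have h3 : fderiv ℝ (fun z => u (simChart b O s z)) z = _ := h2.fderiv
    rw [h3]
    simp
  rw [← b.sum_sq_inner_right]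
  simp only [gradSq, key, Fin.sum_univ_two, real_inner_comm, inner_gradient_left]
  simp
  ring

end simChart

theorem sq_sum_of_mul_eq_zero {ι : Type*} [Fintype ι] (a : ι → ℝ)
    (h : ∀ i j, i ≠ j → a i * a j = 0) : (∑ i, a i) ^ 2 = ∑ i, a i ^ 2 := by
  classical
  rw [sq, Finset.sum_mul_sum]
  refine Finset.sum_congr rfl fun i _ => ?_
  rw [Finset.sum_eq_single i, sq]
  · intro j _ hj
    exact h i j hj.symm
  · simp

theorem fderiv_sum_smul_apply {ι : Type*} [Fintype ι] {v : ι → ℝ × ℝ → ℝ}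
    (hv : ∀ i, ContDiff ℝ (⊤ : ℕ∞) (v i)) (c : ι → ℝ) (z d : ℝ × ℝ) :
    fderiv ℝ (fun z => ∑ i, c i * v i z) z d = ∑ i, c i * fderiv ℝ (v i) z d := by
  have h : HasFDerivAt (fun z => ∑ i, c i * v i z) (∑ i, c i • fderiv ℝ (v i) z) z :=
    HasFDerivAt.fun_sum fun i _ => (((hv i).differentiable (by simp)) z).hasFDerivAt.const_mul (c i)
  rw [h.fderiv]
  simp

section

variable {b : OrthonormalBasis (Fin 2) ℝ (EuclideanSpace ℝ (Fin 2))}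
  {O : EuclideanSpace ℝ (Fin 2)} {s : ℝ} {Ω : Set (EuclideanSpace ℝ (Fin 2))} {D : Set (ℝ × ℝ)}

theorem IsTest.comp_simChart (hs : s ≠ 0) (hΩ : ∀ z, simChart b O s z ∈ Ω ↔ z ∈ D)
    {u : EuclideanSpace ℝ (Fin 2) → ℝ} (hu : IsTest Ω u) :
        IsTest D (fun z => u (simChart b O s z)) :=
  ⟨hu.smooth.comp (contDiff_simChart b O), hu.compact.comp_homeomorph (simHomeo b O hs),
    fun z hz => (hΩ z).1 (hu.supp
      (tsupport_comp_subset_preimage u (contDiff_simChart b O).continuous hz))⟩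

theorem IsTest.comp_simChartInv (hs : s ≠ 0) (hΩ : ∀ z, simChart b O s z ∈ Ω ↔ z ∈ D)
    {v : ℝ × ℝ → ℝ} (hv : IsTest D v) : IsTest Ω (fun x => v (simChartInv b O s x)) :=
  ⟨hv.smooth.comp (contDiff_simChartInv b O), hv.compact.comp_homeomorph (simHomeo b O hs).symm,
    fun x hx => by
      have := (hΩ _).2 (hv.supp
        (tsupport_comp_subset_preimage v (contDiff_simChartInv b O (s := s)).continuous hx))
      rwa [simChart_simChartInv b O hs] at this⟩

theorem IsTest.sum {ι : Type*} [Fintype ι] {E : Type*} [NormedAddCommGroup E] [NormedSpace ℝ E]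
    {W : Set E} {v : ι → E → ℝ} (hv : ∀ i, IsTest W (v i)) (c : ι → ℝ) :
    IsTest W (fun z => ∑ i, c i * v i z) := by
  have hsub : Function.support (fun z => ∑ i, c i * v i z) ⊆ ⋃ i, tsupport (v i) := fun z hz => by
    by_contra hcon
    simp only [Set.mem_iUnion, not_exists] at hcon
    exact hz (Finset.sum_eq_zero fun i _ => by
      rw [image_eq_zero_of_notMem_tsupport (hcon i), mul_zero])
  have hK : IsCompact (⋃ i, tsupport (v i)) := isCompact_iUnion fun i => (hv i).compact.isCompact
  refine ⟨ContDiff.sum fun i _ => contDiff_const.mul (hv i).smooth,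
    HasCompactSupport.intro hK fun z hz => ?_, ?_⟩
  · by_contra h; exact hz (hsub h)
  · exact (closure_minimal hsub hK.isClosed).trans (Set.iUnion_subset fun i => (hv i).supp)

theorem setIntegral_test (g : EuclideanSpace ℝ (Fin 2) → ℝ) (hg : ∀ x, x ∉ Ω → g x = 0) :
    ∫ x in Ω, g x = ∫ x, g x :=
  setIntegral_eq_integral_of_forall_compl_eq_zero hg

theorem rayleigh_simChart (hs : s ≠ 0) {u : EuclideanSpace ℝ (Fin 2) → ℝ} (hu : IsTest Ω u) :
    (∫ x in Ω, ‖gradient u x‖ ^ 2) / (∫ x in Ω, u x ^ 2)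
      = (∫ z, gradSq (fun z => u (simChart b O s z)) z)
        / (∫ z, u (simChart b O s z) ^ 2) / s ^ 2 := by
  rw [setIntegral_test, setIntegral_test, integral_simChart b O hs, integral_simChart b O hs]
  · simp only [gradSq_simChart b O hu.smooth, integral_const_mul]
    field_simp
  · intro x hx
    rw [image_eq_zero_of_notMem_tsupport fun h => hx (hu.supp h)]; simp
  · intro x hx
    rw [gradient, fderiv_of_notMem_tsupport ℝ fun h => hx (hu.supp h)]; simp

theorem exists_test_subspace (hs : s ≠ 0) (hΩ : ∀ z, simChart b O s z ∈ Ω ↔ z ∈ D)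
    {k : ℕ} {W : Fin k → Set (ℝ × ℝ)} (hWD : ∀ i, W i ⊆ D)
    (hW : ∀ i j, i ≠ j → Disjoint (W i) (W j)) {v : Fin k → ℝ × ℝ → ℝ}
    (hv : ∀ i, IsTest (W i) (v i)) (hv0 : ∀ i, ∃ z, v i z ≠ 0) :
    ∃ E : Submodule ℝ (EuclideanSpace ℝ (Fin 2) → ℝ), Module.finrank ℝ E = k ∧
      (∀ u ∈ E, IsTest Ω u) ∧
      ∀ u ∈ E, ∃ c : Fin k → ℝ, ∀ z, u (simChart b O s z) = ∑ i, c i * v i z := by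
  set w : Fin k → EuclideanSpace ℝ (Fin 2) → ℝ := fun i x => v i (simChartInv b O s x) with hw
  have hsum : ∀ (c : Fin k → ℝ) z, (∑ i, c i • w i) (simChart b O s z) = ∑ i, c i * v i z := by
    intro c z
    simp [hw, simChartInv_simChart b O hs]
  have hli : LinearIndependent ℝ w := by
    rw [Fintype.linearIndependent_iff]
    intro c hc i
    obtain ⟨z, hz⟩ := hv0 i
    have h1 := congrFun hc (simChart b O s z)
    rw [hsum, Finset.sum_eq_single i] at h1
    · simpa [hz] using h1
    · intro j _ hj
      have : z ∉ tsupport (v j) := fun h =>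
        Set.disjoint_left.1 (hW i j hj.symm) ((hv i).supp (subset_tsupport _ hz)) ((hv j).supp h)
      rw [image_eq_zero_of_notMem_tsupport this, mul_zero]
    · simp
  refine ⟨Submodule.span ℝ (Set.range w), ?_, fun u hu => ?_, fun u hu => ?_⟩
  · rw [finrank_span_eq_card hli, Fintype.card_fin]
  · obtain ⟨c, rfl⟩ := (Submodule.mem_span_range_iff_exists_fun ℝ).1 hu
    have := IsTest.sum (fun i => (((hv i).mono (hWD i)).comp_simChartInv hs hΩ)) c
    have h : (∑ i, c i • w i) = fun x => ∑ i, c i * w i x := by ext x; simp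
    rw [h]
    exact this
  · obtain ⟨c, rfl⟩ := (Submodule.mem_span_range_iff_exists_fun ℝ).1 hu
    exact ⟨c, hsum c⟩

theorem rayleigh_set_nonneg {E : Submodule ℝ (EuclideanSpace ℝ (Fin 2) → ℝ)} :
    0 ≤ sSup { q : ℝ | ∃ u ∈ E, u ≠ (0 : EuclideanSpace ℝ (Fin 2) → ℝ) ∧
        q = (∫ x in Ω, ‖gradient u x‖ ^ 2) / (∫ x in Ω, (u x) ^ 2) } := by
  refine Real.sSup_nonneg fun q ⟨u, _, _, hq⟩ => ?_
  rw [hq]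
  exact div_nonneg (integral_nonneg fun x => sq_nonneg _) (integral_nonneg fun x => sq_nonneg _)

theorem dirichletEig_le_of_disjoint (hs : s ≠ 0) (hΩ : ∀ z, simChart b O s z ∈ Ω ↔ z ∈ D)
    {k : ℕ} {W : Fin k → Set (ℝ × ℝ)} (hWD : ∀ i, W i ⊆ D)
    (hW : ∀ i j, i ≠ j → Disjoint (W i) (W j)) {v : Fin k → ℝ × ℝ → ℝ}
    (hv : ∀ i, IsTest (W i) (v i)) (hv0 : ∀ i, ∃ z, v i z ≠ 0) {μ : ℝ} (hμ : 0 ≤ μ)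
    (hle : ∀ i, ∫ z, gradSq (v i) z ≤ μ * ∫ z, v i z ^ 2) :
    dirichletEig Ω k ≤ μ / s ^ 2 := by
  obtain ⟨E, hk, hE, hEv⟩ := exists_test_subspace hs hΩ hWD hW hv hv0
  refine csInf_le_of_le ⟨0, ?_⟩ ⟨E, hk, fun u hu => ⟨(hE u hu).smooth, (hE u hu).compact,
    (hE u hu).supp⟩, rfl⟩ ?_
  · rintro r ⟨E', _, _, rfl⟩
    exact rayleigh_set_nonneg
  refine Real.sSup_le ?_ (by positivity)
  rintro q ⟨u, hu, _, rfl⟩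
  rw [rayleigh_simChart (b := b) (O := O) hs (hE u hu)]
  gcongr
  obtain ⟨c, hc⟩ := hEv u hu
  simp only [hc]
  refine div_le_of_le_mul₀ (integral_nonneg fun x => sq_nonneg _) hμ ?_
  have hzero : ∀ i j, i ≠ j → ∀ z, z ∉ tsupport (v i) ∨ z ∉ tsupport (v j) := fun i j hij z => by
    by_contra hcon
    push Not at hcon
    exact Set.disjoint_left.1 (hW i j hij) ((hv i).supp hcon.1) ((hv j).supp hcon.2)
  have h1 : ∀ z, (∑ i, c i * v i z) ^ 2 = ∑ i, c i ^ 2 * v i z ^ 2 := fun z => by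
    rw [sq_sum_of_mul_eq_zero]
    · simp only [mul_pow]
    · intro i j hij
      rcases hzero i j hij z with h | h <;> simp [image_eq_zero_of_notMem_tsupport h]
  have h2 : ∀ z, gradSq (fun z => ∑ i, c i * v i z) z = ∑ i, c i ^ 2 * gradSq (v i) z := fun z => by
    simp only [gradSq, fderiv_sum_smul_apply fun i => (hv i).smooth]
    rw [sq_sum_of_mul_eq_zero, sq_sum_of_mul_eq_zero, ← Finset.sum_add_distrib]
    · exact Finset.sum_congr rfl fun i _ => by ring
    all_goals
      intro i j hij
      rcases hzero i j hij z with h | h <;> simp [fderiv_of_notMem_tsupport ℝ h]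
  simp only [h1, h2]
  rw [integral_finsetSum _ fun i _ => ((hv i).smooth.integrable_gradSq (hv i).compact).const_mul _,
    integral_finsetSum _ fun i _ => ((hv i).smooth.integrable_sq (hv i).compact).const_mul _,
    Finset.mul_sum]
  refine Finset.sum_le_sum fun i _ => ?_
  rw [integral_const_mul, integral_const_mul]
  nlinarith [mul_le_mul_of_nonneg_left (hle i) (sq_nonneg (c i))]

end

theorem exists_integral_gradSq_le {k : ℕ} {D : Set (ℝ × ℝ)} {w : Fin k → ℝ × ℝ → ℝ}
    (hw : ∀ i, IsTest D (w i)) (hinj : ∀ c : Fin k → ℝ, (∀ z, ∑ i, c i * w i z = 0) → c = 0) :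
    ∃ M : ℝ, ∀ c : Fin k → ℝ, ∫ z, gradSq (fun z => ∑ i, c i * w i z) z
      ≤ M * ∫ z, (∑ i, c i * w i z) ^ 2 := by
  rcases Nat.eq_zero_or_pos k with rfl | hk
  · exact ⟨0, fun c => by simp [gradSq]⟩
  set G := ∫ z, ∑ i, gradSq (w i) z with hG
  have hG0 : 0 ≤ G := integral_nonneg fun z => Finset.sum_nonneg fun i _ => by
    simp only [gradSq]; positivity
  have hInt : ∀ i j, Integrable fun z => w i z * w j z := fun i j =>
    ((hw i).smooth.continuous.mul (hw j).smooth.continuous).integrable_of_hasCompactSupport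
      (hw i).compact.mul_right
  have hN : ∀ c : Fin k → ℝ, ∫ z, (∑ i, c i * w i z) ^ 2
      = ∑ i, ∑ j, c i * c j * ∫ z, w i z * w j z := fun c => by
    have : ∀ z, (∑ i, c i * w i z) ^ 2 = ∑ i, ∑ j, c i * c j * (w i z * w j z) := fun z => by
      rw [sq, Finset.sum_mul_sum]
      exact Finset.sum_congr rfl fun i _ => Finset.sum_congr rfl fun j _ => by ring
    simp only [this]
    rw [integral_finsetSum _ fun i _ => integrable_finsetSum _ fun j _ => (hInt i j).const_mul _]
    refine Finset.sum_congr rfl fun i _ => ?_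
    rw [integral_finsetSum _ fun j _ => (hInt i j).const_mul _]
    exact Finset.sum_congr rfl fun j _ => integral_const_mul _ _
  have hM : ∀ c : Fin k → ℝ, ∫ z, gradSq (fun z => ∑ i, c i * w i z) z ≤ (∑ i, c i ^ 2) * G := by
    intro c
    rw [hG, ← integral_const_mul]
    refine integral_mono ((IsTest.sum hw c).smooth.integrable_gradSq (IsTest.sum hw c).compact)
      ((integrable_finsetSum _ fun i _ =>
        (hw i).smooth.integrable_gradSq (hw i).compact).const_mul _) fun z => ?_
    simp only [gradSq, fderiv_sum_smul_apply fun i => (hw i).smooth, Finset.sum_add_distrib,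
        mul_add]
    exact add_le_add (Finset.sum_mul_sq_le_sq_mul_sq _ _ _) (Finset.sum_mul_sq_le_sq_mul_sq _ _ _)
  have hpos : ∀ c : Fin k → ℝ, c ≠ 0 → 0 < ∫ z, (∑ i, c i * w i z) ^ 2 := by
    intro c hc
    have hc' : ∃ z, ∑ i, c i * w i z ≠ 0 := by
      by_contra hcon
      push Not at hcon
      exact hc (hinj c hcon)
    obtain ⟨z, hz⟩ := hc'
    have ht := IsTest.sum hw c
    refine Continuous.integral_pos_of_hasCompactSupport_nonneg_nonzero (x := z)
      (ht.smooth.continuous.pow 2) ?_ (fun z => sq_nonneg _) (pow_ne_zero 2 hz)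
    exact ht.compact.comp_left (g := fun x : ℝ => x ^ 2) (by simp)
  have : Nonempty (Fin k) := ⟨⟨0, hk⟩⟩
  obtain ⟨c₀, hc₀, hmin⟩ := (isCompact_sphere (0 : EuclideanSpace ℝ (Fin k)) 1).exists_isMinOn
    (NormedSpace.sphere_nonempty.2 zero_le_one)
    (f := fun c => ∑ i, ∑ j, c i * c j * ∫ z, w i z * w j z) (by fun_prop)
  set μ := ∑ i, ∑ j, c₀ i * c₀ j * ∫ z, w i z * w j z with hμ
  have hμ0 : 0 < μ := by
    rw [hμ, ← hN]
    refine hpos _ fun h => ?_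
    have : c₀ = 0 := by ext i; simpa using congrFun h i
    simp [this] at hc₀
  have hlow : ∀ c : Fin k → ℝ, μ * ∑ i, c i ^ 2 ≤ ∫ z, (∑ i, c i * w i z) ^ 2 := by
    intro c
    rcases (Finset.sum_nonneg fun i (_ : i ∈ Finset.univ) => sq_nonneg (c i)).eq_or_lt with h | h
    · rw [← h, mul_zero]
      exact integral_nonneg fun z => sq_nonneg _
    set n := ∑ i, c i ^ 2 with hn
    have h1 := hmin (a := WithLp.toLp 2 fun i => (√n)⁻¹ * c i) (by
      simp only [mem_sphere_zero_iff_norm]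
      rw [EuclideanSpace.norm_eq, Real.sqrt_eq_one]
      simp only [Real.norm_eq_abs, sq_abs, mul_pow, ← Finset.mul_sum, ← hn, inv_pow,
        Real.sq_sqrt h.le]
      field_simp)
    simp only [Set.mem_ofPred_eq] at h1
    have h2 : ∑ i, ∑ j, (√n)⁻¹ * c i * ((√n)⁻¹ * c j) * ∫ z, w i z * w j z
        = n⁻¹ * ∑ i, ∑ j, c i * c j * ∫ z, w i z * w j z := by
      simp only [Finset.mul_sum]
      refine Finset.sum_congr rfl fun i _ => Finset.sum_congr rfl fun j _ => ?_
      have : (√n)⁻¹ * (√n)⁻¹ = n⁻¹ := by rw [← mul_inv, Real.mul_self_sqrt h.le]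
      rw [← this]; ring
    rw [h2, ← hμ, ← hN] at h1
    rw [mul_comm]
    have := mul_le_mul_of_nonneg_left h1 h.le
    rwa [mul_inv_cancel_left₀ h.ne'] at this
  refine ⟨G / μ, fun c => (hM c).trans ?_⟩
  rw [div_mul_eq_mul_div, le_div_iff₀ hμ0]
  nlinarith [mul_le_mul_of_nonneg_left (hlow c) hG0]

theorem exists_isTest_ne_zero {E : Type*} [NormedAddCommGroup E] [NormedSpace ℝ E]
    [FiniteDimensional ℝ E] {W : Set E} (hW : IsOpen W) {z : E} (hz : z ∈ W) :
    ∃ v, IsTest W v ∧ ∃ z, v z ≠ 0 := by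
  obtain ⟨f, hf, hc, hs, _, h1⟩ := exists_contDiff_tsupport_subset (n := (⊤ : ℕ∞)) (hW.mem_nhds hz)
  exact ⟨f, ⟨hs, hc, hf⟩, z, by rw [h1]; exact one_ne_zero⟩

section

variable {b : OrthonormalBasis (Fin 2) ℝ (EuclideanSpace ℝ (Fin 2))}
  {O : EuclideanSpace ℝ (Fin 2)} {s : ℝ} {Ω : Set (EuclideanSpace ℝ (Fin 2))} {D : Set (ℝ × ℝ)}

theorem exists_test_subspace_of_isOpen (hs : s ≠ 0) (hΩ : ∀ z, simChart b O s z ∈ Ω ↔ z ∈ D)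
    (hD : IsOpen D) (hne : D.Nonempty) (k : ℕ) :
    ∃ E : Submodule ℝ (EuclideanSpace ℝ (Fin 2) → ℝ), Module.finrank ℝ E = k ∧
      ∀ u ∈ E, IsTest Ω u := by
  obtain ⟨z, hz⟩ := hne
  obtain ⟨r, hr, hball⟩ := Metric.isOpen_iff.1 hD z hz
  have hk : (0 : ℝ) < k + 1 := by positivity
  set W : Fin k → Set (ℝ × ℝ) := fun i =>
    D ∩ {y | z.1 + r / (k + 1) * i < y.1 ∧ y.1 < z.1 + r / (k + 1) * (i + 1)} with hWdef
  have hWo : ∀ i, IsOpen (W i) := fun i =>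
    hD.inter ((isOpen_lt continuous_const continuous_fst).inter
      (isOpen_lt continuous_fst continuous_const))
  have hWne : ∀ i, (z.1 + r / (k + 1) * (i + 1 / 2), z.2) ∈ W i := by
    intro i
    have hik : (i : ℝ) + 1 ≤ k := by exact_mod_cast i.2
    have hi0 : (0 : ℝ) ≤ i := by positivity
    have hrk : 0 < r / (k + 1) := by positivity
    refine ⟨hball ?_, by dsimp; nlinarith, by dsimp; nlinarith⟩
    rw [Metric.mem_ball, Prod.dist_eq, max_lt_iff]
    refine ⟨?_, by simpa using hr⟩
    rw [Real.dist_eq, add_sub_cancel_left, abs_of_nonneg (by positivity), div_mul_eq_mul_div,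
      div_lt_iff₀ hk]
    nlinarith
  choose v hv hv0 using fun i => exists_isTest_ne_zero (hWo i) (hWne i)
  obtain ⟨E, h1, h2, _⟩ := exists_test_subspace (b := b) (O := O) hs hΩ (W := W)
    (fun i => Set.inter_subset_left) (fun i j hij => by
      rw [Set.disjoint_left]
      rintro y ⟨_, h1, h2⟩ ⟨_, h3, h4⟩
      have hrk : 0 < r / (k + 1) := by positivity
      have h5 : (i : ℝ) < j + 1 := by
        by_contra hcon
        push Not at hcon
        nlinarith
      have h6 : (j : ℝ) < i + 1 := by
        by_contra hcon
        push Not at hcon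
        nlinarith
      norm_cast at h5 h6
      exact hij (Fin.ext (by omega))) hv hv0
  exact ⟨E, h1, h2⟩

/-- A lower bound for the eigenvalue `λ_{m+1}` from a bound for the test functions satisfying
`m` linear constraints. -/
theorem le_dirichletEig (hs : s ≠ 0) (hΩ : ∀ z, simChart b O s z ∈ Ω ↔ z ∈ D)
    (hD : IsOpen D) (hne : D.Nonempty) {m : ℕ} (c a : Fin m → ℝ) {μ : ℝ}
    (h : ∀ v, IsTest D v → (∀ j, ∫ t in (0 : ℝ)..π, v (c j, a j * t) * sin t = 0) →
      μ * ∫ z, v z ^ 2 ≤ ∫ z, gradSq v z) :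
    μ / s ^ 2 ≤ dirichletEig Ω (m + 1) := by
  refine le_csInf ?_ ?_
  · obtain ⟨E, h1, h2⟩ := exists_test_subspace_of_isOpen (b := b) (O := O) hs hΩ hD hne (m + 1)
    exact ⟨_, E, h1, fun u hu => ⟨(h2 u hu).smooth, (h2 u hu).compact, (h2 u hu).supp⟩, rfl⟩
  rintro r ⟨E, hE, hT, rfl⟩
  have hT' : ∀ u ∈ E, IsTest Ω u := fun u hu => ⟨(hT u hu).1, (hT u hu).2.1, (hT u hu).2.2⟩
  have hTD : ∀ u ∈ E, IsTest D fun z => u (simChart b O s z) := fun u hu =>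
    (hT' u hu).comp_simChart hs hΩ
  have : Module.Finite ℝ E := Module.finite_of_finrank_pos (by omega)
  have hsurj : ∀ u : EuclideanSpace ℝ (Fin 2) → ℝ, (∀ z, u (simChart b O s z) = 0) → u = 0 := by
    intro u hu
    ext x
    rw [← simChart_simChartInv b O hs x, hu]; rfl
  have hci : ∀ u ∈ E, ∀ j, IntervalIntegrable
      (fun t => u (simChart b O s (c j, a j * t)) * sin t) volume 0 π := fun u hu j =>
    (Continuous.mul ((hTD u hu).smooth.continuous.comp
      (by fun_prop : Continuous fun t : ℝ => (c j, a j * t))) continuous_sin).intervalIntegrable _ _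
  let f : E →ₗ[ℝ] (Fin m → ℝ) :=
    { toFun := fun u j => ∫ t in (0 : ℝ)..π,
        (u : EuclideanSpace ℝ (Fin 2) → ℝ) (simChart b O s (c j, a j * t)) * sin t
      map_add' := fun u v => by
        ext j
        simp only [Submodule.coe_add, Pi.add_apply, add_mul]
        exact intervalIntegral.integral_add (hci u u.2 j) (hci v v.2 j)
      map_smul' := fun r u => by
        ext j
        simp [mul_assoc] }
  obtain ⟨u, huf, hu0⟩ := (Submodule.ne_bot_iff _).1
    (LinearMap.ker_ne_bot_of_finrank_lt (f := f) (by simp [hE]))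
  have hv := hTD u u.2
  have hu0' : (u : EuclideanSpace ℝ (Fin 2) → ℝ) ≠ 0 := fun h => hu0 (Subtype.ext h)
  have hpos : 0 < ∫ z, (u : EuclideanSpace ℝ (Fin 2) → ℝ) (simChart b O s z) ^ 2 := by
    have : ∃ z, (u : EuclideanSpace ℝ (Fin 2) → ℝ) (simChart b O s z) ≠ 0 := by
      by_contra hcon
      push Not at hcon
      exact hu0' (hsurj _ hcon)
    obtain ⟨z, hz⟩ := this
    refine Continuous.integral_pos_of_hasCompactSupport_nonneg_nonzero (x := z)
      (hv.smooth.continuous.pow 2) ?_ (fun z => sq_nonneg _) (pow_ne_zero 2 hz)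
    exact hv.compact.comp_left (g := fun x : ℝ => x ^ 2) (by simp)
  have hbdd : BddAbove { q : ℝ | ∃ u ∈ E, u ≠ (0 : EuclideanSpace ℝ (Fin 2) → ℝ) ∧
        q = (∫ x in Ω, ‖gradient u x‖ ^ 2) / (∫ x in Ω, (u x) ^ 2) } := by
    let e := Module.finBasis ℝ E
    obtain ⟨M, hM⟩ := exists_integral_gradSq_le (fun i => hTD (e i) (e i).2) (fun c hc => by
      have h1 : ∑ i, c i • e i = 0 := by
        apply Subtype.ext
        refine hsurj _ fun z => ?_
        rw [← hc z]
        simp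
      exact funext (Fintype.linearIndependent_iff.1 e.linearIndependent c h1))
    refine ⟨max M 0 / s ^ 2, ?_⟩
    rintro q ⟨w, hw, _, rfl⟩
    rw [rayleigh_simChart (b := b) (O := O) hs (hT' w hw)]
    gcongr
    refine div_le_of_le_mul₀ (integral_nonneg fun x => sq_nonneg _) (le_max_right _ _) ?_
    have h2 : ∀ z, w (simChart b O s z) = ∑ i, e.repr ⟨w, hw⟩ i *
        (e i : EuclideanSpace ℝ (Fin 2) → ℝ) (simChart b O s z) := fun z => by
      have h3 := congrArg (fun u : E => (u : EuclideanSpace ℝ (Fin 2) → ℝ) (simChart b O s z))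
        (e.sum_repr ⟨w, hw⟩)
      simp only [Submodule.coe_sum, Submodule.coe_smul, Finset.sum_apply, Pi.smul_apply,
        smul_eq_mul] at h3
      exact h3.symm
    simp only [h2]
    refine (hM _).trans ?_
    exact mul_le_mul_of_nonneg_right (le_max_left _ _) (integral_nonneg fun x => sq_nonneg _)
  refine le_csSup_of_le hbdd ⟨u, u.2, hu0', rfl⟩ ?_
  rw [rayleigh_simChart (b := b) (O := O) hs (hT' u u.2)]
  gcongr
  rw [le_div_iff₀ hpos]
  exact h _ hv fun j => congrFun (LinearMap.mem_ker.1 huf) j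

end

theorem integral_slice_sq {G : ℝ} (hG : 0 < G) (p : ℝ) :
    ∫ y in (0 : ℝ)..G, (p * √(2 / G) * sin (y * (π / G))) ^ 2 = p ^ 2 := by
  have hq : √(2 / G) ^ 2 = 2 / G := Real.sq_sqrt (by positivity)
  have h := intervalIntegral.integral_comp_mul_right (a := 0) (b := G)
    (fun t => (p * √(2 / G) * sin t) ^ 2) (c := π / G) (by positivity)
  rw [h]
  simp only [mul_pow, intervalIntegral.integral_const_mul, integral_sin_sq, hq]
  rw [show G * (π / G) = π by field_simp]
  simp
  field_simp

theorem integral_slice_grad {G : ℝ} (hG : 0 < G) (p p' G' : ℝ) :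
    ∫ y in (0 : ℝ)..G, ((p' * √(2 / G) * sin (y * (π / G)) - p * √(2 / G) * (G' / G) *
        (1 / 2 * sin (y * (π / G)) + y * (π / G) * cos (y * (π / G)))) ^ 2
      + (p * √(2 / G) * (π / G) * cos (y * (π / G))) ^ 2)
    = p' ^ 2 + (π ^ 2 + (π ^ 2 / 3 + 1 / 4) * G' ^ 2) / G ^ 2 * p ^ 2 := by
  have hq : √(2 / G) ^ 2 = 2 / G := Real.sq_sqrt (by positivity)
  have h := intervalIntegral.integral_comp_mul_right (a := 0) (b := G)
    (fun t => (p' * √(2 / G) * sin t - p * √(2 / G) * (G' / G) *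
        (1 / 2 * sin t + t * cos t)) ^ 2
      + (p * √(2 / G) * (π / G) * cos t) ^ 2) (c := π / G) (by positivity)
  rw [h, show G * (π / G) = π by field_simp, zero_mul]
  have hexp : ∀ t, (p' * √(2 / G) * sin t - p * √(2 / G) * (G' / G) *
        (1 / 2 * sin t + t * cos t)) ^ 2
      + (p * √(2 / G) * (π / G) * cos t) ^ 2
      = p' ^ 2 * (2 / G) * sin t ^ 2 - 2 * p * p' * (2 / G) * (G' / G)
        * (sin t * (1 / 2 * sin t + t * cos t))
        + p ^ 2 * (2 / G) * (G' / G) ^ 2 * (1 / 2 * sin t + t * cos t) ^ 2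
        + p ^ 2 * (2 / G) * (π / G) ^ 2 * cos t ^ 2 := fun t => by
    linear_combination (p' ^ 2 * sin t ^ 2 - 2 * p * p' * (G' / G) *
      (sin t * (1 / 2 * sin t + t * cos t)) + p ^ 2 * (G' / G) ^ 2 *
      (1 / 2 * sin t + t * cos t) ^ 2 + p ^ 2 * (π / G) ^ 2 * cos t ^ 2) * hq
  simp only [hexp]
  have hi : ∀ f : ℝ → ℝ, Continuous f → IntervalIntegrable f volume 0 π := fun f hf =>
    hf.intervalIntegrable _ _
  rw [intervalIntegral.integral_add (hi _ (by fun_prop)) (hi _ (by fun_prop)),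
    intervalIntegral.integral_add (hi _ (by fun_prop)) (hi _ (by fun_prop)),
    intervalIntegral.integral_sub (hi _ (by fun_prop)) (hi _ (by fun_prop))]
  simp only [intervalIntegral.integral_const_mul, integral_twist_sq, integral_sin_mul_twist,
    integral_sin_sq, integral_cos_sq]
  simp
  field_simp
  ring

/-- A smooth truncation of the identity. -/
theorem exists_smooth_truncation {δ : ℝ} (hδ : 0 < δ) :
    ∃ F : ℝ → ℝ, ContDiff ℝ (⊤ : ℕ∞) F ∧ (∀ x, x ≤ δ → F x = 0) ∧
      (∀ x, 0 ≤ deriv F x ∧ deriv F x ≤ 1) ∧ ∀ x, 0 ≤ x →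
          x ^ 2 - 2 * δ * (x ^ 2 + 1) ≤ F x ^ 2 := by
  set f : ℝ → ℝ := fun t => Real.smoothTransition (t / δ - 1) with hf
  have hfs : ContDiff ℝ (⊤ : ℕ∞) f := Real.smoothTransition.contDiff.comp (by fun_prop)
  set F : ℝ → ℝ := fun x => ∫ t in δ..x, f t with hF
  have hd : ∀ x, HasDerivAt F (f x) x := fun x =>
    hfs.continuous.integral_hasStrictDerivAt δ x |>.hasDerivAt
  have hderiv : deriv F = f := funext fun x => (hd x).deriv
  have hmono : Monotone F := monotone_of_hasDerivAt_nonneg hd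
      fun x => Real.smoothTransition.nonneg _
  refine ⟨F, ?_, fun x hx => ?_, fun x => ?_, fun x hx => ?_⟩
  · rw [contDiff_infty_iff_deriv, hderiv]
    exact ⟨fun x => (hd x).differentiableAt, hfs⟩
  · refine (intervalIntegral.integral_congr (g := fun _ => (0 : ℝ)) fun t ht => ?_).trans (by simp)
    rw [Set.uIcc_of_ge hx] at ht
    refine Real.smoothTransition.zero_of_nonpos ?_
    rw [sub_nonpos, div_le_one hδ]; exact ht.2
  · rw [hderiv]
    exact ⟨Real.smoothTransition.nonneg _, Real.smoothTransition.le_one _⟩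
  · have hF0 : ∀ y, δ ≤ y → 0 ≤ F y := fun y hy => by
      have := hmono hy
      simpa [hF] using this
    rcases le_total x (2 * δ) with h | h
    · nlinarith [sq_nonneg (F x), sq_nonneg (x - 1), mul_nonneg hx (sub_nonneg.2 h)]
    · have h1 : x - 2 * δ ≤ F x := by
        have h2 : ∫ t in (2 * δ)..x, f t = x - 2 * δ := by
          refine (intervalIntegral.integral_congr (g := fun _ => (1 : ℝ)) fun t ht => ?_).trans
            (by simp)
          rw [Set.uIcc_of_le h] at ht
          refine Real.smoothTransition.one_of_one_le ?_
          rw [le_sub_iff_add_le, le_div_iff₀ hδ]; linarith [ht.1]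
        have h3 : F (2 * δ) + ∫ t in (2 * δ)..x, f t = F x :=
          intervalIntegral.integral_add_adjacent_intervals
            (hfs.continuous.intervalIntegrable _ _) (hfs.continuous.intervalIntegrable _ _)
        linarith [hF0 (2 * δ) (by linarith)]
      have h4 : (x - 2 * δ) ^ 2 ≤ F x ^ 2 := by gcongr
      nlinarith [sq_nonneg (x - 1)]

/-- The region under the graph of `g` between two verticals. -/
def underGraph (g : ℝ → ℝ) (x₁ x₂ : ℝ) : Set (ℝ × ℝ) :=
  {z | x₁ < z.1 ∧ z.1 < x₂ ∧ 0 < z.2 ∧ z.2 < g z.1}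

theorem setIntegral_underGraph {g : ℝ → ℝ} (hg : Continuous g) {x₁ x₂ : ℝ} (hx : x₁ ≤ x₂)
    (hpos : ∀ x ∈ Set.Icc x₁ x₂, 0 < g x) {f : ℝ × ℝ → ℝ}
    (hf : IntegrableOn f (underGraph g x₁ x₂)) :
    ∫ z in underGraph g x₁ x₂, f z = ∫ x in x₁..x₂, ∫ y in (0 : ℝ)..g x, f (x, y) := by
  have hm : MeasurableSet (underGraph g x₁ x₂) := by
    have ho : IsOpen (underGraph g x₁ x₂) :=
      (isOpen_lt continuous_const continuous_fst).inter <|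
        (isOpen_lt continuous_fst continuous_const).inter <|
        (isOpen_lt continuous_const continuous_snd).inter
          (isOpen_lt continuous_snd (hg.comp continuous_fst))
    exact ho.measurableSet
  rw [← integral_indicator hm]
  rw [← integrable_indicator_iff hm] at hf
  rw [Measure.volume_eq_prod] at hf ⊢
  rw [integral_prod _ hf, intervalIntegral.integral_of_le hx, integral_Ioc_eq_integral_Ioo,
    ← integral_indicator measurableSet_Ioo]
  refine integral_congr_ae (Filter.Eventually.of_forall fun x => ?_)
  by_cases hxm : x ∈ Set.Ioo x₁ x₂
  · rw [Set.indicator_of_mem hxm, intervalIntegral.integral_of_le (hpos x ⟨hxm.1.le, hxm.2.le⟩).le,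
      integral_Ioc_eq_integral_Ioo, ← integral_indicator measurableSet_Ioo]
    refine integral_congr_ae (Filter.Eventually.of_forall fun y => ?_)
    have : (x, y) ∈ underGraph g x₁ x₂ ↔ y ∈ Set.Ioo 0 (g x) :=
      ⟨fun h => ⟨h.2.2.1, h.2.2.2⟩, fun h => ⟨hxm.1, hxm.2, h.1, h.2⟩⟩
    by_cases hy : y ∈ Set.Ioo 0 (g x)
    · simp only [Set.indicator_of_mem hy, Set.indicator_of_mem (this.2 hy)]
    · simp only [Set.indicator_of_notMem hy, Set.indicator_of_notMem (fun h => hy (this.1 h))]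
  · rw [Set.indicator_of_notMem hxm]
    refine integral_eq_zero_of_ae (Filter.Eventually.of_forall fun y => ?_)
    exact Set.indicator_of_notMem (fun h => hxm ⟨h.1, h.2.1⟩) _

theorem isOpen_underGraph {g : ℝ → ℝ} (hg : Continuous g) (x₁ x₂ : ℝ) :
    IsOpen (underGraph g x₁ x₂) :=
  (isOpen_lt continuous_const continuous_fst).inter <|
    (isOpen_lt continuous_fst continuous_const).inter <|
    (isOpen_lt continuous_const continuous_snd).inter
      (isOpen_lt continuous_snd (hg.comp continuous_fst))

/-- The closed region under a graph. -/
theorem isCompact_closed_underGraph {g : ℝ → ℝ} (hg : Continuous g) (x₁ x₂ : ℝ) :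
    IsCompact {z : ℝ × ℝ | x₁ ≤ z.1 ∧ z.1 ≤ x₂ ∧ 0 ≤ z.2 ∧ z.2 ≤ g z.1} := by
  obtain ⟨M, hM⟩ := (isCompact_Icc (a := x₁) (b := x₂)).bddAbove_image hg.continuousOn
  refine IsCompact.of_isClosed_subset
    ((isCompact_Icc (a := x₁) (b := x₂)).prod (isCompact_Icc (a := (0 : ℝ)) (b := M))) ?_ ?_
  · exact (isClosed_le continuous_const continuous_fst).inter <|
      (isClosed_le continuous_fst continuous_const).inter <|
      (isClosed_le continuous_const continuous_snd).inter
        (isClosed_le continuous_snd (hg.comp continuous_fst))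
  · rintro z ⟨h1, h2, h3, h4⟩
    exact ⟨⟨h1, h2⟩, h3, h4.trans (hM ⟨z.1, ⟨h1, h2⟩, rfl⟩)⟩

/-- Truncating a nonnegative function which vanishes at the boundary. -/
theorem exists_isTest_of_vanishing {R C : Set (ℝ × ℝ)} (hR : IsOpen R) (hC : IsCompact C)
    (hRC : R ⊆ C) {u ux uy : ℝ × ℝ → ℝ} (hu : ∀ z ∈ C, ContDiffAt ℝ (⊤ : ℕ∞) u z)
    (hu0 : ∀ z ∈ C, z ∉ R → u z = 0) (hupos : ∀ z ∈ R, 0 ≤ u z)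
    (hux : ∀ z ∈ C, fderiv ℝ u z (1, 0) = ux z) (huy : ∀ z ∈ C, fderiv ℝ u z (0, 1) = uy z)
    (hcx : ContinuousOn ux C) (hcy : ContinuousOn uy C) {μ : ℝ} (hμ : 0 < μ)
    (hN : 0 < ∫ z in R, u z ^ 2)
    (h : ∫ z in R, (ux z ^ 2 + uy z ^ 2) < μ * ∫ z in R, u z ^ 2) :
    ∃ v, IsTest R v ∧ (∃ z, v z ≠ 0) ∧ ∫ z, gradSq v z ≤ μ * ∫ z, v z ^ 2 := by
  have huc : ContinuousOn u C := fun z hz => (hu z hz).continuousAt.continuousWithinAt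
  have hInt : ∀ f : ℝ × ℝ → ℝ, ContinuousOn f C → IntegrableOn f R := fun f hf =>
    (hf.integrableOn_compact hC).mono_set hRC
  set N := ∫ z in R, u z ^ 2 with hNdef
  set G := ∫ z in R, (ux z ^ 2 + uy z ^ 2) with hGdef
  set A := ∫ z in R, (1 : ℝ) with hA
  have hA0 : 0 ≤ A := integral_nonneg fun _ => zero_le_one
  have hG0 : 0 ≤ G := integral_nonneg fun z => by positivity
  obtain ⟨δ, hδ, hδN⟩ : ∃ δ > 0, G + μ * (2 * δ * (N + A)) < μ * N := by
    refine ⟨(μ * N - G) / (μ * 2 * (N + A + 1) * 2), ?_, ?_⟩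
    · have : 0 < μ * N - G := by linarith
      positivity
    · have h1 : 0 < μ * N - G := by linarith
      have h2 : μ * (2 * ((μ * N - G) / (μ * 2 * (N + A + 1) * 2)) * (N + A))
          = (μ * N - G) * ((N + A) / (2 * (N + A + 1))) := by field_simp
      have h3 : (N + A) / (2 * (N + A + 1)) < 1 := by
        rw [div_lt_one (by positivity)]; linarith
      rw [h2]
      nlinarith
  obtain ⟨F, hF, hF0, hF1, hF2⟩ := exists_smooth_truncation hδ
  set v : ℝ × ℝ → ℝ := R.indicator fun z => F (u z) with hv
  set K := C ∩ u ⁻¹' Set.Ici δ with hK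
  have hKc : IsCompact K := hC.of_isClosed_subset
    (huc.preimage_isClosed_of_isClosed hC.isClosed isClosed_Ici) Set.inter_subset_left
  have hKR : K ⊆ R := fun z hz => by
    by_contra hcon
    have := hz.2
    rw [Set.mem_preimage, hu0 z hz.1 hcon, Set.mem_Ici] at this
    linarith
  have hvK : ∀ z, z ∉ K → v z = 0 := fun z hz => by
    by_cases hzR : z ∈ R
    · rw [hv, Set.indicator_of_mem hzR]
      refine hF0 _ (le_of_not_ge fun hcon => hz ⟨hRC hzR, hcon⟩)
    · rw [hv, Set.indicator_of_notMem hzR]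
  have hvR : ∀ z ∈ R, v =ᶠ[nhds z] fun z => F (u z) := fun z hz => by
    filter_upwards [hR.mem_nhds hz] with y hy
    rw [hv, Set.indicator_of_mem hy]
  have hsupp : tsupport v ⊆ K := closure_minimal (fun z hz => by
    by_contra hcon; exact hz (hvK z hcon)) hKc.isClosed
  have ht : IsTest R v := by
    refine ⟨contDiff_iff_contDiffAt.2 fun z => ?_, HasCompactSupport.intro hKc hvK,
      hsupp.trans hKR⟩
    by_cases hz : z ∈ R
    · exact (hF.contDiffAt.comp z (hu z (hRC hz))).congr_of_eventuallyEq (hvR z hz)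
    · have : v =ᶠ[nhds z] fun _ => 0 := by
        filter_upwards [hKc.isClosed.isOpen_compl.mem_nhds fun h => hz (hKR h)] with y hy
        exact hvK y hy
      exact contDiffAt_const.congr_of_eventuallyEq this
  have hgrad : ∫ z, gradSq v z ≤ G := by
    rw [hGdef, ← setIntegral_eq_integral_of_forall_compl_eq_zero (s := R) fun z hz =>
      gradSq_eq_zero fun h => hz (ht.supp h)]
    refine setIntegral_mono_on (ht.smooth.integrable_gradSq ht.compact).integrableOn
      (hInt _ ((hcx.pow 2).add (hcy.pow 2))) hR.measurableSet fun z hz => ?_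
    have hfd : fderiv ℝ v z = deriv F (u z) • fderiv ℝ u z := by
      rw [(hvR z hz).fderiv_eq]
      exact (((hF.differentiable (by simp)) (u z)).hasDerivAt.comp_hasFDerivAt z
        ((hu z (hRC hz)).differentiableAt (by simp)).hasFDerivAt).fderiv
    simp only [gradSq, hfd, smul_apply, smul_eq_mul, hux z (hRC hz),
      huy z (hRC hz), mul_pow, ← mul_add]
    refine mul_le_of_le_one_left (by positivity) ?_
    exact pow_le_one₀ (hF1 _).1 (hF1 _).2
  have hsq : N - 2 * δ * (N + A) ≤ ∫ z, v z ^ 2 := by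
    rw [← setIntegral_eq_integral_of_forall_compl_eq_zero (s := R) (f := fun z => v z ^ 2)
      fun z hz => by simp [hv, hz]]
    have h1 : N - 2 * δ * (N + A) = ∫ z in R, (u z ^ 2 - 2 * δ * (u z ^ 2 + 1)) := by
      have hi : IntegrableOn (fun z => u z ^ 2) R := hInt _ (huc.pow 2)
      have hi1 : IntegrableOn (fun _ => (1 : ℝ)) R := hInt _ continuousOn_const
      have hi2 : IntegrableOn (fun z => 2 * δ * (u z ^ 2 + 1)) R := (hi.add hi1).const_mul _
      rw [integral_sub hi hi2, integral_const_mul, integral_add hi hi1]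
    rw [h1]
    refine setIntegral_mono_on (hInt _ ((huc.pow 2).sub
      (((huc.pow 2).add continuousOn_const).const_smul (2 * δ))))
      (ht.smooth.integrable_sq ht.compact).integrableOn hR.measurableSet fun z hz => ?_
    rw [hv, Set.indicator_of_mem hz]
    exact hF2 _ (hupos z hz)
  refine ⟨v, ht, ?_, hgrad.trans ?_⟩
  · by_contra hcon
    push Not at hcon
    simp only [hcon] at hsq
    simp only [ne_eq, OfNat.ofNat_ne_zero, not_false_eq_true, zero_pow, integral_zero] at hsq
    nlinarith
  · nlinarith

theorem exists_isTest_of_profile {g φ : ℝ → ℝ} {x₁ x₂ : ℝ} (hx : x₁ < x₂)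
    (hg : ContDiff ℝ (⊤ : ℕ∞) g) (hgpos : ∀ x ∈ Set.Icc x₁ x₂, 0 < g x)
    (hφ : ContDiff ℝ (⊤ : ℕ∞) φ) (h₁ : φ x₁ = 0) (h₂ : φ x₂ = 0)
    (hφpos : ∀ x ∈ Set.Ioo x₁ x₂, 0 < φ x) {μ : ℝ} (hμ : 0 < μ)
    (h : ∫ x in x₁..x₂, (deriv φ x ^ 2 + (π ^ 2 + (π ^ 2 / 3 + 1 / 4) * deriv g x ^ 2) / g x ^ 2
      * φ x ^ 2) < μ * ∫ x in x₁..x₂, φ x ^ 2) :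
    ∃ v, IsTest (underGraph g x₁ x₂) v ∧ (∃ z, v z ≠ 0) ∧
      ∫ z, gradSq v z ≤ μ * ∫ z, v z ^ 2 := by
  have hdφ : ∀ x, HasDerivAt φ (deriv φ x) x := fun x =>
    ((hφ.differentiable (by simp)) x).hasDerivAt
  have hdg : ∀ x, HasDerivAt g (deriv g x) x := fun x =>
    ((hg.differentiable (by simp)) x).hasDerivAt
  have hφ'c : Continuous (deriv φ) := hφ.continuous_deriv (by simp)
  have hg'c : Continuous (deriv g) := hg.continuous_deriv (by simp)
  set C := {z : ℝ × ℝ | x₁ ≤ z.1 ∧ z.1 ≤ x₂ ∧ 0 ≤ z.2 ∧ z.2 ≤ g z.1} with hCdef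
  have hC : IsCompact C := isCompact_closed_underGraph hg.continuous x₁ x₂
  have hRC : underGraph g x₁ x₂ ⊆ C := fun z hz => ⟨hz.1.le, hz.2.1.le, hz.2.2.1.le, hz.2.2.2.le⟩
  have hCg : ∀ z ∈ C, 0 < g z.1 := fun z hz => hgpos _ ⟨hz.1, hz.2.1⟩
  set u : ℝ × ℝ → ℝ := fun z => φ z.1 * √(2 / g z.1) * sin (z.2 * (π / g z.1)) with hu
  set ux : ℝ × ℝ → ℝ := fun z => deriv φ z.1 * √(2 / g z.1) * sin (z.2 * (π / g z.1)) -
    φ z.1 * √(2 / g z.1) * (deriv g z.1 / g z.1) *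
        (1 / 2 * sin (z.2 * (π / g z.1)) + z.2 * (π / g z.1) * cos (z.2 * (π / g z.1))) with hux
  set uy : ℝ × ℝ → ℝ := fun z => φ z.1 * √(2 / g z.1) * (π / g z.1) * cos (z.2 * (π / g z.1))
    with huy
  have hgc : ContinuousOn (fun z : ℝ × ℝ => g z.1) C :=
      (hg.continuous.comp continuous_fst).continuousOn
  have hg'c' : ContinuousOn (fun z : ℝ × ℝ => deriv g z.1) C :=
    (hg'c.comp continuous_fst).continuousOn
  have hφc : ContinuousOn (fun z : ℝ × ℝ => φ z.1) C :=
      (hφ.continuous.comp continuous_fst).continuousOn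
  have hφ'c' : ContinuousOn (fun z : ℝ × ℝ => deriv φ z.1) C :=
    (hφ'c.comp continuous_fst).continuousOn
  have hs : ContinuousOn (fun z : ℝ × ℝ => √(2 / g z.1)) C :=
    (continuousOn_const.div hgc fun z hz => (hCg z hz).ne').sqrt
  have hpg : ContinuousOn (fun z : ℝ × ℝ => π / g z.1) C :=
    continuousOn_const.div hgc fun z hz => (hCg z hz).ne'
  have ht : ContinuousOn (fun z : ℝ × ℝ => z.2 * (π / g z.1)) C := continuousOn_snd.mul hpg
  have hgg : ContinuousOn (fun z : ℝ × ℝ => deriv g z.1 / g z.1) C :=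
    hg'c'.div hgc fun z hz => (hCg z hz).ne'
  have hsin := continuous_sin.comp_continuousOn ht
  have hcos := continuous_cos.comp_continuousOn ht
  have huc : ContinuousOn u C := (hφc.mul hs).mul hsin
  have hcx : ContinuousOn ux C := ((hφ'c'.mul hs).mul hsin).sub
    (((hφc.mul hs).mul hgg).mul ((continuousOn_const.mul hsin).add (ht.mul hcos)))
  have hcy : ContinuousOn uy C := ((hφc.mul hs).mul hpg).mul hcos
  have hud : ∀ z ∈ C, ContDiffAt ℝ (⊤ : ℕ∞) u z := by
    intro z hz
    have hgz := hCg z hz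
    have h1 : ContDiffAt ℝ (⊤ : ℕ∞) (fun z : ℝ × ℝ => g z.1) z :=
        hg.contDiffAt.comp z contDiffAt_fst
    have h2 : ContDiffAt ℝ (⊤ : ℕ∞) (fun z : ℝ × ℝ => φ z.1) z :=
        hφ.contDiffAt.comp z contDiffAt_fst
    exact (h2.mul ((contDiffAt_const.div h1 hgz.ne').sqrt (div_pos two_pos hgz).ne')).mul
      (contDiffAt_snd.mul (contDiffAt_const.div h1 hgz.ne')).sin
  have hR := isOpen_underGraph hg.continuous x₁ x₂
  have hInt : ∀ f : ℝ × ℝ → ℝ, ContinuousOn f C → IntegrableOn f (underGraph g x₁ x₂) := fun f hf =>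
    (hf.integrableOn_compact hC).mono_set hRC
  have hN : ∫ z in underGraph g x₁ x₂, u z ^ 2 = ∫ x in x₁..x₂, φ x ^ 2 := by
    rw [setIntegral_underGraph hg.continuous hx.le hgpos (f := fun z => u z ^ 2)
        (hInt _ (huc.pow 2))]
    refine intervalIntegral.integral_congr fun x hxx => ?_
    rw [Set.uIcc_of_le hx.le] at hxx
    exact integral_slice_sq (hgpos x hxx) (φ x)
  have hG : ∫ z in underGraph g x₁ x₂, (ux z ^ 2 + uy z ^ 2) = ∫ x in x₁..x₂, (deriv φ x ^ 2 +
      (π ^ 2 + (π ^ 2 / 3 + 1 / 4) * deriv g x ^ 2) / g x ^ 2 * φ x ^ 2) := by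
    rw [setIntegral_underGraph hg.continuous hx.le hgpos (f := fun z => ux z ^ 2 + uy z ^ 2)
      (hInt _ ((hcx.pow 2).add (hcy.pow 2)))]
    refine intervalIntegral.integral_congr fun x hxx => ?_
    rw [Set.uIcc_of_le hx.le] at hxx
    exact integral_slice_grad (hgpos x hxx) (φ x) (deriv φ x) (deriv g x)
  refine exists_isTest_of_vanishing hR hC hRC (ux := ux) (uy := uy) hud ?_ ?_ ?_ ?_ hcx hcy hμ ?_ ?_
  · rintro z hz hzR
    have hgz := hCg z hz
    rcases hz.1.eq_or_lt with h3 | h3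
    · simp [hu, ← h3, h₁]
    rcases hz.2.1.eq_or_lt with h4 | h4
    · simp [hu, h4, h₂]
    rcases hz.2.2.1.eq_or_lt with h5 | h5
    · simp [hu, ← h5]
    rcases hz.2.2.2.eq_or_lt with h6 | h6
    · have : z.2 * (π / g z.1) = π := by rw [h6]; field_simp
      simp only [hu, this, sin_pi, mul_zero]
    exact absurd ⟨h3, h4, h5, h6⟩ hzR
  · intro z hz
    have hgz := hCg z (hRC hz)
    have h3 := hφpos z.1 ⟨hz.1, hz.2.1⟩
    have h4 : 0 ≤ sin (z.2 * (π / g z.1)) := by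
      have h5 := hz.2.2.1
      refine sin_nonneg_of_nonneg_of_le_pi (by positivity) ?_
      rw [← mul_div_assoc, div_le_iff₀ hgz]
      nlinarith [hz.2.2.2, pi_pos]
    simp only [hu]
    positivity
  · intro z hz
    have hgz := hCg z hz
    have hd : HasFDerivAt u (fderiv ℝ u z) ((fun x : ℝ => (x, z.2)) z.1) :=
      ((hud z hz).differentiableAt (by simp)).hasFDerivAt
    have h3 : HasDerivAt (fun x => u (x, z.2)) (fderiv ℝ u z (1, 0)) z.1 :=
      hd.comp_hasDerivAt (f := fun x : ℝ => (x, z.2)) z.1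
          ((hasDerivAt_id z.1).prodMk (hasDerivAt_const z.1 z.2))
    refine h3.unique ?_
    have h4 : HasDerivAt (fun x => 2 / g x) (-(2 * deriv g z.1) / g z.1 ^ 2) z.1 :=
      ((hasDerivAt_const z.1 (2 : ℝ)).div (hdg z.1) hgz.ne').congr_deriv (by ring)
    have h5 : HasDerivAt (fun x => z.2 * (π / g x)) (-(z.2 * π * deriv g z.1) / g z.1 ^ 2) z.1 :=
      (((hasDerivAt_const z.1 (π : ℝ)).div (hdg z.1) hgz.ne').const_mul z.2).congr_deriv (by ring)
    refine (((hdφ z.1).mul (h4.sqrt (by positivity))).mul h5.sin).congr_deriv ?_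
    simp only [hux, Pi.mul_apply]
    have hq0 : 0 < √(2 / g z.1) := Real.sqrt_pos.2 (by positivity)
    have hq : √(2 / g z.1) ^ 2 * g z.1 = 2 := by
      rw [Real.sq_sqrt (by positivity)]; field_simp
    generalize √(2 / g z.1) = q at hq0 hq
    have hq1 : -(2 * deriv g z.1) / g z.1 ^ 2 / (2 * q) = -(q * (deriv g z.1 / (2 * g z.1))) := by
      field_simp
      linear_combination (deriv g z.1) * hq
    rw [hq1]
    field_simp
    ring
  · intro z hz
    have hgz := hCg z hz
    have hd : HasFDerivAt u (fderiv ℝ u z) ((fun y : ℝ => (z.1, y)) z.2) :=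
      ((hud z hz).differentiableAt (by simp)).hasFDerivAt
    have h3 : HasDerivAt (fun y => u (z.1, y)) (fderiv ℝ u z (0, 1)) z.2 :=
      hd.comp_hasDerivAt (f := fun y : ℝ => (z.1, y)) z.2
          ((hasDerivAt_const z.2 z.1).prodMk (hasDerivAt_id z.2))
    refine h3.unique ?_
    refine ((((hasDerivAt_id z.2).mul_const (π / g z.1)).sin).const_mul
      (φ z.1 * √(2 / g z.1))).congr_deriv ?_
    simp only [huy, id]
    ring
  · rw [hN]
    refine intervalIntegral.intervalIntegral_pos_of_pos_on
      ((hφ.continuous.pow 2).intervalIntegrable _ _) (fun x hxx => ?_) hx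
    exact pow_pos (hφpos x hxx) 2
  · rwa [hG, hN]

/-- A smooth approximation from below of the height profile of `thinTri`. -/
noncomputable def softMin (ε ρ δ x : ℝ) : ℝ :=
  ((1 + ε * x) + (1 - ε / ρ * x) - √(((ε + ε / ρ) * x) ^ 2 + δ ^ 2)) / 2

/-- The derivative of `softMin`. -/
noncomputable def softMin' (ε ρ δ x : ℝ) : ℝ :=
  (ε - ε / ρ - (ε + ε / ρ) * ((ε + ε / ρ) * x) / √(((ε + ε / ρ) * x) ^ 2 + δ ^ 2)) / 2

section softMin

variable {ε ρ δ : ℝ}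

theorem contDiff_softMin (hδ : 0 < δ) : ContDiff ℝ (⊤ : ℕ∞) (softMin ε ρ δ) := by
  unfold softMin
  have : ContDiff ℝ (⊤ : ℕ∞) fun x : ℝ => √(((ε + ε / ρ) * x) ^ 2 + δ ^ 2) :=
    ContDiff.sqrt (by fun_prop) fun x => by positivity
  fun_prop

theorem hasDerivAt_softMin (hδ : 0 < δ) (x : ℝ) :
    HasDerivAt (softMin ε ρ δ) (softMin' ε ρ δ x) x := by
  have hpos : 0 < ((ε + ε / ρ) * x) ^ 2 + δ ^ 2 := by positivity
  have h1 : HasDerivAt (fun x : ℝ => ((ε + ε / ρ) * x) ^ 2 + δ ^ 2)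
      (2 * ((ε + ε / ρ) * x) * (ε + ε / ρ)) x := by
    have := (((hasDerivAt_id x).const_mul (ε + ε / ρ)).pow 2).add_const (δ ^ 2)
    refine this.congr_deriv ?_
    simp
  have h2 := ((((hasDerivAt_id x).const_mul ε).const_add 1).add
    (((hasDerivAt_id x).const_mul (ε / ρ)).const_sub 1)).sub (h1.sqrt hpos.ne')
  refine (h2.div_const 2).congr_deriv ?_
  have := (Real.sqrt_pos.2 hpos).ne'
  simp only [softMin']
  field_simp
  ring

theorem softMin_le_left (x : ℝ) : softMin ε ρ δ x ≤ 1 + ε * x := by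
  have h := Real.abs_le_sqrt (x := (ε + ε / ρ) * x) (y := ((ε + ε / ρ) * x) ^ 2 + δ ^ 2)
    (by nlinarith [sq_nonneg δ])
  have := neg_abs_le ((ε + ε / ρ) * x)
  simp only [softMin]
  linarith

theorem softMin_le_right (x : ℝ) : softMin ε ρ δ x ≤ 1 - ε / ρ * x := by
  have h := Real.abs_le_sqrt (x := (ε + ε / ρ) * x) (y := ((ε + ε / ρ) * x) ^ 2 + δ ^ 2)
    (by nlinarith [sq_nonneg δ])
  have := le_abs_self ((ε + ε / ρ) * x)
  simp only [softMin]
  linarith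

theorem le_softMin (hδ : 0 ≤ δ) {m x : ℝ} (h1 : m ≤ 1 + ε * x) (h2 : m ≤ 1 - ε / ρ * x) :
    m - δ / 2 ≤ softMin ε ρ δ x := by
  have h : √(((ε + ε / ρ) * x) ^ 2 + δ ^ 2) ≤ |(ε + ε / ρ) * x| + δ := by
    refine Real.sqrt_le_iff.2 ⟨by positivity, ?_⟩
    rw [← sq_abs ((ε + ε / ρ) * x)]
    nlinarith [abs_nonneg ((ε + ε / ρ) * x)]
  simp only [softMin]
  rcases abs_cases ((ε + ε / ρ) * x) with h3 | h3 <;> linarith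

theorem abs_softMin'_le (hε : 0 < ε) (hρ : 0 < ρ) (hδ : 0 < δ) (x : ℝ) :
    |softMin' ε ρ δ x| ≤ ε + ε / ρ := by
  have hρε : 0 < ε / ρ := by positivity
  have hpos : 0 < √(((ε + ε / ρ) * x) ^ 2 + δ ^ 2) := Real.sqrt_pos.2 (by positivity)
  have h := Real.abs_le_sqrt (x := (ε + ε / ρ) * x) (y := ((ε + ε / ρ) * x) ^ 2 + δ ^ 2)
    (by nlinarith [sq_nonneg δ])
  have h4 : |(ε + ε / ρ) * ((ε + ε / ρ) * x) / √(((ε + ε / ρ) * x) ^ 2 + δ ^ 2)| ≤ ε + ε / ρ := by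
    rw [abs_div, abs_of_pos hpos, div_le_iff₀ hpos, abs_mul, abs_of_pos (by positivity)]
    gcongr
  rw [abs_le] at h4 ⊢
  simp only [softMin']
  constructor <;> linarith [h4.1, h4.2]

theorem softMin_zero_of_neg (hε : 0 < ε) (hρ : 0 < ρ) {x : ℝ} (hx : x < 0) :
    softMin ε ρ 0 x = 1 + ε * x ∧ softMin' ε ρ 0 x = ε := by
  have h : √(((ε + ε / ρ) * x) ^ 2 + 0 ^ 2) = -((ε + ε / ρ) * x) := by
    rw [zero_pow two_ne_zero, add_zero, Real.sqrt_sq_eq_abs, abs_of_neg]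
    exact mul_neg_of_pos_of_neg (by positivity) hx
  have hk : (ε + ε / ρ) ≠ 0 := by positivity
  have hx' := hx.ne
  simp only [softMin, softMin', h]
  constructor
  · ring
  · rw [mul_div_assoc, div_neg, div_self (mul_ne_zero hk hx')]; ring

theorem softMin_zero_of_pos (hε : 0 < ε) (hρ : 0 < ρ) {x : ℝ} (hx : 0 < x) :
    softMin ε ρ 0 x = 1 - ε / ρ * x ∧ softMin' ε ρ 0 x = -(ε / ρ) := by
  have h : √(((ε + ε / ρ) * x) ^ 2 + 0 ^ 2) = (ε + ε / ρ) * x := by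
    rw [zero_pow two_ne_zero, add_zero, Real.sqrt_sq (by positivity)]
  have hk : (ε + ε / ρ) ≠ 0 := by positivity
  simp only [softMin, softMin', h]
  constructor
  · ring
  · rw [mul_div_assoc, div_self (mul_ne_zero hk hx.ne')]; ring

theorem tendsto_integral_softMin (hε : 0 < ε) (hρ : 0 < ρ) {a b m : ℝ} (hab : a ≤ b) (hm : 0 < m)
    (h1 : ∀ x ∈ Set.Ioo a b, m ≤ 1 + ε * x) (h2 : ∀ x ∈ Set.Ioo a b, m ≤ 1 - ε / ρ * x)
    (h0 : ∀ x ∈ Set.Ioo a b, x ≠ 0) {p p' : ℝ → ℝ} (hp : Continuous p) (hp' : Continuous p')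
    {K c : ℝ} (hK : 0 ≤ K) (hc : 0 ≤ c) :
    Filter.Tendsto (fun δ => ∫ x in a..b, (p' x ^ 2 + (K + c * softMin' ε ρ δ x ^ 2) /
        softMin ε ρ δ x ^ 2 * p x ^ 2)) (nhdsWithin 0 (Set.Ioi 0))
      (nhds (∫ x in a..b, (p' x ^ 2 + (K + c * softMin' ε ρ 0 x ^ 2) /
        softMin ε ρ 0 x ^ 2 * p x ^ 2))) := by
  have hae : ∀ᵐ x ∂(volume : Measure ℝ), x ∈ Set.uIoc a b → x ∈ Set.Ioo a b := by
    have : ∀ᵐ x ∂(volume : Measure ℝ), x ≠ b := by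
      simp [ae_iff, measure_singleton]
    filter_upwards [this] with x hx hxu
    rw [Set.uIoc_of_le hab] at hxu
    exact ⟨hxu.1, lt_of_le_of_ne hxu.2 hx⟩
  refine intervalIntegral.tendsto_integral_filter_of_dominated_convergence
    (fun x => p' x ^ 2 + (K + c * (ε + ε / ρ) ^ 2) / (m / 2) ^ 2 * p x ^ 2) ?_ ?_ ?_ ?_
  · refine Filter.Eventually.of_forall fun δ => Measurable.aestronglyMeasurable ?_
    have hp1 := hp.measurable
    have hp2 := hp'.measurable
    unfold softMin softMin'
    fun_prop
  · have hδm : ∀ᶠ δ in nhdsWithin (0 : ℝ) (Set.Ioi 0), δ < m := by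
      filter_upwards [nhdsWithin_le_nhds (Iio_mem_nhds hm)] with δ hδ using hδ
    filter_upwards [hδm, self_mem_nhdsWithin] with δ hδ hδ0
    filter_upwards [hae] with x hx hxu
    have hx := hx hxu
    have hs := le_softMin hδ0.le (h1 x hx) (h2 x hx)
    have hs' := abs_softMin'_le hε hρ hδ0 x
    rw [Real.norm_of_nonneg (by positivity)]
    have h3 : softMin' ε ρ δ x ^ 2 ≤ (ε + ε / ρ) ^ 2 := sq_le_sq' (abs_le.1 hs').1 (abs_le.1 hs').2
    gcongr
    linarith
  · exact Continuous.intervalIntegrable (by fun_prop) _ _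
  · filter_upwards [hae] with x hx hxu
    have hx := hx hxu
    have hx0 := h0 x hx
    have hk : ε + ε / ρ ≠ 0 := by positivity
    have hs0 : softMin ε ρ 0 x ≠ 0 := by
      have := le_softMin (le_refl (0 : ℝ)) (h1 x hx) (h2 x hx)
      linarith
    have hq : √(((ε + ε / ρ) * x) ^ 2 + (0 : ℝ) ^ 2) ≠ 0 := by
      refine (Real.sqrt_pos.2 ?_).ne'
      have := sq_pos_of_ne_zero (mul_ne_zero hk hx0)
      linarith [sq_nonneg (0 : ℝ)]
    have hqc : ContinuousAt (fun δ : ℝ => √(((ε + ε / ρ) * x) ^ 2 + δ ^ 2)) 0 :=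
      (by fun_prop : Continuous fun δ : ℝ => √(((ε + ε / ρ) * x) ^ 2 + δ ^ 2)).continuousAt
    have hc1 : ContinuousAt (fun δ => softMin ε ρ δ x) 0 := by
      unfold softMin; fun_prop
    have hc2 : ContinuousAt (fun δ => softMin' ε ρ δ x) 0 := by
      unfold softMin'
      exact (continuousAt_const.sub (continuousAt_const.div hqc hq)).div_const 2
    have hc3 : ContinuousAt (fun δ => p' x ^ 2 + (K + c * softMin' ε ρ δ x ^ 2) /
        softMin ε ρ δ x ^ 2 * p x ^ 2) 0 :=
      continuousAt_const.add (((continuousAt_const.add (continuousAt_const.mul (hc2.pow 2))).div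
        (hc1.pow 2) (pow_ne_zero 2 hs0)).mul continuousAt_const)
    exact hc3.tendsto.mono_left nhdsWithin_le_nhds

end softMin

section lobes

variable {ε ρ x₁ x₂ U : ℝ} {φ : ℝ → ℝ}

theorem exists_isTest_of_scaled_profile {s s' : ℝ → ℝ} (hε : 0 < ε) (hx : x₁ < x₂)
    (hs : ContDiff ℝ (⊤ : ℕ∞) s) (hs' : ∀ x, HasDerivAt s (s' x) x)
    (hspos : ∀ x ∈ Set.Icc x₁ x₂, 0 < s x) (hsa : ∀ x, x₁ < x → x < x₂ → s x ≤ 1 + ε * x)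
    (hsb : ∀ x, x₁ < x → x < x₂ → s x ≤ 1 - ε / ρ * x)
    (hφ : ContDiff ℝ (⊤ : ℕ∞) φ) (h₁ : φ x₁ = 0) (h₂ : φ x₂ = 0)
    (hφpos : ∀ x ∈ Set.Ioo x₁ x₂, 0 < φ x) (hU : 0 ≤ U)
    (h : ∫ x in x₁..x₂, (deriv φ x ^ 2 + (1 / (2 * ε) + (π ^ 2 / 3 + 1 / 4) * s' x ^ 2) / s x ^ 2
      * φ x ^ 2) < (1 / (2 * ε) + U) * ∫ x in x₁..x₂, φ x ^ 2) :
    ∃ v, IsTest (thinTri ε ρ ∩ {z | x₁ < z.1 ∧ z.1 < x₂}) v ∧ (∃ z, v z ≠ 0) ∧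
      ∫ z, gradSq v z ≤ (1 / (2 * ε) + U) * ∫ z, v z ^ 2 := by
  have hh : 0 < π * √(2 * ε) := mul_pos pi_pos (Real.sqrt_pos.2 (by positivity))
  have hq : √(2 * ε) ^ 2 = 2 * ε := Real.sq_sqrt (by positivity)
  obtain ⟨v, hv, hv0, hvle⟩ := exists_isTest_of_profile (g := fun x => π * √(2 * ε) * s x) hx
    (contDiff_const.mul hs) (fun x hxx => mul_pos hh (hspos x hxx)) hφ h₁ h₂ hφpos
    (μ := 1 / (2 * ε) + U) (by positivity) (by
      refine lt_of_eq_of_lt (intervalIntegral.integral_congr fun x hxx => ?_) h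
      rw [Set.uIcc_of_le hx.le] at hxx
      have := hspos x hxx
      simp only [((hs' x).const_mul (π * √(2 * ε))).deriv, mul_pow, hq]
      field_simp)
  refine ⟨v, hv.mono fun z hz => ⟨⟨hz.2.2.1, ?_, ?_⟩, hz.1, hz.2.1⟩, hv0, hvle⟩
  · refine hz.2.2.2.trans_le ?_
    exact mul_le_mul_of_nonneg_left (hsa _ hz.1 hz.2.1) hh.le
  · refine hz.2.2.2.trans_le ?_
    exact mul_le_mul_of_nonneg_left (hsb _ hz.1 hz.2.1) hh.le

/-- Test functions on the left side of the foot of the height. -/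
theorem exists_isTest_left (hε : 0 < ε) (hρ : 0 < ρ) (hx : x₁ < x₂) (hx₂ : x₂ ≤ 0)
    (hx₁ : 0 < 1 + ε * x₁) (hφ : ContDiff ℝ (⊤ : ℕ∞) φ) (h₁ : φ x₁ = 0) (h₂ : φ x₂ = 0)
    (hφpos : ∀ x ∈ Set.Ioo x₁ x₂, 0 < φ x) (hU : 0 ≤ U)
    (h : ∫ x in x₁..x₂, (deriv φ x ^ 2 + (1 / (2 * ε) + (π ^ 2 / 3 + 1 / 4) * ε ^ 2) /
      (1 + ε * x) ^ 2 * φ x ^ 2) < (1 / (2 * ε) + U) * ∫ x in x₁..x₂, φ x ^ 2) :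
    ∃ v, IsTest (thinTri ε ρ ∩ {z | x₁ < z.1 ∧ z.1 < x₂}) v ∧ (∃ z, v z ≠ 0) ∧
      ∫ z, gradSq v z ≤ (1 / (2 * ε) + U) * ∫ z, v z ^ 2 := by
  refine exists_isTest_of_scaled_profile hε hx (s := fun x => 1 + ε * x) (s' := fun _ => ε)
    (by fun_prop) (fun x => ?_) (fun x hxx => ?_) (fun x _ _ => le_rfl) (fun x _ hxx => ?_)
    hφ h₁ h₂ hφpos hU h
  · simpa using ((hasDerivAt_id x).const_mul ε).const_add 1
  · have : ε * x₁ ≤ ε * x := by gcongr; exact hxx.1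
    linarith
  · have : ε * x ≤ 0 := mul_nonpos_of_nonneg_of_nonpos hε.le (by linarith)
    have : ε / ρ * x ≤ 0 := mul_nonpos_of_nonneg_of_nonpos (by positivity) (by linarith)
    linarith

/-- Test functions on both sides of the foot of the height. -/
theorem exists_isTest_straddle (hε : 0 < ε) (hρ : 0 < ρ) (hx₁0 : x₁ < 0) (hx₂0 : 0 < x₂)
    (hx₁ : 0 < 1 + ε * x₁) (hx₂ : 0 < 1 - ε / ρ * x₂) (hφ : ContDiff ℝ (⊤ : ℕ∞) φ)
    (h₁ : φ x₁ = 0) (h₂ : φ x₂ = 0) (hφpos : ∀ x ∈ Set.Ioo x₁ x₂, 0 < φ x) (hU : 0 ≤ U)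
    (h : (∫ x in x₁..0, (deriv φ x ^ 2 + (1 / (2 * ε) + (π ^ 2 / 3 + 1 / 4) * ε ^ 2) /
        (1 + ε * x) ^ 2 * φ x ^ 2)) +
      (∫ x in 0..x₂, (deriv φ x ^ 2 + (1 / (2 * ε) + (π ^ 2 / 3 + 1 / 4) * (ε / ρ) ^ 2) /
        (1 - ε / ρ * x) ^ 2 * φ x ^ 2))
      < (1 / (2 * ε) + U) * ∫ x in x₁..x₂, φ x ^ 2) :
    ∃ v, IsTest (thinTri ε ρ ∩ {z | x₁ < z.1 ∧ z.1 < x₂}) v ∧ (∃ z, v z ≠ 0) ∧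
      ∫ z, gradSq v z ≤ (1 / (2 * ε) + U) * ∫ z, v z ^ 2 := by
  set m := min (1 + ε * x₁) (1 - ε / ρ * x₂) with hm
  have hm0 : 0 < m := lt_min hx₁ hx₂
  have hρε : 0 < ε / ρ := by positivity
  have ha : ∀ x ∈ Set.Icc x₁ x₂, m ≤ 1 + ε * x := fun x hxx => by
    refine (min_le_left _ _).trans ?_
    gcongr; exact hxx.1
  have hb : ∀ x ∈ Set.Icc x₁ x₂, m ≤ 1 - ε / ρ * x := fun x hxx => by
    refine (min_le_right _ _).trans ?_
    gcongr; exact hxx.2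
  have hφ'c : Continuous (deriv φ) := hφ.continuous_deriv (by simp)
  have hcL := tendsto_integral_softMin hε hρ hx₁0.le hm0
      (fun x hxx => ha x ⟨hxx.1.le, by linarith [hxx.2]⟩)
    (fun x hxx => hb x ⟨hxx.1.le, by linarith [hxx.2]⟩) (fun x hxx => hxx.2.ne) hφ.continuous hφ'c
    (K := 1 / (2 * ε)) (c := π ^ 2 / 3 + 1 / 4) (by positivity) (by positivity)
  have hcR := tendsto_integral_softMin hε hρ hx₂0.le hm0
      (fun x hxx => ha x ⟨by linarith [hxx.1], hxx.2.le⟩)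
    (fun x hxx => hb x ⟨by linarith [hxx.1], hxx.2.le⟩) (fun x hxx => hxx.1.ne') hφ.continuous hφ'c
    (K := 1 / (2 * ε)) (c := π ^ 2 / 3 + 1 / 4) (by positivity) (by positivity)
  have heL : ∫ x in x₁..0, (deriv φ x ^ 2 + (1 / (2 * ε) + (π ^ 2 / 3 + 1 / 4) *
      softMin' ε ρ 0 x ^ 2) / softMin ε ρ 0 x ^ 2 * φ x ^ 2)
      = ∫ x in x₁..0, (deriv φ x ^ 2 + (1 / (2 * ε) + (π ^ 2 / 3 + 1 / 4) * ε ^ 2) /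
        (1 + ε * x) ^ 2 * φ x ^ 2) := by
    refine intervalIntegral.integral_congr_ae ?_
    have : ∀ᵐ x ∂(volume : Measure ℝ), x ≠ 0 := by simp [ae_iff, measure_singleton]
    filter_upwards [this] with x hx hxu
    rw [Set.uIoc_of_le hx₁0.le] at hxu
    rw [(softMin_zero_of_neg hε hρ (lt_of_le_of_ne hxu.2 hx)).1,
      (softMin_zero_of_neg hε hρ (lt_of_le_of_ne hxu.2 hx)).2]
  have heR : ∫ x in 0..x₂, (deriv φ x ^ 2 + (1 / (2 * ε) + (π ^ 2 / 3 + 1 / 4) *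
      softMin' ε ρ 0 x ^ 2) / softMin ε ρ 0 x ^ 2 * φ x ^ 2)
      = ∫ x in 0..x₂, (deriv φ x ^ 2 + (1 / (2 * ε) + (π ^ 2 / 3 + 1 / 4) * (ε / ρ) ^ 2) /
        (1 - ε / ρ * x) ^ 2 * φ x ^ 2) := by
    refine intervalIntegral.integral_congr_ae (Filter.Eventually.of_forall fun x hxu => ?_)
    rw [Set.uIoc_of_le hx₂0.le] at hxu
    rw [(softMin_zero_of_pos hε hρ hxu.1).1, (softMin_zero_of_pos hε hρ hxu.1).2, neg_sq]
  rw [heL] at hcL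
  rw [heR] at hcR
  have hev := (hcL.add hcR).eventually (Iio_mem_nhds h)
  have hδm : ∀ᶠ δ in nhdsWithin (0 : ℝ) (Set.Ioi 0), δ < m := by
    filter_upwards [nhdsWithin_le_nhds (Iio_mem_nhds hm0)] with δ hδ using hδ
  obtain ⟨δ, ⟨hδ1, hδ2⟩, hδ0⟩ := ((hev.and hδm).and self_mem_nhdsWithin).exists
  have hspos : ∀ x ∈ Set.Icc x₁ x₂, 0 < softMin ε ρ δ x := fun x hxx => by
    have := le_softMin hδ0.le (ha x hxx) (hb x hxx)
    linarith
  refine exists_isTest_of_scaled_profile hε (hx₁0.trans hx₂0) (contDiff_softMin (ρ := ρ) hδ0)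
    (hasDerivAt_softMin hδ0) hspos (fun x _ _ => softMin_le_left x)
    (fun x _ _ => softMin_le_right x) hφ h₁ h₂ hφpos hU (lt_of_eq_of_lt ?_ hδ1)
  have hcont : ContinuousOn (fun x => deriv φ x ^ 2 + (1 / (2 * ε) + (π ^ 2 / 3 + 1 / 4) *
      softMin' ε ρ δ x ^ 2) / softMin ε ρ δ x ^ 2 * φ x ^ 2) (Set.Icc x₁ x₂) := by
    have h3 : Continuous (softMin' ε ρ δ) := by
      have : softMin' ε ρ δ = deriv (softMin ε ρ δ) :=
        funext fun x => ((hasDerivAt_softMin hδ0 x).deriv).symm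
      rw [this]
      exact (contDiff_softMin hδ0).continuous_deriv (by simp)
    have h4 : Continuous (softMin ε ρ δ) := (contDiff_softMin hδ0).continuous
    have h5 := hφ.continuous
    exact ((hφ'c.pow 2).continuousOn).add (ContinuousOn.mul (ContinuousOn.div
      (by fun_prop) (h4.pow 2).continuousOn fun x hxx => (pow_pos (hspos x hxx) 2).ne')
      (h5.pow 2).continuousOn)
  rw [intervalIntegral.integral_add_adjacent_intervals]
  · refine ContinuousOn.intervalIntegrable (hcont.mono ?_)
    rw [Set.uIcc_of_le hx₁0.le]
    exact Set.Icc_subset_Icc_right hx₂0.le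
  · refine ContinuousOn.intervalIntegrable (hcont.mono ?_)
    rw [Set.uIcc_of_le hx₂0.le]
    exact Set.Icc_subset_Icc_left hx₁0.le

end lobes

/-- A lower bound for the line energy on a half line, evaluated on all long intervals. -/
def TailBound (θ σ Λ : ℝ) (f f' : ℝ → ℝ) (a k : ℝ) : Prop :=
  ∃ Y₀, ∀ Y, Y₀ ≤ Y → k * f a ^ 2 ≤ lineEnergy θ σ Λ f f' a Y

section TailBound

variable {θ σ Λ : ℝ} {f f' : ℝ → ℝ}

theorem TailBound.of_le (hθ : 0 < θ) (hσ : 0 ≤ σ) (hf : ∀ x, HasDerivAt f (f' x) x)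
    (hf' : Continuous f') (hX : ∃ X, ∀ x, X ≤ x → f x = 0) {a k : ℝ}
    (hk : θ * k ^ 2 ≤ σ * a - Λ) : TailBound θ σ Λ f f' a k := by
  obtain ⟨X, hX⟩ := hX
  exact ⟨max X a, fun Y hY => lineEnergy_tail hθ hσ hf hf' a Y k (le_of_max_le_right hY)
    (hX Y (le_of_max_le_left hY)) hk⟩

theorem TailBound.cons (hf : ∀ x, HasDerivAt f (f' x) x) (hf' : Continuous f') {a b k k₁ k₂ : ℝ}
    (h : TailBound θ σ Λ f f' b k) (hs : k₁ * f a ^ 2 + k₂ * f b ^ 2 ≤ lineEnergy θ σ Λ f f' a b)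
    (hk : 0 ≤ k₂ + k) : TailBound θ σ Λ f f' a k₁ := by
  obtain ⟨Y₀, hY⟩ := h
  refine ⟨Y₀, fun Y hYY => ?_⟩
  rw [← lineEnergy_add hf hf' a b Y]
  nlinarith [hY Y hYY, mul_nonneg hk (sq_nonneg (f b))]

theorem TailBound.cubic (hθ : 0 < θ) (hf : ∀ x, HasDerivAt f (f' x) x) (hf' : Continuous f')
    {a b k : ℝ} (L g₀ g₁ g₂ g₃ : ℝ) (h : TailBound θ σ Λ f f' b k) (hb : a + L = b) (hL : 0 ≤ L)
    (hR : ∀ s, 0 ≤ s → s ≤ L → g₁ + 2 * g₂ * s + 3 * g₃ * s ^ 2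
      + θ * (g₀ + g₁ * s + g₂ * s ^ 2 + g₃ * s ^ 3) ^ 2 ≤ σ * (a + s) - Λ)
    (hk : 0 ≤ g₀ + g₁ * L + g₂ * L ^ 2 + g₃ * L ^ 3 + k) :
    TailBound θ σ Λ f f' a (-g₀) :=
  (hb ▸ h).cons hf hf' (by
    have := lineEnergy_cubic hθ hf hf' a L g₀ g₁ g₂ g₃ hL hR
    linarith) hk

theorem TailBound.cubic_left (hθ : 0 < θ) (hf : ∀ x, HasDerivAt f (f' x) x) (hf' : Continuous f')
    {a b k k' : ℝ} (L g₀ g₁ g₂ g₃ : ℝ) (h : TailBound θ σ Λ f f' b k) (ha : b - L = a) (hL : 0 ≤ L)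
    (hR : ∀ s, 0 ≤ s → s ≤ L → g₁ + 2 * g₂ * s + 3 * g₃ * s ^ 2
      + θ * (g₀ + g₁ * s + g₂ * s ^ 2 + g₃ * s ^ 3) ^ 2 ≤ σ * (b - s) - Λ)
    (hk : g₀ ≤ k) (hk' : k' ≤ g₀ + g₁ * L + g₂ * L ^ 2 + g₃ * L ^ 3) :
    TailBound θ σ Λ f f' a k' :=
  h.cons hf hf' (k₂ := -g₀) (by
    have := lineEnergy_cubic_left hθ hf hf' b L g₀ g₁ g₂ g₃ hL hR
    rw [ha] at this
    linarith [mul_le_mul_of_nonneg_right hk' (sq_nonneg (f a))]) (by linarith)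

theorem TailBound.singular (hθ : 0 < θ) (hf : ∀ x, HasDerivAt f (f' x) x) (hf' : Continuous f')
    {a b k : ℝ} (L B C D : ℝ) (h : TailBound θ σ Λ f f' b k) (hb : a + L = b) (hL : 0 < L)
    (hfa : f a = 0)
    (hR : ∀ s, 0 ≤ s → s ≤ L → (B * s - C * s ^ 2 + D * s ^ 3) ^ 2 - 3 * B + 4 * C * s
      - 5 * D * s ^ 2 ≤ θ * (σ * (a + s) - Λ))
    (hk : 0 ≤ (1 / L - B * L + C * L ^ 2 - D * L ^ 3) / θ + k) :
    TailBound θ σ Λ f f' a 0 :=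
  (hb ▸ h).cons hf hf' (by
    have := lineEnergy_singular hθ hf hf' a L B C D hL hfa hR
    linarith) hk

theorem TailBound.singular_left (hθ : 0 < θ) (hf : ∀ x, HasDerivAt f (f' x) x)
    (hf' : Continuous f') {a b k' : ℝ} (L B C D : ℝ) (h : TailBound θ σ Λ f f' b 0)
    (ha : b - L = a) (hL : 0 < L) (hfb : f b = 0)
    (hR : ∀ s, 0 ≤ s → s ≤ L → (B * s - C * s ^ 2 + D * s ^ 3) ^ 2 - 3 * B + 4 * C * s
      - 5 * D * s ^ 2 ≤ θ * (σ * (b - s) - Λ))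
    (hk' : k' ≤ (1 / L - B * L + C * L ^ 2 - D * L ^ 3) / θ) :
    TailBound θ σ Λ f f' a k' :=
  h.cons hf hf' (k₂ := 0) (by
    have := lineEnergy_singular_left hθ hf hf' b L B C D hL hfb hR
    rw [ha] at this
    linarith [mul_le_mul_of_nonneg_right hk' (sq_nonneg (f a))]) (by simp)

theorem pow_mul_sub_pow_six_nonneg {s L : ℝ} (h0 : 0 ≤ s) (h1 : s ≤ L) :
    0 ≤ s ^ 6 ∧ 0 ≤ s ^ 5 * (L - s) ∧ 0 ≤ s ^ 4 * (L - s) ^ 2 ∧ 0 ≤ s ^ 3 * (L - s) ^ 3 ∧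
      0 ≤ s ^ 2 * (L - s) ^ 4 ∧ 0 ≤ s * (L - s) ^ 5 ∧ 0 ≤ (L - s) ^ 6 := by
  have := sub_nonneg.2 h1
  refine ⟨?_, ?_, ?_, ?_, ?_, ?_, ?_⟩ <;> positivity

/-- Beyond a zero, the energy is nonnegative as long as the potential is not too deep. -/
theorem TailBound.of_zero {s p : ℝ} (hf : ∀ x, HasDerivAt f (f' x) x) (hf' : Continuous f')
    (hX : ∃ X, ∀ x, X ≤ x → f x = 0) (hs : 0 < s) (hσ : s ^ 3 ≤ σ)
    (hp : Λ - σ * p ≤ 11 / 5 * s ^ 2) (hfp : f p = 0) :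
    TailBound (203 / 200) σ Λ f f' p 0 := by
  have hσs : s ^ 2 ≤ σ / s := by rw [le_div_iff₀ hs]; linarith
  have hσ0 : 0 ≤ σ := le_trans (by positivity) hσ
  have hL : ∀ {L x : ℝ}, 0 ≤ x → x ≤ L / s → 0 ≤ s * x ∧ s * x ≤ L := fun h0 h1 =>
    ⟨by positivity, by rw [le_div_iff₀ hs] at h1; linarith⟩
  have h3 : TailBound (203 / 200) σ Λ f f' (p + 1.2 / s + 0.3 / s + 1.2 / s) (0.69 * s) :=
    TailBound.of_le (by norm_num) hσ0 hf hf' hX (by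
      have : σ * (p + 1.2 / s + 0.3 / s + 1.2 / s) = σ * p + 2.7 * (σ / s) := by field_simp; ring
      rw [this]
      nlinarith)
  have h2 := h3.cubic (by norm_num) hf hf' (1.2 / s) (-0.148 * s) (-0.7223 * s ^ 2)
    (0.3914 * s ^ 3) (-0.138 * s ^ 4) rfl (by positivity) (fun x hx0 hx1 => by
      obtain ⟨h0, h1⟩ := hL hx0 hx1
      have : σ * (p + 1.2 / s + 0.3 / s + x) = σ * p + 1.5 * (σ / s) + σ * x := by
        field_simp; ring
      rw [this]
      have hb : -0.7223 + 2 * 0.3914 * (s * x) + 3 * (-0.138) * (s * x) ^ 2 + 203 / 200 *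
          (-0.148 + -0.7223 * (s * x) + 0.3914 * (s * x) ^ 2 + -0.138 * (s * x) ^ 3) ^ 2
          ≤ 1.5 + s * x - 2.2 := by
        obtain ⟨b0, b1, b2, b3, b4, b5, b6⟩ := pow_mul_sub_pow_six_nonneg h0 h1
        linarith
      have := mul_le_mul_of_nonneg_left hb (sq_nonneg s)
      have := mul_le_mul_of_nonneg_right hσ hx0
      linarith) (by field_simp; norm_num [hs.le])
  have h1 := TailBound.cubic (by norm_num) hf hf' (0.3 / s) (0.112 * s) (-1.0128 * s ^ 2)
    (0.6151 * s ^ 3) (-0.394 * s ^ 4) h2 rfl (by positivity) (fun x hx0 hx1 => by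
      obtain ⟨h0, h1⟩ := hL hx0 hx1
      have : σ * (p + 1.2 / s + x) = σ * p + 1.2 * (σ / s) + σ * x := by
        field_simp
      rw [this]
      have hb : -1.0128 + 2 * 0.6151 * (s * x) + 3 * (-0.394) * (s * x) ^ 2 + 203 / 200 *
          (0.112 + -1.0128 * (s * x) + 0.6151 * (s * x) ^ 2 + -0.394 * (s * x) ^ 3) ^ 2
          ≤ 1.2 + s * x - 2.2 := by
        obtain ⟨b0, b1, b2, b3, b4, b5, b6⟩ := pow_mul_sub_pow_six_nonneg h0 h1
        linarith
      have := mul_le_mul_of_nonneg_left hb (sq_nonneg s)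
      have := mul_le_mul_of_nonneg_right hσ hx0
      linarith) (by field_simp; norm_num [hs.le])
  exact h1.singular (by norm_num) hf hf' (1.2 / s) (0.7444 * s ^ 2) (0.2537 * s ^ 3)
    (0.1109 * s ^ 4) rfl (by positivity) hfp (fun x hx0 hx1 => by
      obtain ⟨h0, h1⟩ := hL hx0 hx1
      have hb : (0.7444 * (s * x) - 0.2537 * (s * x) ^ 2 + 0.1109 * (s * x) ^ 3) ^ 2 - 3 * 0.7444
          + 4 * 0.2537 * (s * x) - 5 * 0.1109 * (s * x) ^ 2 ≤ 203 / 200 * (s * x - 2.2) := by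
        obtain ⟨b0, b1, b2, b3, b4, b5, b6⟩ := pow_mul_sub_pow_six_nonneg h0 h1
        linarith
      have := mul_le_mul_of_nonneg_left hb (sq_nonneg s)
      have := mul_le_mul_of_nonneg_right hσ hx0
      linarith) (by field_simp; norm_num [hs.le])

end TailBound

/-- A certificate that the sum of the line energies on both sides of the foot of the height is
nonnegative for all profiles vanishing on the given sets of points. -/
def SliceCertificate (ρ Λ : ℝ) (PL PR : Set ℝ) : Prop :=
  ∀ fL fL' fR fR' : ℝ → ℝ, (∀ x, HasDerivAt fL (fL' x) x) → Continuous fL' →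
    (∀ x, HasDerivAt fR (fR' x) x) → Continuous fR' → (∃ X, ∀ x, X ≤ x → fL x = 0) →
    (∃ X, ∀ x, X ≤ x → fR x = 0) → fL 0 = fR 0 → (∀ p ∈ PL, fL p = 0) → (∀ q ∈ PR, fR q = 0) →
    ∃ k k', TailBound (203 / 200) 1 Λ fL fL' 0 k ∧ TailBound (203 / 200) (1 / ρ) Λ fR fR' 0 k' ∧
      0 ≤ (k + k') * fL 0 ^ 2

theorem sliceCertificate_one_small :
    SliceCertificate 0.2 2.6 {0.4} ∅ := by
  intro fL fL' fR fR' hL hL' hR hR' hXL hXR h0 hPL hPR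
  have zL0 : fL 0.4 = 0 := hPL _ (by simp)
  have tL : TailBound (203 / 200) 1 2.6 fL fL' 0.4 0 :=
    TailBound.of_zero hL hL' hXL (s := 1) (by norm_num) (by norm_num) (by norm_num) zL0
  have tLi0 : TailBound (203 / 200) 1 2.6 fL fL' 0 2.12 :=
    tL.singular_left (by norm_num) hL hL' 0.4 0.7444 (-0.2538) 0.1519 (by norm_num)
      (by norm_num) zL0 (fun s h0 h1 => by
        obtain ⟨b0, b1, b2, b3, b4, b5, b6⟩ := pow_mul_sub_pow_six_nonneg h0 h1
        linarith) (by norm_num)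
  have tRt : TailBound (203 / 200) (1 / 0.2) 2.6 fR fR' 0.6 0.429 :=
    TailBound.of_le (by norm_num) (by norm_num) hR hR' hXR (by norm_num)
  have tR1 : TailBound (203 / 200) (1 / 0.2) 2.6 fR fR' 0.1 (-1.539) :=
    tRt.cubic (by norm_num) hR hR' 0.5 1.539 (-4.5041) 9.5357 (-16.795) (by norm_num)
      (by norm_num) (fun s h0 h1 => by
        obtain ⟨b0, b1, b2, b3, b4, b5, b6⟩ := pow_mul_sub_pow_six_nonneg h0 h1
        linarith) (by norm_num)
  have tR0 : TailBound (203 / 200) (1 / 0.2) 2.6 fR fR' 0 (-2.12) :=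
    tR1.cubic (by norm_num) hR hR' 0.1 2.12 (-7.1619) 17.9109 (-43.048) (by norm_num)
      (by norm_num) (fun s h0 h1 => by
        obtain ⟨b0, b1, b2, b3, b4, b5, b6⟩ := pow_mul_sub_pow_six_nonneg h0 h1
        linarith) (by norm_num)
  exact ⟨_, _, tLi0, tR0, by nlinarith [sq_nonneg (fL 0)]⟩

theorem sliceCertificate_two_tiny :
    SliceCertificate 0.09 4.66 {0.75, 2.46} ∅ := by
  intro fL fL' fR fR' hL hL' hR hR' hXL hXR h0 hPL hPR
  have zL0 : fL 0.75 = 0 := hPL _ (by simp)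
  have zL1 : fL 2.46 = 0 := hPL _ (by simp)
  have tL : TailBound (203 / 200) 1 4.66 fL fL' 2.46 0 :=
    TailBound.of_zero hL hL' hXL (s := 1) (by norm_num) (by norm_num) (by norm_num) zL1
  have tLm : TailBound (203 / 200) 1 4.66 fL fL' 1.63 0.261 :=
    tL.singular_left (by norm_num) hL hL' 0.83 0.7444 (-0.2538) 0.2559 (by norm_num)
      (by norm_num) zL1 (fun s h0 h1 => by
        obtain ⟨b0, b1, b2, b3, b4, b5, b6⟩ := pow_mul_sub_pow_six_nonneg h0 h1
        linarith) (by norm_num)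
  have tLp : TailBound (203 / 200) 1 4.66 fL fL' 0.75 0 :=
    tLm.singular (by norm_num) hL hL' 0.88 1.3229 0.2537 0.3951 (by norm_num)
      (by norm_num) zL0 (fun s h0 h1 => by
        obtain ⟨b0, b1, b2, b3, b4, b5, b6⟩ := pow_mul_sub_pow_six_nonneg h0 h1
        linarith) (by norm_num)
  have tLi0 : TailBound (203 / 200) 1 4.66 fL fL' 0.15 0.65 :=
    tLp.singular_left (by norm_num) hL hL' 0.6 1.3229 (-0.2538) 0.5631 (by norm_num)
      (by norm_num) zL0 (fun s h0 h1 => by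
        obtain ⟨b0, b1, b2, b3, b4, b5, b6⟩ := pow_mul_sub_pow_six_nonneg h0 h1
        linarith) (by norm_num)
  have tLi1 : TailBound (203 / 200) 1 4.66 fL fL' 0 (-0.061) :=
    tLi0.cubic_left (by norm_num) hL hL' 0.15 0.65 (-4.9389) 2.7584 (-9.467) (by norm_num)
      (by norm_num) (fun s h0 h1 => by
        obtain ⟨b0, b1, b2, b3, b4, b5, b6⟩ := pow_mul_sub_pow_six_nonneg h0 h1
        linarith) (by norm_num) (by norm_num)
  have tRt : TailBound (203 / 200) (1 / 0.09) 4.66 fR fR' 0.78 1.918 :=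
    TailBound.of_le (by norm_num) (by norm_num) hR hR' hXR (by norm_num)
  have tR2 : TailBound (203 / 200) (1 / 0.09) 4.66 fR fR' 0.28 (-(-1.087)) :=
    tRt.cubic (by norm_num) hR hR' 0.5 (-1.087) (-2.7482) 2.5234 (-0.7) (by norm_num)
      (by norm_num) (fun s h0 h1 => by
        obtain ⟨b0, b1, b2, b3, b4, b5, b6⟩ := pow_mul_sub_pow_six_nonneg h0 h1
        linarith) (by norm_num)
  have tR1 : TailBound (203 / 200) (1 / 0.09) 4.66 fR fR' 0.03 (-(-0.197)) :=
    tR2.cubic (by norm_num) hR hR' 0.25 (-0.197) (-4.3661) 4.6825 (-5.826) (by norm_num)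
      (by norm_num) (fun s h0 h1 => by
        obtain ⟨b0, b1, b2, b3, b4, b5, b6⟩ := pow_mul_sub_pow_six_nonneg h0 h1
        linarith) (by norm_num)
  have tR0 : TailBound (203 / 200) (1 / 0.09) 4.66 fR fR' 0 (-(-0.061)) :=
    tR1.cubic (by norm_num) hR hR' 0.03 (-0.061) (-4.6638) 5.2667 (-7.142) (by norm_num)
      (by norm_num) (fun s h0 h1 => by
        obtain ⟨b0, b1, b2, b3, b4, b5, b6⟩ := pow_mul_sub_pow_six_nonneg h0 h1
        linarith) (by norm_num)
  exact ⟨_, _, tLi1, tR0, by nlinarith [sq_nonneg (fL 0)]⟩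

theorem sliceCertificate_two_small :
    SliceCertificate 0.2 4.1 {0.36, 1.9} ∅ := by
  intro fL fL' fR fR' hL hL' hR hR' hXL hXR h0 hPL hPR
  have zL0 : fL 0.36 = 0 := hPL _ (by simp)
  have zL1 : fL 1.9 = 0 := hPL _ (by simp)
  have tL : TailBound (203 / 200) 1 4.1 fL fL' 1.9 0 :=
    TailBound.of_zero hL hL' hXL (s := 1) (by norm_num) (by norm_num) (by norm_num) zL1
  have tLm : TailBound (203 / 200) 1 4.1 fL fL' 1.43 1.679 :=
    tL.singular_left (by norm_num) hL hL' 0.47 0.7444 (-0.2538) 0.1619 (by norm_num)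
      (by norm_num) zL1 (fun s h0 h1 => by
        obtain ⟨b0, b1, b2, b3, b4, b5, b6⟩ := pow_mul_sub_pow_six_nonneg h0 h1
        linarith) (by norm_num)
  have tLp : TailBound (203 / 200) 1 4.1 fL fL' 0.36 0 :=
    tLm.singular (by norm_num) hL hL' 1.07 1.2654 0.2537 0.4683 (by norm_num)
      (by norm_num) zL0 (fun s h0 h1 => by
        obtain ⟨b0, b1, b2, b3, b4, b5, b6⟩ := pow_mul_sub_pow_six_nonneg h0 h1
        linarith) (by norm_num)
  have tLi0 : TailBound (203 / 200) 1 4.1 fL fL' 0 2.237 :=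
    tLp.singular_left (by norm_num) hL hL' 0.36 1.2654 (-0.2538) 0.3963 (by norm_num)
      (by norm_num) zL0 (fun s h0 h1 => by
        obtain ⟨b0, b1, b2, b3, b4, b5, b6⟩ := pow_mul_sub_pow_six_nonneg h0 h1
        linarith) (by norm_num)
  have tRt : TailBound (203 / 200) (1 / 0.2) 4.1 fR fR' 0.88 0.528 :=
    TailBound.of_le (by norm_num) (by norm_num) hR hR' hXR (by norm_num)
  have tR2 : TailBound (203 / 200) (1 / 0.2) 4.1 fR fR' 0.38 (-0.123) :=
    tRt.cubic (by norm_num) hR hR' 0.5 0.123 (-2.2154) 2.7765 (-1.892) (by norm_num)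
      (by norm_num) (fun s h0 h1 => by
        obtain ⟨b0, b1, b2, b3, b4, b5, b6⟩ := pow_mul_sub_pow_six_nonneg h0 h1
        linarith) (by norm_num)
  have tR1 : TailBound (203 / 200) (1 / 0.2) 4.1 fR fR' 0.08 (-1.619) :=
    tR2.cubic (by norm_num) hR hR' 0.3 1.619 (-6.3605) 12.9521 (-27.877) (by norm_num)
      (by norm_num) (fun s h0 h1 => by
        obtain ⟨b0, b1, b2, b3, b4, b5, b6⟩ := pow_mul_sub_pow_six_nonneg h0 h1
        linarith) (by norm_num)
  have tR0 : TailBound (203 / 200) (1 / 0.2) 4.1 fR fR' 0 (-2.237) :=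
    tR1.cubic (by norm_num) hR hR' 0.08 2.237 (-9.1793) 23.3421 (-63.841) (by norm_num)
      (by norm_num) (fun s h0 h1 => by
        obtain ⟨b0, b1, b2, b3, b4, b5, b6⟩ := pow_mul_sub_pow_six_nonneg h0 h1
        linarith) (by norm_num)
  exact ⟨_, _, tLi0, tR0, by nlinarith [sq_nonneg (fL 0)]⟩

theorem sliceCertificate_one_large :
    SliceCertificate 1 2.2 {0} ∅ := by
  intro fL fL' fR fR' hL hL' hR hR' hXL hXR h0 hPL hPR
  have zL0 : fL 0 = 0 := hPL _ (by simp)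
  have tL : TailBound (203 / 200) 1 2.2 fL fL' 0 0 :=
    TailBound.of_zero hL hL' hXL (s := 1) (by norm_num) (by norm_num) (by norm_num) zL0
  have tR : TailBound (203 / 200) (1 / 1) 2.2 fR fR' 0 0 :=
    TailBound.of_zero hR hR' hXR (s := 1) (by norm_num) (by norm_num) (by norm_num) (h0 ▸ zL0)
  exact ⟨_, _, tL, tR, by simp [zL0]⟩

theorem sliceCertificate_two_medium :
    SliceCertificate 0.4 3.8 {0, 1.6} ∅ := by
  intro fL fL' fR fR' hL hL' hR hR' hXL hXR h0 hPL hPR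
  have zL0 : fL 0 = 0 := hPL _ (by simp)
  have zL1 : fL 1.6 = 0 := hPL _ (by simp)
  have tL : TailBound (203 / 200) 1 3.8 fL fL' 1.6 0 :=
    TailBound.of_zero hL hL' hXL (s := 1) (by norm_num) (by norm_num) (by norm_num) zL1
  have tLm : TailBound (203 / 200) 1 3.8 fL fL' 1.02 1.154 :=
    tL.singular_left (by norm_num) hL hL' 0.58 0.7444 (-0.2538) 0.1819 (by norm_num)
      (by norm_num) zL1 (fun s h0 h1 => by
        obtain ⟨b0, b1, b2, b3, b4, b5, b6⟩ := pow_mul_sub_pow_six_nonneg h0 h1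
        linarith) (by norm_num)
  have tLp : TailBound (203 / 200) 1 3.8 fL fL' 0 0 :=
    tLm.singular (by norm_num) hL hL' 1.02 1.2857 0.2537 0.4427 (by norm_num)
      (by norm_num) zL0 (fun s h0 h1 => by
        obtain ⟨b0, b1, b2, b3, b4, b5, b6⟩ := pow_mul_sub_pow_six_nonneg h0 h1
        linarith) (by norm_num)
  have tR : TailBound (203 / 200) (1 / 0.4) 3.8 fR fR' 0 0 :=
    TailBound.of_zero hR hR' hXR (s := 1.357) (by norm_num) (by norm_num) (by norm_num) (h0 ▸ zL0)
  exact ⟨_, _, tLp, tR, by simp [zL0]⟩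

theorem sliceCertificate_two_large :
    SliceCertificate 0.7 3.4 {1.2} {0.43} := by
  intro fL fL' fR fR' hL hL' hR hR' hXL hXR h0 hPL hPR
  have zL0 : fL 1.2 = 0 := hPL _ (by simp)
  have zR0 : fR 0.43 = 0 := hPR _ (by simp)
  have tL : TailBound (203 / 200) 1 3.4 fL fL' 1.2 0 :=
    TailBound.of_zero hL hL' hXL (s := 1) (by norm_num) (by norm_num) (by norm_num) zL0
  have tR : TailBound (203 / 200) (1 / 0.7) 3.4 fR fR' 0.43 0 :=
    TailBound.of_zero hR hR' hXR (s := 1.126) (by norm_num) (by norm_num) (by norm_num) zR0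
  have tLi0 : TailBound (203 / 200) 1 3.4 fL fL' 0.36 0.228 :=
    tL.singular_left (by norm_num) hL hL' 0.84 0.7444 (-0.2538) 0.2609 (by norm_num)
      (by norm_num) zL0 (fun s h0 h1 => by
        obtain ⟨b0, b1, b2, b3, b4, b5, b6⟩ := pow_mul_sub_pow_six_nonneg h0 h1
        linarith) (by norm_num)
  have tLi1 : TailBound (203 / 200) 1 3.4 fL fL' 0 (-1.047) :=
    tLi0.cubic_left (by norm_num) hL hL' 0.36 0.228 (-3.0928) 0.2157 (-4.05) (by norm_num)
      (by norm_num) (fun s h0 h1 => by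
        obtain ⟨b0, b1, b2, b3, b4, b5, b6⟩ := pow_mul_sub_pow_six_nonneg h0 h1
        linarith) (by norm_num) (by norm_num)
  have tRi0 : TailBound (203 / 200) (1 / 0.7) 3.4 fR fR' 0 1.805 :=
    tR.singular_left (by norm_num) hR hR' 0.43 0.9425 (-0.3625) 0.2637 (by norm_num)
      (by norm_num) zR0 (fun s h0 h1 => by
        obtain ⟨b0, b1, b2, b3, b4, b5, b6⟩ := pow_mul_sub_pow_six_nonneg h0 h1
        linarith) (by norm_num)
  exact ⟨_, _, tLi1, tRi0, by nlinarith [sq_nonneg (fL 0)]⟩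

theorem sliceCertificate_two_huge :
    SliceCertificate 1 3 {0.8} {0.8} := by
  intro fL fL' fR fR' hL hL' hR hR' hXL hXR h0 hPL hPR
  have zL0 : fL 0.8 = 0 := hPL _ (by simp)
  have zR0 : fR 0.8 = 0 := hPR _ (by simp)
  have tL : TailBound (203 / 200) 1 3 fL fL' 0.8 0 :=
    TailBound.of_zero hL hL' hXL (s := 1) (by norm_num) (by norm_num) (by norm_num) zL0
  have tR : TailBound (203 / 200) (1 / 1) 3 fR fR' 0.8 0 :=
    TailBound.of_zero hR hR' hXR (s := 1) (by norm_num) (by norm_num) (by norm_num) zR0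
  have tLi0 : TailBound (203 / 200) 1 3 fL fL' 0.16 0.917 :=
    tL.singular_left (by norm_num) hL hL' 0.64 0.7444 (-0.2538) 0.1949 (by norm_num)
      (by norm_num) zL0 (fun s h0 h1 => by
        obtain ⟨b0, b1, b2, b3, b4, b5, b6⟩ := pow_mul_sub_pow_six_nonneg h0 h1
        linarith) (by norm_num)
  have tLi1 : TailBound (203 / 200) 1 3 fL fL' 0 0.374 :=
    tLi0.cubic_left (by norm_num) hL hL' 0.16 0.917 (-3.6936) 2.9378 (-6.439) (by norm_num)
      (by norm_num) (fun s h0 h1 => by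
        obtain ⟨b0, b1, b2, b3, b4, b5, b6⟩ := pow_mul_sub_pow_six_nonneg h0 h1
        linarith) (by norm_num) (by norm_num)
  have tRi0 : TailBound (203 / 200) (1 / 1) 3 fR fR' 0.16 0.917 :=
    tR.singular_left (by norm_num) hR hR' 0.64 0.7444 (-0.2538) 0.1949 (by norm_num)
      (by norm_num) zR0 (fun s h0 h1 => by
        obtain ⟨b0, b1, b2, b3, b4, b5, b6⟩ := pow_mul_sub_pow_six_nonneg h0 h1
        linarith) (by norm_num)
  have tRi1 : TailBound (203 / 200) (1 / 1) 3 fR fR' 0 0.374 :=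
    tRi0.cubic_left (by norm_num) hR hR' 0.16 0.917 (-3.6936) 2.9378 (-6.439) (by norm_num)
      (by norm_num) (fun s h0 h1 => by
        obtain ⟨b0, b1, b2, b3, b4, b5, b6⟩ := pow_mul_sub_pow_six_nonneg h0 h1
        linarith) (by norm_num) (by norm_num)
  exact ⟨_, _, tLi1, tRi1, by nlinarith [sq_nonneg (fL 0)]⟩

theorem isOpen_thinTri {ε ρ : ℝ} : IsOpen (thinTri ε ρ) := by
  have h1 : Continuous fun z : ℝ × ℝ => π * √(2 * ε) * (1 + ε * z.1) := by fun_prop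
  have h2 : Continuous fun z : ℝ × ℝ => π * √(2 * ε) * (1 - ε / ρ * z.1) := by fun_prop
  exact (isOpen_lt continuous_const continuous_snd).inter
    ((isOpen_lt continuous_snd h1).inter (isOpen_lt continuous_snd h2))

theorem thinTri_nonempty {ε ρ : ℝ} (hε : 0 < ε) : (thinTri ε ρ).Nonempty := by
  have hh : 0 < π * √(2 * ε) := mul_pos pi_pos (Real.sqrt_pos.2 (by positivity))
  exact ⟨(0, π * √(2 * ε) / 2), by positivity, by simp only [mul_zero, add_zero, mul_one]; linarith,
    by simp only [mul_zero, sub_zero, mul_one]; linarith⟩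

theorem thinTri_mono {ε ρ ρ' : ℝ} (hε : 0 < ε) (hρ : 0 < ρ) (h : ρ ≤ ρ') :
    thinTri ε ρ ⊆ thinTri ε ρ' := by
  rintro z ⟨h1, h2, h3⟩
  have hh : 0 < π * √(2 * ε) := mul_pos pi_pos (Real.sqrt_pos.2 (by positivity))
  refine ⟨h1, h2, ?_⟩
  rcases le_total z.1 0 with hz | hz
  · refine h2.trans_le (mul_le_mul_of_nonneg_left ?_ hh.le)
    have : ε * z.1 ≤ 0 := mul_nonpos_of_nonneg_of_nonpos hε.le hz
    have : ε / ρ' * z.1 ≤ 0 :=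
      mul_nonpos_of_nonneg_of_nonpos (div_pos hε (hρ.trans_le h)).le hz
    linarith
  · refine h3.trans_le (mul_le_mul_of_nonneg_left ?_ hh.le)
    have : ε / ρ' * z.1 ≤ ε / ρ * z.1 := by gcongr
    linarith

theorem lineEnergy_sum_nonneg {ρ Λ : ℝ} {PL PR : Set ℝ} (hcert : SliceCertificate ρ Λ PL PR)
    {fL fL' fR fR' : ℝ → ℝ} (hL : ∀ x, HasDerivAt fL (fL' x) x) (hL' : Continuous fL')
    (hR : ∀ x, HasDerivAt fR (fR' x) x) (hR' : Continuous fR') (hXL : ∃ X, ∀ x, X ≤ x → fL x = 0)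
    (hXR : ∃ X, ∀ x, X ≤ x → fR x = 0) (h0 : fL 0 = fR 0) (hPL : ∀ p ∈ PL, fL p = 0)
    (hPR : ∀ q ∈ PR, fR q = 0) :
    ∃ Y₀, ∀ Y, Y₀ ≤ Y → 0 ≤ lineEnergy (1 + 3 / 200) 1 Λ fL fL' 0 Y
      + lineEnergy (1 + 3 / 200) (1 / ρ) Λ fR fR' 0 Y := by
  obtain ⟨k, k', ⟨Y₁, h1⟩, ⟨Y₂, h2⟩, hk⟩ := hcert fL fL' fR fR' hL hL' hR hR' hXL hXR h0 hPL hPR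
  refine ⟨max Y₁ Y₂, fun Y hY => ?_⟩
  have := h1 Y (le_of_max_le_left hY)
  have := h2 Y (le_of_max_le_right hY)
  rw [← h0] at this
  norm_num at *
  linarith

theorem pi_sq_div_three_add_le : π ^ 2 / 3 + 1 / 4 ≤ 709 / 200 := by
  have := pi_lt_d4
  nlinarith [pi_pos]

/-- Lower bounds for Dirichlet eigenvalues from certificates on slices. -/
theorem le_dirichletEig_of_certificate {b : OrthonormalBasis (Fin 2) ℝ (EuclideanSpace ℝ (Fin 2))}
    {O : EuclideanSpace ℝ (Fin 2)} {s ε ρ ρ' Λ : ℝ} {Ω : Set (EuclideanSpace ℝ (Fin 2))}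
    (hs : s ≠ 0) (hΩ : ∀ z, simChart b O s z ∈ Ω ↔ z ∈ thinTri ε ρ) (hε : 0 < ε) (hρ : 0 < ρ)
    (hρ' : ρ ≤ ρ') (hρ1 : ρ' ≤ 1) (hΛ : 0 ≤ Λ)
    (hsmall : 2 * ε * Λ + 709 / 200 * (2 * ε ^ 3 / ρ' ^ 2) / (3 / 200) ≤ 3)
    {PL PR : Set ℝ} (hcert : SliceCertificate ρ' Λ PL PR) {m : ℕ} (c : Fin m → ℝ)
    (hPL : ∀ p ∈ PL, ∃ j, c j = -p ∧ c j ≤ 0) (hPR : ∀ q ∈ PR, ∃ j, c j = q ∧ 0 < c j) :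
    (1 / (2 * ε) + Λ) / s ^ 2 ≤ dirichletEig Ω (m + 1) := by
  have hρ'0 : 0 < ρ' := hρ.trans_le hρ'
  have hπ := pi_sq_div_three_add_le
  have hε3 : 0 < ε ^ 3 := by positivity
  have hsR : 2 * ε * Λ + (π ^ 2 / 3 + 1 / 4) * (2 * ε * (ε / ρ') ^ 2) / (3 / 200) ≤ 3 := by
    refine le_trans ?_ hsmall
    have : 2 * ε * (ε / ρ') ^ 2 = 2 * ε ^ 3 / ρ' ^ 2 := by field_simp
    rw [this]
    gcongr
  have hsL : 2 * ε * Λ + (π ^ 2 / 3 + 1 / 4) * (2 * ε * ε ^ 2) / (3 / 200) ≤ 3 := by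
    refine le_trans ?_ hsR
    gcongr
    exact (le_div_iff₀ hρ'0).2 (mul_le_of_le_one_right hε.le hρ1)
  refine le_dirichletEig hs hΩ isOpen_thinTri (thinTri_nonempty hε) c
    (fun j => if c j ≤ 0 then π * √(2 * ε) * (1 - ε * -c j) / π
      else π * √(2 * ε) * (1 - ε / ρ' * c j) / π) fun v hv hvc => ?_
  refine thin_reduction hε hρ'0 hΛ (by norm_num) (by norm_num) hsL hsR PL PR
    (fun fL fL' fR fR' hL hL' hR hR' hXL hXR h0 hPL hPR =>
      lineEnergy_sum_nonneg hcert hL hL' hR hR' hXL hXR h0 hPL hPR)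
    hv.smooth hv.compact (hv.supp.trans (thinTri_mono hε hρ hρ')) (fun p hp => ?_) fun q hq => ?_
  · obtain ⟨j, hj, hj0⟩ := hPL p hp
    have := hvc j
    simp only [if_pos hj0] at this
    rw [hj, neg_neg] at this
    exact this
  · obtain ⟨j, hj, hj0⟩ := hPR q hq
    have := hvc j
    simp only [if_neg hj0.not_ge] at this
    rw [hj] at this
    exact this

/-- An upper bound for the slice potential by a cubic polynomial. -/
theorem potential_le {ε τ κ ε₁ τ₁ k x x₀ C w₀ w₁ w₂ w₃ : ℝ} (hε : 0 < ε) (hε₁ : ε ≤ ε₁)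
    (hτ : 0 < τ) (hτ₁ : τ ≤ τ₁) (hκ : κ * (ε₁ * τ₁) ^ 2 ≤ k) (hκ0 : 0 ≤ κ) (hx : 0 ≤ x)
    (hx₀ : ε₁ * τ₁ * x ≤ x₀) (hx₁ : x₀ < 1) (hC : 4 - 3 * x₀ ≤ C * (1 - x₀) ^ 2)
    (hC' : 3 ≤ 2 * C * (1 - x₀)) (hw₀ : k ≤ w₀) (hw₁ : τ₁ + 2 * k * (ε₁ * τ₁) ≤ w₁)
    (hw₂ : 3 / 2 * τ₁ * (ε₁ * τ₁) + 3 * k * (ε₁ * τ₁) ^ 2 ≤ w₂)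
    (hw₃ : C / 2 * τ₁ * (ε₁ * τ₁) ^ 2 + C * k * (ε₁ * τ₁) ^ 3 ≤ w₃) :
    (1 / (2 * ε) + κ * (ε * τ) ^ 2) / (1 - ε * τ * x) ^ 2
      ≤ 1 / (2 * ε) + (w₀ + w₁ * x + w₂ * x ^ 2 + w₃ * x ^ 3) := by
  have hε₁0 : 0 < ε₁ := hε.trans_le hε₁
  have hτ₁0 : 0 < τ₁ := hτ.trans_le hτ₁
  have hC0 : 0 < C := by
    by_contra h
    nlinarith
  set e := ε * τ with he
  set e₁ := ε₁ * τ₁ with he₁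
  have he0 : 0 < e := by positivity
  have hee : e ≤ e₁ := by rw [he, he₁]; gcongr
  have hyy : e * x ≤ e₁ * x := by gcongr
  have hy1 : e * x < 1 := by linarith
  have hk0 : 0 ≤ k := le_trans (by positivity) hκ
  have hkey : 1 / (1 - e * x) ^ 2 ≤ 1 + 2 * (e * x) + 3 * (e * x) ^ 2 + C * (e * x) ^ 3 := by
    have hy0 : 0 ≤ e * x := by positivity
    set y := e * x
    have hy2 : y ≤ x₀ := hyy.trans hx₀
    rw [div_le_iff₀ (by have := sub_pos.2 hy1; positivity)]
    have h4 : 4 - 3 * y ≤ C * (1 - y) ^ 2 := by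
      nlinarith [mul_nonneg (sub_nonneg.2 hy2) (sub_nonneg.2 hC'),
        mul_nonneg hC0.le (sq_nonneg (x₀ - y))]
    nlinarith [mul_le_mul_of_nonneg_left h4 (pow_nonneg hy0 3)]
  have h1 : (1 / (2 * ε) + κ * e ^ 2) / (1 - e * x) ^ 2 ≤ (1 / (2 * ε) + κ * e ^ 2) *
      (1 + 2 * (e * x) + 3 * (e * x) ^ 2 + C * (e * x) ^ 3) := by
    rw [div_eq_mul_one_div]
    gcongr
  have h2 : 1 / (2 * ε) * (1 + 2 * (e * x) + 3 * (e * x) ^ 2 + C * (e * x) ^ 3)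
      = 1 / (2 * ε) + τ * x * (1 + 3 / 2 * (e * x) + C / 2 * (e * x) ^ 2) := by
    rw [he]; field_simp; ring
  have h3 : τ * x * (1 + 3 / 2 * (e * x) + C / 2 * (e * x) ^ 2)
      ≤ τ₁ * x * (1 + 3 / 2 * (e₁ * x) + C / 2 * (e₁ * x) ^ 2) := by gcongr
  have h4 : κ * e ^ 2 * (1 + 2 * (e * x) + 3 * (e * x) ^ 2 + C * (e * x) ^ 3)
      ≤ k * (1 + 2 * (e₁ * x) + 3 * (e₁ * x) ^ 2 + C * (e₁ * x) ^ 3) := by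
    have : κ * e ^ 2 ≤ k := le_trans (by gcongr) hκ
    gcongr
  have h5 := mul_le_mul_of_nonneg_right hw₁ hx
  have h6 := mul_le_mul_of_nonneg_right hw₂ (pow_nonneg hx 2)
  have h7 := mul_le_mul_of_nonneg_right hw₃ (pow_nonneg hx 3)
  calc _ ≤ _ := h1
    _ ≤ 1 / (2 * ε) + τ₁ * x * (1 + 3 / 2 * (e₁ * x) + C / 2 * (e₁ * x) ^ 2)
        + k * (1 + 2 * (e₁ * x) + 3 * (e₁ * x) ^ 2 + C * (e₁ * x) ^ 3) := by
      rw [add_mul, h2]; linarith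
    _ ≤ _ := by linarith

/-- The cubic trial function with zeros `x₁` and `x₂`. -/
def cubicProfile (x₁ x₂ β x : ℝ) : ℝ := (x - x₁) * (x₂ - x) * (1 + β * x)

/-- A primitive of `q' ^ 2 + w * q ^ 2` for cubic polynomials `q` and `w`. -/
noncomputable def cubicPrimitive (q₀ q₁ q₂ q₃ w₀ w₁ w₂ w₃ x : ℝ) : ℝ :=
  q₁ ^ 2 * x + 2 * q₁ * q₂ * x ^ 2 + (4 * q₂ ^ 2 + 6 * q₁ * q₃) * x ^ 3 / 3
    + 3 * q₂ * q₃ * x ^ 4 + 9 * q₃ ^ 2 * x ^ 5 / 5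
    + q₀ ^ 2 * (w₀ * x + w₁ * x ^ 2 / 2 + w₂ * x ^ 3 / 3 + w₃ * x ^ 4 / 4)
    + 2 * q₀ * q₁ * (w₀ * x ^ 2 / 2 + w₁ * x ^ 3 / 3 + w₂ * x ^ 4 / 4 + w₃ * x ^ 5 / 5)
    + (2 * q₀ * q₂ + q₁ ^ 2) * (w₀ * x ^ 3 / 3 + w₁ * x ^ 4 / 4 + w₂ * x ^ 5 / 5 + w₃ * x ^ 6 / 6)
    + (2 * q₀ * q₃ + 2 * q₁ * q₂) *
      (w₀ * x ^ 4 / 4 + w₁ * x ^ 5 / 5 + w₂ * x ^ 6 / 6 + w₃ * x ^ 7 / 7)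
    + (2 * q₁ * q₃ + q₂ ^ 2) * (w₀ * x ^ 5 / 5 + w₁ * x ^ 6 / 6 + w₂ * x ^ 7 / 7 + w₃ * x ^ 8 / 8)
    + 2 * q₂ * q₃ * (w₀ * x ^ 6 / 6 + w₁ * x ^ 7 / 7 + w₂ * x ^ 8 / 8 + w₃ * x ^ 9 / 9)
    + q₃ ^ 2 * (w₀ * x ^ 7 / 7 + w₁ * x ^ 8 / 8 + w₂ * x ^ 9 / 9 + w₃ * x ^ 10 / 10)

theorem hasDerivAt_cubicPrimitive (q₀ q₁ q₂ q₃ w₀ w₁ w₂ w₃ x : ℝ) :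
    HasDerivAt (cubicPrimitive q₀ q₁ q₂ q₃ w₀ w₁ w₂ w₃)
      ((q₁ + 2 * q₂ * x + 3 * q₃ * x ^ 2) ^ 2 + (w₀ + w₁ * x + w₂ * x ^ 2 + w₃ * x ^ 3) *
        (q₀ + q₁ * x + q₂ * x ^ 2 + q₃ * x ^ 3) ^ 2) x := by
  have h := fun (c : ℝ) (n : ℕ) => ((hasDerivAt_pow n x).const_mul c)
  have hs : HasDerivAt (cubicPrimitive q₀ q₁ q₂ q₃ w₀ w₁ w₂ w₃) _ x :=
    ((((((((((h (q₁ ^ 2 + q₀ ^ 2 * w₀) 1).add (h (2 * q₁ * q₂ + q₀ ^ 2 * w₁ / 2 + q₀ * q₁ * w₀) 2)).add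
      (h ((4 * q₂ ^ 2 + 6 * q₁ * q₃) / 3 + q₀ ^ 2 * w₂ / 3 + 2 * q₀ * q₁ * w₁ / 3
        + (2 * q₀ * q₂ + q₁ ^ 2) * w₀ / 3) 3)).add
      (h (3 * q₂ * q₃ + q₀ ^ 2 * w₃ / 4 + 2 * q₀ * q₁ * w₂ / 4 + (2 * q₀ * q₂ + q₁ ^ 2) * w₁ / 4
        + (2 * q₀ * q₃ + 2 * q₁ * q₂) * w₀ / 4) 4)).add
      (h (9 * q₃ ^ 2 / 5 + 2 * q₀ * q₁ * w₃ / 5 + (2 * q₀ * q₂ + q₁ ^ 2) * w₂ / 5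
        + (2 * q₀ * q₃ + 2 * q₁ * q₂) * w₁ / 5 + (2 * q₁ * q₃ + q₂ ^ 2) * w₀ / 5) 5)).add
      (h ((2 * q₀ * q₂ + q₁ ^ 2) * w₃ / 6 + (2 * q₀ * q₃ + 2 * q₁ * q₂) * w₂ / 6
        + (2 * q₁ * q₃ + q₂ ^ 2) * w₁ / 6 + 2 * q₂ * q₃ * w₀ / 6) 6)).add
      (h ((2 * q₀ * q₃ + 2 * q₁ * q₂) * w₃ / 7 + (2 * q₁ * q₃ + q₂ ^ 2) * w₂ / 7
        + 2 * q₂ * q₃ * w₁ / 7 + q₃ ^ 2 * w₀ / 7) 7)).add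
      (h ((2 * q₁ * q₃ + q₂ ^ 2) * w₃ / 8 + 2 * q₂ * q₃ * w₂ / 8 + q₃ ^ 2 * w₁ / 8) 8)).add
      (h (2 * q₂ * q₃ * w₃ / 9 + q₃ ^ 2 * w₂ / 9) 9)).add (h (q₃ ^ 2 * w₃ / 10) 10)).congr_of_eventuallyEq
      (Filter.Eventually.of_forall fun y => by
        simp only [cubicPrimitive, Pi.add_apply]; ring)
  refine hs.congr_deriv ?_
  norm_num
  ring

/-- The value of the slice energy of `cubicProfile` between `a` and `b`. -/
noncomputable def cubicEnergy (x₁ x₂ β w₀ w₁ w₂ w₃ a b : ℝ) : ℝ :=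
  cubicPrimitive (-(x₁ * x₂)) (x₁ + x₂ - β * (x₁ * x₂)) (-1 + β * (x₁ + x₂)) (-β) w₀ w₁ w₂ w₃ b
    - cubicPrimitive (-(x₁ * x₂)) (x₁ + x₂ - β * (x₁ * x₂)) (-1 + β * (x₁ + x₂)) (-β) w₀ w₁ w₂ w₃ a

theorem contDiff_cubicProfile {x₁ x₂ β : ℝ} : ContDiff ℝ (⊤ : ℕ∞) (cubicProfile x₁ x₂ β) := by
  unfold cubicProfile; fun_prop

theorem cubicProfile_pos {x₁ x₂ β x : ℝ} (h₁ : 0 < 1 + β * x₁) (h₂ : 0 < 1 + β * x₂)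
    (hx : x ∈ Set.Ioo x₁ x₂) : 0 < cubicProfile x₁ x₂ β x := by
  have h3 := sub_pos.2 hx.1
  have h4 := sub_pos.2 hx.2
  refine mul_pos (mul_pos h3 h4) ?_
  rcases le_total 0 β with hβ | hβ
  · nlinarith
  · nlinarith

theorem deriv_cubicProfile {x₁ x₂ β x : ℝ} : deriv (cubicProfile x₁ x₂ β) x
    = (x₁ + x₂ - β * (x₁ * x₂)) + 2 * (-1 + β * (x₁ + x₂)) * x + 3 * -β * x ^ 2 := by
  have h := (((hasDerivAt_id x).sub_const x₁).mul ((hasDerivAt_id x).const_sub x₂)).mul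
    (((hasDerivAt_id x).const_mul β).const_add 1)
  have h2 : HasDerivAt (cubicProfile x₁ x₂ β) _ x := h
  rw [h2.deriv]
  simp
  ring

theorem integral_cubicProfile (x₁ x₂ β w₀ w₁ w₂ w₃ a b : ℝ) :
    ∫ x in a..b, (deriv (cubicProfile x₁ x₂ β) x ^ 2 + (w₀ + w₁ * x + w₂ * x ^ 2 + w₃ * x ^ 3) *
      cubicProfile x₁ x₂ β x ^ 2) = cubicEnergy x₁ x₂ β w₀ w₁ w₂ w₃ a b := by
  rw [cubicEnergy, ← intervalIntegral.integral_eq_sub_of_hasDerivAt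
    (fun x _ => hasDerivAt_cubicPrimitive _ _ _ _ _ _ _ _ x)
    (Continuous.intervalIntegrable (by fun_prop) _ _)]
  refine intervalIntegral.integral_congr fun x _ => ?_
  simp only [deriv_cubicProfile, cubicProfile]
  ring

/-- The slice potential over the half line is at most a cubic on `[0, X]`, for all thinness
parameters up to `ε₁` and slope ratios up to `τ₁`. -/
def PotentialBound (ε₁ τ₁ X w₀ w₁ w₂ w₃ : ℝ) : Prop :=
  ∀ ε τ x, 0 < ε → ε ≤ ε₁ → 0 < τ → τ ≤ τ₁ → 0 ≤ x → x ≤ X → 0 < 1 - ε * τ * x ∧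
    (1 / (2 * ε) + (π ^ 2 / 3 + 1 / 4) * (ε * τ) ^ 2) / (1 - ε * τ * x) ^ 2
      ≤ 1 / (2 * ε) + (w₀ + w₁ * x + w₂ * x ^ 2 + w₃ * x ^ 3)

theorem potentialBound_of {ε₁ τ₁ X w₀ w₁ w₂ w₃ : ℝ} (k x₀ C : ℝ) (hε₁ : 0 ≤ ε₁) (hτ₁ : 0 ≤ τ₁)
    (hk : 709 / 200 * (ε₁ * τ₁) ^ 2 ≤ k)
    (hx₀ : ε₁ * τ₁ * X ≤ x₀) (hx₁ : x₀ < 1) (hC : 4 - 3 * x₀ ≤ C * (1 - x₀) ^ 2)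
    (hC' : 3 ≤ 2 * C * (1 - x₀)) (hw₀ : k ≤ w₀) (hw₁ : τ₁ + 2 * k * (ε₁ * τ₁) ≤ w₁)
    (hw₂ : 3 / 2 * τ₁ * (ε₁ * τ₁) + 3 * k * (ε₁ * τ₁) ^ 2 ≤ w₂)
    (hw₃ : C / 2 * τ₁ * (ε₁ * τ₁) ^ 2 + C * k * (ε₁ * τ₁) ^ 3 ≤ w₃) :
    PotentialBound ε₁ τ₁ X w₀ w₁ w₂ w₃ := by
  intro ε τ x hε hε₁' hτ hτ₁' hx hxX
  have h1 : ε₁ * τ₁ * x ≤ x₀ := le_trans (by gcongr) hx₀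
  refine ⟨?_, potential_le hε hε₁' hτ hτ₁' (le_trans ?_ hk) (by positivity) hx h1 hx₁ hC hC'
    hw₀ hw₁ hw₂ hw₃⟩
  · have : ε * τ * x ≤ ε₁ * τ₁ * x := by gcongr
    linarith
  · gcongr
    exact pi_sq_div_three_add_le

section cubicLobes

variable {ε ρ ε₁ x₁ x₂ β U w₀ w₁ w₂ w₃ : ℝ}

/-- The potential terms can be compared under the integral sign. -/
theorem integral_potential_le {a b K U : ℝ} {V w p p' : ℝ → ℝ} (hab : a ≤ b)
    (hV : ContinuousOn V (Set.Icc a b)) (hw : Continuous w) (hp : Continuous p)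
    (hp' : Continuous p') (h : ∀ x ∈ Set.Icc a b, V x ≤ K + w x) :
    ∫ x in a..b, (p' x ^ 2 + V x * p x ^ 2)
      ≤ (∫ x in a..b, (p' x ^ 2 + (w x - U) * p x ^ 2)) + (K + U) * ∫ x in a..b, p x ^ 2 := by
  have hVi : IntervalIntegrable (fun x => p' x ^ 2 + V x * p x ^ 2) volume a b := by
    refine ContinuousOn.intervalIntegrable ?_
    rw [Set.uIcc_of_le hab]
    exact (by fun_prop : Continuous fun x => p' x ^ 2).continuousOn.add
      (hV.mul (by fun_prop : Continuous fun x => p x ^ 2).continuousOn)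
  rw [← intervalIntegral.integral_const_mul, ← intervalIntegral.integral_add
    (Continuous.intervalIntegrable (by fun_prop) _ _)
    (Continuous.intervalIntegrable (by fun_prop) _ _)]
  refine intervalIntegral.integral_mono_on hab hVi
    (Continuous.intervalIntegrable (by fun_prop) _ _) fun x hx => ?_
  have := mul_le_mul_of_nonneg_right (h x hx) (sq_nonneg (p x))
  linarith

theorem integral_cubicProfile_left_le {a b : ℝ} (hε : 0 < ε) (hε₁ : ε ≤ ε₁)
    (hw : PotentialBound ε₁ 1 (-a) w₀ w₁ w₂ w₃) (hab : a ≤ b) (hb : b ≤ 0) :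
    (∫ x in a..b, (deriv (cubicProfile x₁ x₂ β) x ^ 2 + (1 / (2 * ε) + (π ^ 2 / 3 + 1 / 4) * ε ^ 2) /
      (1 + ε * x) ^ 2 * cubicProfile x₁ x₂ β x ^ 2)) ≤
      cubicEnergy x₁ x₂ β (w₀ - U) (-w₁) w₂ (-w₃) a b
        + (1 / (2 * ε) + U) * ∫ x in a..b, cubicProfile x₁ x₂ β x ^ 2 := by
  have hd : Continuous (deriv (cubicProfile x₁ x₂ β)) :=
    contDiff_cubicProfile.continuous_deriv (by simp)
  have hp : ∀ x ∈ Set.Icc a b, 0 < 1 + ε * x ∧ (1 / (2 * ε) + (π ^ 2 / 3 + 1 / 4) * ε ^ 2) /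
      (1 + ε * x) ^ 2 ≤ 1 / (2 * ε) + (w₀ + -w₁ * x + w₂ * x ^ 2 + -w₃ * x ^ 3) := fun x hx => by
    have := hw ε 1 (-x) hε hε₁ one_pos le_rfl (by linarith [hx.2]) (by linarith [hx.1])
    rw [mul_one, mul_neg, sub_neg_eq_add] at this
    exact ⟨this.1, this.2.trans_eq (by ring)⟩
  refine (integral_potential_le (U := U) hab ?_ (by fun_prop) contDiff_cubicProfile.continuous hd
    fun x hx => (hp x hx).2).trans_eq ?_
  · exact continuousOn_const.div (by fun_prop) fun x hx => (pow_pos (hp x hx).1 2).ne'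
  · rw [← integral_cubicProfile]
    congr 1
    refine intervalIntegral.integral_congr fun x _ => ?_
    ring

theorem integral_cubicProfile_right_le {τ₁ b : ℝ} (hε : 0 < ε) (hε₁ : ε ≤ ε₁) (hρ : 0 < ρ)
    (hτ₁ : ρ⁻¹ ≤ τ₁) (hw : PotentialBound ε₁ τ₁ b w₀ w₁ w₂ w₃) (hb : 0 ≤ b) :
    (∫ x in 0..b, (deriv (cubicProfile x₁ x₂ β) x ^ 2 +
      (1 / (2 * ε) + (π ^ 2 / 3 + 1 / 4) * (ε / ρ) ^ 2) /
      (1 - ε / ρ * x) ^ 2 * cubicProfile x₁ x₂ β x ^ 2)) ≤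
      cubicEnergy x₁ x₂ β (w₀ - U) w₁ w₂ w₃ 0 b
        + (1 / (2 * ε) + U) * ∫ x in 0..b, cubicProfile x₁ x₂ β x ^ 2 := by
  have hd : Continuous (deriv (cubicProfile x₁ x₂ β)) :=
    contDiff_cubicProfile.continuous_deriv (by simp)
  have hp := fun x (hx : x ∈ Set.Icc 0 b) => hw ε ρ⁻¹ x hε hε₁ (inv_pos.2 hρ) hτ₁ hx.1 hx.2
  simp only [← div_eq_mul_inv] at hp
  refine (integral_potential_le (U := U) hb ?_ (by fun_prop) contDiff_cubicProfile.continuous hd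
    fun x hx => (hp x hx).2).trans_eq ?_
  · exact continuousOn_const.div (by fun_prop) fun x hx => (pow_pos (hp x hx).1 2).ne'
  · rw [← integral_cubicProfile]
    congr 1
    refine intervalIntegral.integral_congr fun x _ => ?_
    ring

theorem exists_isTest_cubic_left (hε : 0 < ε) (hε₁ : ε ≤ ε₁) (hρ : 0 < ρ)
    (hw : PotentialBound ε₁ 1 (-x₁) w₀ w₁ w₂ w₃) (hx : x₁ < x₂) (hx₂ : x₂ ≤ 0)
    (hβ₁ : 0 < 1 + β * x₁) (hβ₂ : 0 < 1 + β * x₂) (hU : 0 ≤ U)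
    (h : cubicEnergy x₁ x₂ β (w₀ - U) (-w₁) w₂ (-w₃) x₁ x₂ < 0) :
    ∃ v, IsTest (thinTri ε ρ ∩ {z | x₁ < z.1 ∧ z.1 < x₂}) v ∧ (∃ z, v z ≠ 0) ∧
      ∫ z, gradSq v z ≤ (1 / (2 * ε) + U) * ∫ z, v z ^ 2 := by
  refine exists_isTest_left hε hρ hx hx₂ ?_ contDiff_cubicProfile (by simp [cubicProfile])
    (by simp [cubicProfile]) (fun x hx => cubicProfile_pos hβ₁ hβ₂ hx) hU ?_
  · have := (hw ε 1 (-x₁) hε hε₁ one_pos le_rfl (by linarith) le_rfl).1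
    rwa [mul_one, mul_neg, sub_neg_eq_add] at this
  · have := integral_cubicProfile_left_le (U := U) (x₁ := x₁) (x₂ := x₂) (β := β)
      hε hε₁ hw hx.le hx₂
    linarith

theorem exists_isTest_cubic_straddle {τ₁ v₀ v₁ v₂ v₃ : ℝ} (hε : 0 < ε) (hε₁ : ε ≤ ε₁)
    (hρ : 0 < ρ) (hτ₁ : ρ⁻¹ ≤ τ₁) (hw : PotentialBound ε₁ 1 (-x₁) w₀ w₁ w₂ w₃)
    (hv : PotentialBound ε₁ τ₁ x₂ v₀ v₁ v₂ v₃) (hx₁ : x₁ < 0) (hx₂ : 0 < x₂)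
    (hβ₁ : 0 < 1 + β * x₁) (hβ₂ : 0 < 1 + β * x₂) (hU : 0 ≤ U)
    (h : cubicEnergy x₁ x₂ β (w₀ - U) (-w₁) w₂ (-w₃) x₁ 0
      + cubicEnergy x₁ x₂ β (v₀ - U) v₁ v₂ v₃ 0 x₂ < 0) :
    ∃ v, IsTest (thinTri ε ρ ∩ {z | x₁ < z.1 ∧ z.1 < x₂}) v ∧ (∃ z, v z ≠ 0) ∧
      ∫ z, gradSq v z ≤ (1 / (2 * ε) + U) * ∫ z, v z ^ 2 := by
  refine exists_isTest_straddle hε hρ hx₁ hx₂ ?_ ?_ contDiff_cubicProfile (by simp [cubicProfile])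
    (by simp [cubicProfile]) (fun x hx => cubicProfile_pos hβ₁ hβ₂ hx) hU ?_
  · have := (hw ε 1 (-x₁) hε hε₁ one_pos le_rfl (by linarith) le_rfl).1
    rwa [mul_one, mul_neg, sub_neg_eq_add] at this
  · have := (hv ε ρ⁻¹ x₂ hε hε₁ (inv_pos.2 hρ) hτ₁ hx₂.le le_rfl).1
    rwa [← div_eq_mul_inv] at this
  · have h1 := integral_cubicProfile_left_le (U := U) (x₁ := x₁) (x₂ := x₂) (β := β)
      hε hε₁ hw hx₁.le
      le_rfl
    have h2 := integral_cubicProfile_right_le (U := U) (x₁ := x₁) (x₂ := x₂) (β := β) hε hε₁ hρ hτ₁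
      hv hx₂.le
    have hc : Continuous fun x => cubicProfile x₁ x₂ β x ^ 2 :=
      contDiff_cubicProfile.continuous.pow 2
    rw [← intervalIntegral.integral_add_adjacent_intervals (hc.intervalIntegrable x₁ 0)
      (hc.intervalIntegrable 0 x₂)]
    linarith

end cubicLobes

/-- There is a test function supported in the slab `x₁ < z.1 < x₂` of `thinTri ε ρ` with Rayleigh
quotient at most `1 / (2 * ε) + U`. -/
def HasLobe (ε ρ x₁ x₂ U : ℝ) : Prop :=
  ∃ v : ℝ × ℝ → ℝ, IsTest (thinTri ε ρ ∩ {z | x₁ < z.1 ∧ z.1 < x₂}) v ∧ (∃ z, v z ≠ 0) ∧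
    ∫ z, gradSq v z ≤ (1 / (2 * ε) + U) * ∫ z, v z ^ 2

section lobes

variable {ε ρ : ℝ}

theorem hasLobe_left_tiny (hε : 0 < ε) (hε₁ : ε ≤ 0.0347) (hρ : 0 < ρ) :
    HasLobe ε ρ (-5.33) (-1.63) 4.65 := by
  refine exists_isTest_cubic_left (β := 0.187) hε hε₁ hρ
    (potentialBound_of (w₀ := 0.0043) (w₁ := 1.0003) (w₂ := 0.0521) (w₃ := 0.0032)
      0.00427 0.185 5.19 ?_ ?_ ?_ ?_ ?_ ?_ ?_ ?_ ?_ ?_ ?_) ?_ ?_ ?_ ?_ ?_ ?_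
  all_goals norm_num [cubicEnergy, cubicPrimitive]

theorem hasLobe_right_tiny (hε : 0 < ε) (hε₁ : ε ≤ 0.0347) (hρ : 0 < ρ) :
    HasLobe ε ρ (-1.63) 0 4.65 := by
  refine exists_isTest_cubic_left (β := 0.084) hε hε₁ hρ
    (potentialBound_of (w₀ := 0.0043) (w₁ := 1.0003) (w₂ := 0.0521) (w₃ := 0.0026)
      0.00427 0.0566 4.31 ?_ ?_ ?_ ?_ ?_ ?_ ?_ ?_ ?_ ?_ ?_) ?_ ?_ ?_ ?_ ?_ ?_
  all_goals norm_num [cubicEnergy, cubicPrimitive]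

theorem hasLobe_left_small (hε : 0 < ε) (hε₁ : ε ≤ 0.037) (hρ : 0 < ρ) :
    HasLobe ε ρ (-4.8) (-1.14) 4.09 := by
  refine exists_isTest_cubic_left (β := 0.203) hε hε₁ hρ
    (potentialBound_of (w₀ := 0.0049) (w₁ := 1.0004) (w₂ := 0.0556) (w₃ := 0.0036)
      0.00486 0.1776 5.13 ?_ ?_ ?_ ?_ ?_ ?_ ?_ ?_ ?_ ?_ ?_) ?_ ?_ ?_ ?_ ?_ ?_
  all_goals norm_num [cubicEnergy, cubicPrimitive]

theorem hasLobe_right_small (hε : 0 < ε) (hε₁ : ε ≤ 0.037) (hρ : 0 < ρ) (hτ : ρ⁻¹ ≤ 11.2) :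
    HasLobe ε ρ (-1.14) 1.025 4.09 := by
  refine exists_isTest_cubic_straddle (β := -0.786) hε hε₁ hρ hτ
    (potentialBound_of (w₀ := 0.0049) (w₁ := 1.0004) (w₂ := 0.0556) (w₃ := 0.0029)
      0.00486 0.0422 4.23 ?_ ?_ ?_ ?_ ?_ ?_ ?_ ?_ ?_ ?_ ?_)
    (potentialBound_of (w₀ := 0.6088) (w₁ := 11.7046) (w₂ := 7.2756) (w₃ := 8.2812)
      0.60878 0.4248 8.24 ?_ ?_ ?_ ?_ ?_ ?_ ?_ ?_ ?_ ?_ ?_) ?_ ?_ ?_ ?_ ?_ ?_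
  all_goals norm_num [cubicEnergy, cubicPrimitive]

theorem hasLobe_left_medium (hε : 0 < ε) (hε₁ : ε ≤ 0.041) (hρ : 0 < ρ) :
    HasLobe ε ρ (-4.57) (-0.87) 3.75 := by
  refine exists_isTest_cubic_left (β := 0.215) hε hε₁ hρ
    (potentialBound_of (w₀ := 0.006) (w₁ := 1.0005) (w₂ := 0.0616) (w₃ := 0.0044)
      0.00596 0.1874 5.21 ?_ ?_ ?_ ?_ ?_ ?_ ?_ ?_ ?_ ?_ ?_) ?_ ?_ ?_ ?_ ?_ ?_
  all_goals norm_num [cubicEnergy, cubicPrimitive]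

theorem hasLobe_right_medium (hε : 0 < ε) (hε₁ : ε ≤ 0.041) (hρ : 0 < ρ) (hτ : ρ⁻¹ ≤ 5) :
    HasLobe ε ρ (-0.87) 1.615 3.75 := by
  refine exists_isTest_cubic_straddle (β := -0.611) hε hε₁ hρ hτ
    (potentialBound_of (w₀ := 0.006) (w₁ := 1.0005) (w₂ := 0.0616) (w₃ := 0.0036)
      0.00596 0.0357 4.19 ?_ ?_ ?_ ?_ ?_ ?_ ?_ ?_ ?_ ?_ ?_)
    (potentialBound_of (w₀ := 0.149) (w₁ := 5.0611) (w₂ := 1.5563) (w₃ := 0.7147)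
      0.14898 0.3311 6.72 ?_ ?_ ?_ ?_ ?_ ?_ ?_ ?_ ?_ ?_ ?_) ?_ ?_ ?_ ?_ ?_ ?_
  all_goals norm_num [cubicEnergy, cubicPrimitive]

theorem hasLobe_left_large (hε : 0 < ε) (hε₁ : ε ≤ 0.0467) (hρ : 0 < ρ) :
    HasLobe ε ρ (-4.3) (-0.57) 3.37 := by
  refine exists_isTest_cubic_left (β := 0.231) hε hε₁ hρ
    (potentialBound_of (w₀ := 0.0078) (w₁ := 1.0008) (w₂ := 0.0702) (w₃ := 0.0059)
      0.00774 0.2009 5.33 ?_ ?_ ?_ ?_ ?_ ?_ ?_ ?_ ?_ ?_ ?_) ?_ ?_ ?_ ?_ ?_ ?_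
  all_goals norm_num [cubicEnergy, cubicPrimitive]

theorem hasLobe_right_large (hε : 0 < ε) (hε₁ : ε ≤ 0.0467) (hρ : 0 < ρ) (hτ : ρ⁻¹ ≤ 2.5) :
    HasLobe ε ρ (-0.57) 2.25 3.37 := by
  refine exists_isTest_cubic_straddle (β := -0.432) hε hε₁ hρ hτ
    (potentialBound_of (w₀ := 0.0078) (w₁ := 1.0008) (w₂ := 0.0702) (w₃ := 0.0046)
      0.00774 0.0267 4.14 ?_ ?_ ?_ ?_ ?_ ?_ ?_ ?_ ?_ ?_ ?_)
    (potentialBound_of (w₀ := 0.0484) (w₁ := 2.5113) (w₂ := 0.4398) (w₃ := 0.1012)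
      0.04833 0.2627 5.91 ?_ ?_ ?_ ?_ ?_ ?_ ?_ ?_ ?_ ?_ ?_) ?_ ?_ ?_ ?_ ?_ ?_
  all_goals norm_num [cubicEnergy, cubicPrimitive]

theorem hasLobe_left_huge (hε : 0 < ε) (hε₁ : ε ≤ 0.052) (hρ : 0 < ρ) :
    HasLobe ε ρ (-4.05) (-0.25) 2.98 := by
  refine exists_isTest_cubic_left (β := 0.244) hε hε₁ hρ
    (potentialBound_of (w₀ := 0.0096) (w₁ := 1.001) (w₂ := 0.0781) (w₃ := 0.0074)
      0.00959 0.2106 5.41 ?_ ?_ ?_ ?_ ?_ ?_ ?_ ?_ ?_ ?_ ?_) ?_ ?_ ?_ ?_ ?_ ?_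
  all_goals norm_num [cubicEnergy, cubicPrimitive]

theorem hasLobe_right_huge (hε : 0 < ε) (hε₁ : ε ≤ 0.052) (hρ : 0 < ρ) (hτ : ρ⁻¹ ≤ 1.43) :
    HasLobe ε ρ (-0.25) 3 2.98 := by
  refine exists_isTest_cubic_straddle (β := -0.317) hε hε₁ hρ hτ
    (potentialBound_of (w₀ := 0.0096) (w₁ := 1.001) (w₂ := 0.0781) (w₃ := 0.0056)
      0.00959 0.013 4.07 ?_ ?_ ?_ ?_ ?_ ?_ ?_ ?_ ?_ ?_ ?_)
    (potentialBound_of (w₀ := 0.0197) (w₁ := 1.433) (w₂ := 0.1599) (w₃ := 0.0219)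
      0.01961 0.2231 5.52 ?_ ?_ ?_ ?_ ?_ ?_ ?_ ?_ ?_ ?_ ?_) ?_ ?_ ?_ ?_ ?_ ?_
  all_goals norm_num [cubicEnergy, cubicPrimitive]

theorem hasLobe_one_small (hε : 0 < ε) (hε₁ : ε ≤ 0.037) (hρ : 0 < ρ) :
    HasLobe ε ρ (-3.9) 0 2.57 := by
  refine exists_isTest_cubic_left (β := 0.254) hε hε₁ hρ
    (potentialBound_of (w₀ := 0.0049) (w₁ := 1.0004) (w₂ := 0.0556) (w₃ := 0.0034)
      0.00486 0.1443 4.88 ?_ ?_ ?_ ?_ ?_ ?_ ?_ ?_ ?_ ?_ ?_) ?_ ?_ ?_ ?_ ?_ ?_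
  all_goals norm_num [cubicEnergy, cubicPrimitive]

theorem hasLobe_one_large (hε : 0 < ε) (hε₁ : ε ≤ 0.052) (hρ : 0 < ρ) (hτ : ρ⁻¹ ≤ 5) :
    HasLobe ε ρ (-3.5) 1.1 2.1 := by
  refine exists_isTest_cubic_straddle (β := 0.225) hε hε₁ hρ hτ
    (potentialBound_of (w₀ := 0.0096) (w₁ := 1.001) (w₂ := 0.0781) (w₃ := 0.007)
      0.00959 0.182 5.17 ?_ ?_ ?_ ?_ ?_ ?_ ?_ ?_ ?_ ?_ ?_)
    (potentialBound_of (w₀ := 0.2397) (w₁ := 5.1247) (w₂ := 1.9987) (w₃ := 1.0688)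
      0.23965 0.286 6.17 ?_ ?_ ?_ ?_ ?_ ?_ ?_ ?_ ?_ ?_ ?_) ?_ ?_ ?_ ?_ ?_ ?_
  all_goals norm_num [cubicEnergy, cubicPrimitive]

end lobes

section thinGap

variable {b : OrthonormalBasis (Fin 2) ℝ (EuclideanSpace ℝ (Fin 2))}
  {O : EuclideanSpace ℝ (Fin 2)} {s ε ρ : ℝ} {Ω : Set (EuclideanSpace ℝ (Fin 2))}

theorem dirichletEig_one_le_of_hasLobe (hs : s ≠ 0)
    (hΩ : ∀ z, simChart b O s z ∈ Ω ↔ z ∈ thinTri ε ρ) (hε : 0 < ε) {x₁ x₂ U : ℝ} (hU : 0 ≤ U)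
    (h : HasLobe ε ρ x₁ x₂ U) : dirichletEig Ω 1 ≤ (1 / (2 * ε) + U) / s ^ 2 := by
  obtain ⟨v, hv, hv0, hle⟩ := h
  exact dirichletEig_le_of_disjoint hs hΩ (fun _ => Set.inter_subset_left)
    (fun i j hij => absurd (Subsingleton.elim i j) hij) (fun _ => hv) (fun _ => hv0)
    (by positivity) fun _ => hle

theorem dirichletEig_two_le_of_hasLobe (hs : s ≠ 0)
    (hΩ : ∀ z, simChart b O s z ∈ Ω ↔ z ∈ thinTri ε ρ) (hε : 0 < ε) {x₁ x₂ x₃ U : ℝ} (hU : 0 ≤ U)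
    (h : HasLobe ε ρ x₁ x₂ U) (h' : HasLobe ε ρ x₂ x₃ U) :
    dirichletEig Ω 2 ≤ (1 / (2 * ε) + U) / s ^ 2 := by
  obtain ⟨v, hv, hv0, hle⟩ := h
  obtain ⟨v', hv', hv0', hle'⟩ := h'
  have hd : Disjoint (thinTri ε ρ ∩ {z | x₁ < z.1 ∧ z.1 < x₂})
      (thinTri ε ρ ∩ {z | x₂ < z.1 ∧ z.1 < x₃}) :=
    Set.disjoint_left.2 fun z hz hz' => lt_asymm hz.2.2 hz'.2.1
  refine dirichletEig_le_of_disjoint hs hΩ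
    (W := ![thinTri ε ρ ∩ {z | x₁ < z.1 ∧ z.1 < x₂}, thinTri ε ρ ∩ {z | x₂ < z.1 ∧ z.1 < x₃}])
    (v := ![v, v']) ?_ ?_ ?_ ?_ (by positivity) ?_
  · intro i; fin_cases i <;> exact Set.inter_subset_left
  · intro i j hij
    fin_cases i <;> fin_cases j
    exacts [absurd rfl hij, hd, hd.symm, absurd rfl hij]
  · intro i; fin_cases i
    exacts [hv, hv']
  · intro i; fin_cases i
    exacts [hv0, hv0']
  · intro i; fin_cases i
    exacts [hle, hle']

theorem div_sq_lt_div_sq (hs : s ≠ 0) {K U Λ : ℝ} (h : U < Λ) :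
    (K + U) / s ^ 2 < (K + Λ) / s ^ 2 := by
  have : 0 < s ^ 2 := by positivity
  gcongr

/-- Simplicity of the second eigenvalue for sufficiently thin triangles in normal form. -/
theorem dirichletEig_gaps_of_thinTri (hs : s ≠ 0)
    (hΩ : ∀ z, simChart b O s z ∈ Ω ↔ z ∈ thinTri ε ρ) (hε : 0 < ε) (hρ : 0 < ρ) (hρ1 : ρ ≤ 1)
    (hthin : 2 * π ^ 2 * ε ^ 3 ≤ (0.02622 * (1 + ρ)) ^ 2) :
    dirichletEig Ω 1 < dirichletEig Ω 2 ∧ dirichletEig Ω 2 < dirichletEig Ω 3 := by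
  have hε3 : 0 < ε ^ 3 := by positivity
  have hcube : 19.738 * ε ^ 3 ≤ (0.02622 * (1 + ρ)) ^ 2 := by
    refine le_trans (mul_le_mul_of_nonneg_right ?_ hε3.le) hthin
    have := pi_gt_d4
    nlinarith
  have hbound : ∀ ρ', ρ ≤ ρ' → 19.738 * ε ^ 3 ≤ (0.02622 * (1 + ρ')) ^ 2 := fun ρ' h =>
    hcube.trans (by gcongr)
  have hεle : ∀ ρ' ε₁, ρ ≤ ρ' → 0 ≤ ε₁ → (0.02622 * (1 + ρ')) ^ 2 ≤ 19.738 * ε₁ ^ 3 → ε ≤ ε₁ := by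
    intro ρ' ε₁ h h0 h1
    refine (pow_le_pow_iff_left₀ hε.le h0 three_ne_zero).1 ?_
    have := (hbound ρ' h).trans h1
    linarith
  have hinv : ∀ r t : ℝ, 0 < r → r ≤ ρ → r⁻¹ ≤ t → ρ⁻¹ ≤ t := fun r t h0 h1 h2 =>
    (inv_anti₀ h0 h1).trans h2
  constructor
  · rcases le_total ρ 0.2 with h | h
    · have hε₁ : ε ≤ 0.037 := hεle 0.2 _ h (by norm_num) (by norm_num)
      refine (dirichletEig_one_le_of_hasLobe hs hΩ hε (by norm_num)
        (hasLobe_one_small hε hε₁ hρ)).trans_lt ((div_sq_lt_div_sq hs (by norm_num)).trans_le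
        (le_dirichletEig_of_certificate hs hΩ hε hρ h (by norm_num) (by norm_num) ?_
          sliceCertificate_one_small ![-0.4] ?_ ?_))
      · have := hbound 0.2 h
        norm_num at this ⊢
        linarith
      · rintro p rfl
        exact ⟨0, by norm_num⟩
      · rintro q ⟨⟩
    · have hε₁ : ε ≤ 0.052 := hεle 1 _ hρ1 (by norm_num) (by norm_num)
      refine (dirichletEig_one_le_of_hasLobe hs hΩ hε (by norm_num)
        (hasLobe_one_large hε hε₁ hρ (hinv _ _ (by norm_num) h (by norm_num)))).trans_lt
        ((div_sq_lt_div_sq hs (by norm_num)).trans_le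
        (le_dirichletEig_of_certificate hs hΩ hε hρ hρ1 (by norm_num) (by norm_num) ?_
          sliceCertificate_one_large ![0] ?_ ?_))
      · have := hbound 1 hρ1
        norm_num at this ⊢
        linarith
      · rintro p rfl
        exact ⟨0, by norm_num⟩
      · rintro q ⟨⟩
  · rcases le_total ρ 0.09 with h | h
    · have hε₁ : ε ≤ 0.0347 := hεle 0.09 _ h (by norm_num) (by norm_num)
      refine (dirichletEig_two_le_of_hasLobe hs hΩ hε (by norm_num) (hasLobe_left_tiny hε hε₁ hρ)
        (hasLobe_right_tiny hε hε₁ hρ)).trans_lt ((div_sq_lt_div_sq hs (by norm_num)).trans_le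
        (le_dirichletEig_of_certificate hs hΩ hε hρ h (by norm_num) (by norm_num) ?_
          sliceCertificate_two_tiny ![-0.75, -2.46] ?_ ?_))
      · have := hbound 0.09 h
        norm_num at this ⊢
        linarith
      · rintro p (rfl | rfl)
        exacts [⟨0, by norm_num⟩, ⟨1, by norm_num⟩]
      · rintro q ⟨⟩
    rcases le_total ρ 0.2 with h' | h'
    · have hε₁ : ε ≤ 0.037 := hεle 0.2 _ h' (by norm_num) (by norm_num)
      refine (dirichletEig_two_le_of_hasLobe hs hΩ hε (by norm_num) (hasLobe_left_small hε hε₁ hρ)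
        (hasLobe_right_small hε hε₁ hρ (hinv _ _ (by norm_num) h (by norm_num)))).trans_lt
        ((div_sq_lt_div_sq hs (by norm_num)).trans_le
        (le_dirichletEig_of_certificate hs hΩ hε hρ h' (by norm_num) (by norm_num) ?_
          sliceCertificate_two_small ![-0.36, -1.9] ?_ ?_))
      · have := hbound 0.2 h'
        norm_num at this ⊢
        linarith
      · rintro p (rfl | rfl)
        exacts [⟨0, by norm_num⟩, ⟨1, by norm_num⟩]
      · rintro q ⟨⟩
    clear h
    rcases le_total ρ 0.4 with h | h
    · have hε₁ : ε ≤ 0.041 := hεle 0.4 _ h (by norm_num) (by norm_num)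
      refine (dirichletEig_two_le_of_hasLobe hs hΩ hε (by norm_num) (hasLobe_left_medium hε hε₁ hρ)
        (hasLobe_right_medium hε hε₁ hρ (hinv _ _ (by norm_num) h' (by norm_num)))).trans_lt
        ((div_sq_lt_div_sq hs (by norm_num)).trans_le
        (le_dirichletEig_of_certificate hs hΩ hε hρ h (by norm_num) (by norm_num) ?_
          sliceCertificate_two_medium ![0, -1.6] ?_ ?_))
      · have := hbound 0.4 h
        norm_num at this ⊢
        linarith
      · rintro p (rfl | rfl)
        exacts [⟨0, by norm_num⟩, ⟨1, by norm_num⟩]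
      · rintro q ⟨⟩
    clear h'
    rcases le_total ρ 0.7 with h' | h'
    · have hε₁ : ε ≤ 0.0467 := hεle 0.7 _ h' (by norm_num) (by norm_num)
      refine (dirichletEig_two_le_of_hasLobe hs hΩ hε (by norm_num) (hasLobe_left_large hε hε₁ hρ)
        (hasLobe_right_large hε hε₁ hρ (hinv _ _ (by norm_num) h (by norm_num)))).trans_lt
        ((div_sq_lt_div_sq hs (by norm_num)).trans_le
        (le_dirichletEig_of_certificate hs hΩ hε hρ h' (by norm_num) (by norm_num) ?_
          sliceCertificate_two_large ![-1.2, 0.43] ?_ ?_))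
      · have := hbound 0.7 h'
        norm_num at this ⊢
        linarith
      · rintro p rfl
        exact ⟨0, by norm_num⟩
      · rintro q rfl
        exact ⟨1, by norm_num⟩
    · have hε₁ : ε ≤ 0.052 := hεle 1 _ hρ1 (by norm_num) (by norm_num)
      refine (dirichletEig_two_le_of_hasLobe hs hΩ hε (by norm_num) (hasLobe_left_huge hε hε₁ hρ)
        (hasLobe_right_huge hε hε₁ hρ (hinv _ _ (by norm_num) h' (by norm_num)))).trans_lt
        ((div_sq_lt_div_sq hs (by norm_num)).trans_le
        (le_dirichletEig_of_certificate hs hΩ hε hρ hρ1 (by norm_num) (by norm_num) ?_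
          sliceCertificate_two_huge ![-0.8, 0.8] ?_ ?_))
      · have := hbound 1 hρ1
        norm_num at this ⊢
        linarith
      · rintro p rfl
        exact ⟨0, by norm_num⟩
      · rintro q rfl
        exact ⟨1, by norm_num⟩

end thinGap

theorem tan_pi_div_sixty_lt : 1 / 2 * tan (π / 60) < 0.02622 := by
  have hπ := pi_lt_d4
  have h0 : 0 < π / 60 := by positivity
  have hs := sin_le h0.le
  have hc := one_sub_sq_div_two_le_cos (x := π / 60)
  have hc' : 0.9986 < cos (π / 60) := by nlinarith
  rw [tan_eq_sin_div_cos, ← mul_div_assoc, div_lt_iff₀ (by linarith)]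
  linarith

/-- The area of a thin triangle in normal form. -/
theorem le_volume_thinTri {ε ρ : ℝ} (hε : 0 < ε) (hρ : 0 < ρ) :
    ENNReal.ofReal (π * √(2 * ε) * (1 + ρ) / (2 * ε)) ≤ volume (thinTri ε ρ) := by
  set h := π * √(2 * ε) with hh
  have hh0 : 0 < h := by positivity
  have hslice : ∀ y ∈ Set.Ioo 0 h, volume ((fun x => (x, y)) ⁻¹' thinTri ε ρ)
      = ENNReal.ofReal ((1 - y / h) * ((1 + ρ) / ε)) := by
    intro y hy
    have : (fun x => (x, y)) ⁻¹' thinTri ε ρ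
        = Set.Ioo (-(1 - y / h) / ε) ((1 - y / h) * ρ / ε) := by
      ext x
      simp only [thinTri, Set.mem_preimage, Set.mem_ofPred_eq, Set.mem_Ioo, hy.1, true_and, ← hh]
      rw [div_lt_iff₀ hε, lt_div_iff₀ hε, ← div_lt_iff₀' hh0, ← div_lt_iff₀' hh0]
      have hx : ε / ρ * x * ρ = x * ε := by field_simp
      constructor
      · rintro ⟨h1, h2⟩
        refine ⟨by linarith, ?_⟩
        have := mul_lt_mul_of_pos_right h2 hρ
        linarith
      · rintro ⟨h1, h2⟩
        refine ⟨by linarith, lt_of_mul_lt_mul_right ?_ hρ.le⟩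
        linarith
    rw [this, Real.volume_Ioo]
    congr 1
    field_simp
    ring
  have hInt : ∫ y in (0)..h, (1 - y / h) * ((1 + ρ) / ε) = h * (1 + ρ) / (2 * ε) := by
    rw [intervalIntegral.integral_mul_const, intervalIntegral.integral_sub (by simp)
      (Continuous.intervalIntegrable (by fun_prop) _ _), intervalIntegral.integral_div]
    simp
    field_simp
    ring
  rw [Measure.volume_eq_prod, Measure.prod_apply_symm isOpen_thinTri.measurableSet]
  calc _ = ENNReal.ofReal (∫ y in Set.Ioo 0 h, (1 - y / h) * ((1 + ρ) / ε)) := by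
        rw [← hInt, intervalIntegral.integral_of_le hh0.le, integral_Ioc_eq_integral_Ioo]
    _ = ∫⁻ y in Set.Ioo 0 h, ENNReal.ofReal ((1 - y / h) * ((1 + ρ) / ε)) := by
        refine ofReal_integral_eq_lintegral_ofReal ?_ ?_
        · exact (Continuous.integrableOn_Icc (by fun_prop)).mono_set Set.Ioo_subset_Icc_self
        · refine (ae_restrict_mem measurableSet_Ioo).mono fun y hy => ?_
          have : y / h ≤ 1 := (div_le_one hh0).2 hy.2.le
          exact mul_nonneg (by linarith) (by positivity)
    _ = ∫⁻ y in Set.Ioo 0 h, volume ((fun x => (x, y)) ⁻¹' thinTri ε ρ) :=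
        (setLIntegral_congr_fun measurableSet_Ioo fun y hy => (hslice y hy).symm)
    _ ≤ _ := setLIntegral_le_lintegral _ _

theorem volume_thinTri_ne_top {ε ρ : ℝ} (hε : 0 < ε) (hρ : 0 < ρ) : volume (thinTri ε ρ) ≠ ⊤ := by
  refine ne_top_of_le_ne_top (isCompact_Icc.prod isCompact_Icc :
    IsCompact (Set.Icc (-1 / ε) (ρ / ε) ×ˢ Set.Icc 0 (π * √(2 * ε) * (1 + ρ)))).measure_lt_top.ne
    (measure_mono ?_)
  rintro z ⟨h0, h1, h2⟩
  have hh : 0 < π * √(2 * ε) := by positivity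
  have h3 := pos_of_mul_pos_right (h0.trans h1) hh.le
  have h4 := pos_of_mul_pos_right (h0.trans h2) hh.le
  have h5 : z.1 ≤ ρ / ε := by
    rw [le_div_iff₀ hε]
    have : ε / ρ * z.1 * ρ = z.1 * ε := by field_simp
    nlinarith
  have h6 : -1 / ε ≤ z.1 := by
    rw [div_le_iff₀ hε]; linarith
  refine ⟨⟨h6, h5⟩, h0.le, h1.le.trans (mul_le_mul_of_nonneg_left ?_ hh.le)⟩
  rw [le_div_iff₀ hε] at h5
  linarith

theorem le_volume_of_simChart {b : OrthonormalBasis (Fin 2) ℝ (EuclideanSpace ℝ (Fin 2))}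
    {O : EuclideanSpace ℝ (Fin 2)} {s ε ρ : ℝ} {Ω : Set (EuclideanSpace ℝ (Fin 2))}
    (hs : s ≠ 0) (hΩ : ∀ z, simChart b O s z ∈ Ω ↔ z ∈ thinTri ε ρ) (hΩo : MeasurableSet Ω)
    (hε : 0 < ε) (hρ : 0 < ρ) :
    s ^ 2 * (π * √(2 * ε) * (1 + ρ) / (2 * ε)) ≤ (volume Ω).toReal := by
  have h1 := integral_simChart b O hs (Ω.indicator fun _ => 1)
  have h2 : (fun z => Ω.indicator (fun _ => (1 : ℝ)) (simChart b O s z))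
      = (thinTri ε ρ).indicator fun _ => 1 := by
    ext z
    by_cases hz : z ∈ thinTri ε ρ
    · rw [Set.indicator_of_mem hz, Set.indicator_of_mem ((hΩ z).2 hz)]
    · rw [Set.indicator_of_notMem hz, Set.indicator_of_notMem (mt (hΩ z).1 hz)]
  rw [h2, integral_indicator_const _ hΩo, integral_indicator_const _ isOpen_thinTri.measurableSet,
    smul_eq_mul, mul_one, smul_eq_mul, mul_one] at h1
  rw [← Measure.real, h1]
  refine mul_le_mul_of_nonneg_left ?_ (sq_nonneg s)
  exact (ENNReal.ofReal_le_iff_le_toReal (volume_thinTri_ne_top hε hρ)).1 (le_volume_thinTri hε hρ)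

/-- The interior of a triangle with its longest side on the first coordinate axis. -/
theorem mem_interior_convexHull_triangle
    {b : OrthonormalBasis (Fin 2) ℝ (EuclideanSpace ℝ (Fin 2))}
    {O P Q R : EuclideanSpace ℝ (Fin 2)} {α α' β : ℝ} (hα : 0 < α) (hα' : 0 < α') (hβ : 0 < β)
    (hP : P = O - α • b 0) (hQ : Q = O + α' • b 0) (hR : R = O + β • b 1)
    (hnc : ¬ Collinear ℝ ({P, Q, R} : Set (EuclideanSpace ℝ (Fin 2)))) (x y : ℝ) :
    O + (x • b 0 + y • b 1) ∈ interior (convexHull ℝ {P, Q, R}) ↔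
      0 < y ∧ y < β * (1 + x / α) ∧ y < β * (1 - x / α') := by
  have hind : AffineIndependent ℝ ![P, Q, R] := affineIndependent_iff_not_collinear_set.2 hnc
  have htop : affineSpan ℝ (Set.range ![P, Q, R]) = ⊤ := by
    rw [hind.affineSpan_eq_top_iff_card_eq_finrank_add_one]
    simp
  let B : AffineBasis (Fin 3) ℝ (EuclideanSpace ℝ (Fin 2)) := ⟨![P, Q, R], hind, htop⟩
  have hB : Set.range B = {P, Q, R} := by
    change Set.range ![P, Q, R] = _
    simp only [Matrix.range_cons, Matrix.range_empty, Set.union_empty, Set.singleton_union]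
  let w : Fin 3 → ℝ := ![(α' * (1 - y / β) - x) / (α + α'), (α * (1 - y / β) + x) / (α + α'), y / β]
  have hw : ∑ i, w i = 1 := by
    simp only [w, Fin.sum_univ_three, Matrix.cons_val]
    field_simp
    ring
  have hpt : O + (x • b 0 + y • b 1) = Finset.univ.affineCombination ℝ B w := by
    rw [Finset.affineCombination_eq_linear_combination _ _ _ hw, Fin.sum_univ_three]
    change _ = w 0 • P + w 1 • Q + w 2 • R
    have h0 : w 0 = 1 - w 1 - w 2 := by
      rw [Fin.sum_univ_three] at hw; linarith
    have h1 : x = w 1 * α' - w 0 * α := by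
      simp only [w, Matrix.cons_val]; field_simp; ring
    have h2 : y = w 2 * β := by
      simp only [w, Matrix.cons_val]; field_simp
    rw [hP, hQ, hR, h1, h2, h0]
    module
  rw [← hB, B.interior_convexHull, Set.mem_ofPred_eq, hpt]
  simp only [B.coord_apply_combination_of_mem (Finset.mem_univ _) hw, Fin.forall_fin_succ,
    IsEmpty.forall_iff, and_true]
  change 0 < (α' * (1 - y / β) - x) / (α + α') ∧ 0 < (α * (1 - y / β) + x) / (α + α') ∧ 0 < y / β
    ↔ _
  have hs : 0 < α + α' := by positivity
  rw [div_pos_iff_of_pos_right hs, div_pos_iff_of_pos_right hs, div_pos_iff_of_pos_right hβ,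
    ← div_lt_iff₀' hβ, ← div_lt_iff₀' hβ]
  have e1 : α' * (1 - y / β) - x = α' * (1 - x / α' - y / β) := by field_simp; ring
  have e2 : α * (1 - y / β) + x = α * (1 + x / α - y / β) := by field_simp; ring
  rw [e1, e2, mul_pos_iff_of_pos_left hα', mul_pos_iff_of_pos_left hα, sub_pos, sub_pos]
  tauto

/-- The result for a triangle whose longest side is `PQ` and whose shortest side is `QR`. -/
theorem dirichletEig_gaps_of_ordered_sides {P Q R : EuclideanSpace ℝ (Fin 2)}
    (hnc : ¬ Collinear ℝ ({P, Q, R} : Set (EuclideanSpace ℝ (Fin 2))))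
    (h1 : dist R Q ≤ dist R P) (h2 : dist R P ≤ dist P Q)
    (hdeg : 2 * (volume (interior (convexHull ℝ {P, Q, R}))).toReal / dist P Q ^ 2
      ≤ 1 / 2 * tan (π / 60)) :
    dirichletEig (interior (convexHull ℝ {P, Q, R})) 1
        < dirichletEig (interior (convexHull ℝ {P, Q, R})) 2 ∧
      dirichletEig (interior (convexHull ℝ {P, Q, R})) 2
        < dirichletEig (interior (convexHull ℝ {P, Q, R})) 3 := by
  have hPQ : P ≠ Q := by
    rintro rfl
    exact hnc (by simpa using collinear_pair ℝ P R)
  set w := Q - P with hw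
  set u := R - P with hu
  have hw0 : w ≠ 0 := sub_ne_zero.2 hPQ.symm
  set l := ‖w‖ with hl
  have hl0 : 0 < l := norm_pos_iff.2 hw0
  have hdPQ : dist P Q = l := by rw [dist_comm, dist_eq_norm]
  set α := inner ℝ u w / l with hα
  have huw : inner ℝ u w = α * l := by rw [hα]; field_simp
  set p := u - (α / l) • w with hp
  have hp0 : p ≠ 0 := by
    intro h0
    refine hnc ((collinear_iff_of_mem (p₀ := P) (by simp)).2 ⟨w, ?_⟩)
    simp only [Set.mem_insert_iff, Set.mem_singleton_iff, forall_eq_or_imp, forall_eq, vadd_eq_add]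
    refine ⟨⟨0, by simp⟩, ⟨1, by simp [hw]⟩, ⟨α / l, ?_⟩⟩
    rw [← sub_eq_zero.1 h0, hu]
    abel
  set β := ‖p‖ with hβ
  have hβ0 : 0 < β := norm_pos_iff.2 hp0
  have hww : inner ℝ w w = l ^ 2 := real_inner_self_eq_norm_sq w
  have hwp : inner ℝ w p = 0 := by
    rw [hp, inner_sub_right, inner_smul_right, hww, real_inner_comm, huw]
    field_simp
    ring
  have hnu : ‖u‖ ^ 2 = α ^ 2 + β ^ 2 := by
    have : u = (α / l) • w + p := by rw [hp]; abel
    rw [this, norm_add_sq_real, inner_smul_left, hwp, norm_smul, mul_pow, ← hl, ← hβ,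
      Real.norm_eq_abs, sq_abs]
    field_simp
    simp
  have hα1 : l ≤ 2 * α := by
    rw [dist_eq_norm, dist_eq_norm] at h1
    have e : R - Q = u - w := by rw [hu, hw]; abel
    have h3 := pow_le_pow_left₀ (norm_nonneg _) h1 2
    rw [e, norm_sub_sq_real, huw, ← hl] at h3
    nlinarith
  have hα0 : 0 < α := by linarith
  have hα2 : 0 < l - α := by
    rw [hdPQ, dist_eq_norm] at h2
    have h3 := pow_le_pow_left₀ (norm_nonneg _) h2 2
    rw [← hu, hnu] at h3
    nlinarith [sq_pos_of_pos hβ0]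
  have hcard : Module.finrank ℝ (EuclideanSpace ℝ (Fin 2)) = Fintype.card (Fin 2) := by simp
  have horth : Pairwise fun i j => inner ℝ ((![w, p] : Fin 2 → EuclideanSpace ℝ (Fin 2)) i)
      ((![w, p] : Fin 2 → EuclideanSpace ℝ (Fin 2)) j) = 0 := by
    intro i j hij
    fin_cases i <;> fin_cases j
    exacts [absurd rfl hij, hwp, by rw [real_inner_comm]; exact hwp, absurd rfl hij]
  obtain ⟨b, hb0, hb1⟩ : ∃ b : OrthonormalBasis (Fin 2) ℝ (EuclideanSpace ℝ (Fin 2)),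
      l • b 0 = w ∧ β • b 1 = p := by
    refine ⟨InnerProductSpace.gramSchmidtOrthonormalBasis hcard ![w, p], ?_, ?_⟩
    · rw [InnerProductSpace.gramSchmidtOrthonormalBasis_apply_of_orthogonal
        hcard horth (i := 0) hw0]
      exact smul_inv_smul₀ hl0.ne' w
    · rw [InnerProductSpace.gramSchmidtOrthonormalBasis_apply_of_orthogonal
        hcard horth (i := 1) hp0]
      exact smul_inv_smul₀ hβ0.ne' p
  set O := P + α • b 0 with hO
  have hmem := mem_interior_convexHull_triangle (b := b) (O := O) (P := P) (Q := Q) (R := R)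
    (α' := l - α) hα0 hα2 hβ0 (by rw [hO]; abel)
    (by rw [hO, sub_smul, hb0, hw]; abel)
    (by rw [hO, hb1, hp, hu, ← hb0, smul_smul, div_mul_cancel₀ _ hl0.ne']; abel) hnc
  obtain ⟨ε, hε, hε3⟩ : ∃ ε : ℝ, 0 < ε ∧ 2 * π ^ 2 * ε ^ 3 = (β / α) ^ 2 := by
    refine ⟨((β / α) ^ 2 / (2 * π ^ 2)) ^ (1 / 3 : ℝ), by positivity, ?_⟩
    rw [← rpow_natCast _ 3, ← rpow_mul (by positivity)]
    norm_num
    field_simp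
  set s := α * ε with hs
  have hs0 : 0 < s := by positivity
  set ρ := (l - α) / α with hρ
  have hρ0 : 0 < ρ := by positivity
  have hρ1 : ρ ≤ 1 := (div_le_one hα0).2 (by linarith)
  have hβs : β = s * (π * √(2 * ε)) := by
    rw [← sq_eq_sq₀ hβ0.le (by positivity), mul_pow, mul_pow, mul_pow, sq_sqrt (by positivity)]
    rw [div_pow, eq_div_iff (by positivity)] at hε3
    rw [← hε3]
    ring
  have hΩ : ∀ z, simChart b O s z ∈ interior (convexHull ℝ {P, Q, R}) ↔ z ∈ thinTri ε ρ := by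
    intro z
    have : simChart b O s z = O + ((s * z.1) • b 0 + (s * z.2) • b 1) := by
      rw [simChart, smul_add, smul_smul, smul_smul]
    rw [this, hmem, hβs, mul_assoc s, mul_assoc s, mul_pos_iff_of_pos_left hs0,
      mul_lt_mul_iff_right₀ hs0, mul_lt_mul_iff_right₀ hs0]
    have e1 : s * z.1 / α = ε * z.1 := by rw [hs]; field_simp
    have e2 : s * z.1 / (l - α) = ε / ρ * z.1 := by rw [hs, hρ]; field_simp
    rw [e1, e2]
    rfl
  refine dirichletEig_gaps_of_thinTri hs0.ne' hΩ hε hρ0 hρ1 ?_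
  have hvol := le_volume_of_simChart hs0.ne' hΩ isOpen_interior.measurableSet hε hρ0
  have harea : s ^ 2 * (π * √(2 * ε) * (1 + ρ) / (2 * ε)) = β * l / 2 := by
    have e3 : 1 + ρ = l / α := by rw [hρ]; field_simp; ring
    rw [hβs, e3, hs]
    field_simp
  rw [harea] at hvol
  rw [hdPQ, div_le_iff₀ (by positivity)] at hdeg
  have hβl : β ≤ 0.02622 * l := by
    have := mul_lt_mul_of_pos_right tan_pi_div_sixty_lt (pow_pos hl0 2)
    refine le_of_mul_le_mul_right ?_ hl0
    linarith
  rw [hε3]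
  refine pow_le_pow_left₀ (by positivity) ?_ 2
  have e3 : 1 + ρ = l / α := by rw [hρ]; field_simp; ring
  rw [e3, ← mul_div_assoc]
  gcongr

/-- simplicity of the second Dirichlet eigenvalue on nearly degenerate triangles:
if a non-equilateral triangle `T` with longest side `L` and area `S` satisfies
`2S/L² ≤ (1/2)·tan(π/60)`, then `λ₁(T) < λ₂(T) < λ₃(T)`. -/
theorem second_dirichlet_eigenvalue_simple_of_nearly_degenerate
    (A B C : EuclideanSpace ℝ (Fin 2))
    (hnc : ¬ Collinear ℝ ({A, B, C} : Set (EuclideanSpace ℝ (Fin 2))))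
    (hne : ¬ (dist A B = dist B C ∧ dist B C = dist C A))
    (hdeg : 2 * (volume (interior (convexHull ℝ ({A, B, C} : Set (EuclideanSpace ℝ (Fin 2)))))).toReal /
        (max (dist A B) (max (dist B C) (dist C A))) ^ 2 ≤ (1 / 2) * Real.tan (π / 60)) :
    dirichletEig (interior (convexHull ℝ ({A, B, C} : Set (EuclideanSpace ℝ (Fin 2))))) 1 <
        dirichletEig (interior (convexHull ℝ ({A, B, C} : Set (EuclideanSpace ℝ (Fin 2))))) 2 ∧
      dirichletEig (interior (convexHull ℝ ({A, B, C} : Set (EuclideanSpace ℝ (Fin 2))))) 2 <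
        dirichletEig (interior (convexHull ℝ ({A, B, C} : Set (EuclideanSpace ℝ (Fin 2))))) 3 := by
  have key : ∀ P Q R : EuclideanSpace ℝ (Fin 2), ({A, B, C} : Set _) = {P, Q, R} →
      max (dist A B) (max (dist B C) (dist C A)) = dist P Q → dist R Q ≤ dist R P →
      dist R P ≤ dist P Q → dirichletEig (interior (convexHull ℝ {A, B, C})) 1
        < dirichletEig (interior (convexHull ℝ {A, B, C})) 2 ∧
      dirichletEig (interior (convexHull ℝ {A, B, C})) 2
        < dirichletEig (interior (convexHull ℝ {A, B, C})) 3 := by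
    intro P Q R hset hmax h1 h2
    rw [hmax] at hdeg
    rw [hset] at hnc hdeg ⊢
    exact dirichletEig_gaps_of_ordered_sides hnc h1 h2 hdeg
  have hAB := dist_comm A B
  have hBC := dist_comm B C
  have hCA := dist_comm C A
  have eACB : ({A, B, C} : Set (EuclideanSpace ℝ (Fin 2))) = {A, C, B} := by
    rw [Set.pair_comm]
  have eBAC : ({A, B, C} : Set (EuclideanSpace ℝ (Fin 2))) = {B, A, C} := Set.insert_comm A B {C}
  have eBCA : ({A, B, C} : Set (EuclideanSpace ℝ (Fin 2))) = {B, C, A} := by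
    rw [eBAC, Set.pair_comm]
  have eCAB : ({A, B, C} : Set (EuclideanSpace ℝ (Fin 2))) = {C, A, B} := by
    rw [eACB, Set.insert_comm]
  have eCBA : ({A, B, C} : Set (EuclideanSpace ℝ (Fin 2))) = {C, B, A} := by
    rw [eCAB, Set.pair_comm]
  rcases le_total (dist A B) (dist B C) with h1 | h1 <;>
    rcases le_total (dist B C) (dist C A) with h2 | h2 <;>
    rcases le_total (dist C A) (dist A B) with h3 | h3
  · exact key A C B eACB (by clear key; grind) (by linarith) (by linarith)
  · exact key C A B eCAB (by clear key; grind) (by linarith) (by linarith)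
  · exact key B C A eBCA (by clear key; grind) (by linarith) (by linarith)
  · exact key C B A eCBA (by clear key; grind) (by linarith) (by linarith)
  · exact key A B C rfl (by clear key; grind) (by linarith) (by linarith)
  · exact key A C B eACB (by clear key; grind) (by linarith) (by linarith)
  · exact key B A C eBAC (by clear key; grind) (by linarith) (by linarith)
  · exact key A C B eACB (by clear key; grind) (by linarith) (by linarith)
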